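/- Fix k ≥ 1 and k+2 alphabets p, q^{(0)}, …, q^{(k)}. Then the series G_k^{(α)}(t,p,q^{(0)},…,q^{(k)}) satisfies (B_∞^{(α)}(−t,q^{(0)},u) + ⋯ + B_∞^{(α)}(−t,q^{(k)},u)) · G_k^{(α)} = B_∞^{(α)⊥}(−t,p,u) · G_k^{(α)}, where each B_∞^{(α)}(−t,q^{(j)},u) acts on the alphabet q^{(j)} and B_∞^{(α)⊥}(−t,p,u) is the adjoint acting on p. -/

import Mathlib

open scoped Classical

noncomputable section

/-- The base field `ℚ(α)` of rational functions in the Jack parameter `α`. -/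
abbrev F : Type := RatFunc ℚ

/-- The Jack deformation parameter `α`. -/
def alpha : F := RatFunc.X

/-- An integer partition, encoded as a multiset of positive integers (its parts). -/
abbrev JPartition : Type := Multiset ℕ+

/-- The size `|λ|` of a partition. -/
def psize (l : JPartition) : ℕ := (l.map fun i => (i : ℕ)).sum

/-- The length `ℓ(λ)` of a partition. -/
def plen (l : JPartition) : ℕ := Multiset.card l

/-- `m_i(λ)`, the number of parts of `λ` equal to `i`. -/
def pmult (l : JPartition) (i : ℕ+) : ℕ := Multiset.count i l

/-- `λ ∪ 1^k`, adjoining `k` parts equal to `1`. -/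
def addOnes (l : JPartition) (k : ℕ) : JPartition := l + Multiset.replicate k 1

/-- `λ̃`, the partition obtained by deleting all parts equal to `1`. -/
def removeOnes (l : JPartition) : JPartition := Multiset.filter (fun i => i ≠ 1) l

/-- Exponent vectors of monomials in the power-sum generators `p₁, p₂, …`. -/
abbrev Exp : Type := ℕ+ →₀ ℕ

/-- The exponent vector of the monomial `p_λ`. -/
def toExp (l : JPartition) : Exp := l.toFinset.sum fun i => Finsupp.single i (Multiset.count i l)

/-- The partition corresponding to an exponent vector. -/
def toPart (m : Exp) : JPartition := m.sum fun i k => Multiset.replicate k i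

/-- The weighted degree (`deg p_i = i`) of an exponent vector; this is the size of the
corresponding partition. -/
def wt (m : Exp) : ℕ := m.sum fun i k => k * (i : ℕ)

/-- The algebra `ℚ(α)[p₁, p₂, …]` of symmetric functions written in the power-sum basis. -/
abbrev SymA : Type := MvPolynomial ℕ+ F

/-- The power-sum monomial `p_λ`. -/
def pPow (l : JPartition) : SymA := (l.map fun i => MvPolynomial.X i).prod

/-- `z_λ α^{ℓ(λ)}`, attached to the exponent vector of `p_λ`. -/
def zalpha (m : Exp) : F :=
  algebraMap ℚ F (m.prod fun i k => (Nat.factorial k : ℚ) * ((i : ℕ) : ℚ) ^ k) *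
    alpha ^ (m.sum fun _ k => k)

/-- The `α`-deformed Hall scalar product: `⟨p_λ, p_μ⟩ = δ_{λμ} z_λ α^{ℓ(λ)}`. -/
def hall (f g : SymA) : F :=
  ∑ m ∈ f.support, MvPolynomial.coeff m f * MvPolynomial.coeff m g * zalpha m

/-- The parts of a partition, sorted in weakly decreasing order. -/
def sortedParts (l : JPartition) : List ℕ := ((l.map fun i => (i : ℕ)).sort (· ≤ ·)).reverse

/-- The sum of the `k` largest parts of a partition. -/
def topSum (l : JPartition) (k : ℕ) : ℕ := ((sortedParts l).take k).sum

/-- The dominance order on partitions: `μ ⊴ λ`. -/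
def dominates (mu lam : JPartition) : Prop :=
  psize mu = psize lam ∧ ∀ k, topSum mu k ≤ topSum lam k

/-- Evaluation of a symmetric function (in power-sum coordinates) in `N` variables
`x₁, …, x_N`: it sends `p_i ↦ x₁^i + ⋯ + x_N^i`. -/
def evalN (N : ℕ) : SymA →ₐ[F] MvPolynomial (Fin N) F :=
  MvPolynomial.aeval fun i : ℕ+ => ∑ j : Fin N, MvPolynomial.X j ^ (i : ℕ)

/-- The exponent of the monomial `x₁^{μ₁} ⋯ x_s^{μ_s}` in `N` variables, for `μ` a
partition; its coefficient in a symmetric polynomial is the coefficient of the monomial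
symmetric function `m_μ` (provided `N ≥ ℓ(μ)`). -/
def xexp (mu : JPartition) (N : ℕ) : Fin N →₀ ℕ :=
  Finsupp.equivFunOnFinite.symm fun j => (sortedParts mu).getD (j : ℕ) 0

/-- The defining properties of the family of Jack polynomials `J_λ^{(α)}` (Macdonald's
characterization): orthogonality for the `α`-deformed Hall product, triangularity with
respect to monomial symmetric functions in dominance order, and normalization
`[p_{1^n}] J_λ^{(α)} = 1`. -/
structure IsJackFamily (J : JPartition → SymA) : Prop where
  orthogonal : ∀ l m : JPartition, l ≠ m → hall (J l) (J m) = 0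
  triangular : ∀ l m : JPartition, ¬ dominates m l →
    MvPolynomial.coeff (xexp m (psize l + psize m + plen m))
      (evalN (psize l + psize m + plen m) (J l)) = 0
  normalized : ∀ l : JPartition, MvPolynomial.coeff (Finsupp.single 1 (psize l)) (J l) = 1

/-- The Jack character `θ_μ^{(α)}(λ)`. -/
def theta (J : JPartition → SymA) (mu lam : JPartition) : F :=
  if psize lam < psize mu then 0
  else (Nat.choose (psize lam - psize mu + pmult mu 1) (pmult mu 1) : F) *
    MvPolynomial.coeff (toExp (addOnes mu (psize lam - psize mu))) (J lam)

/-- `g` is the family of structure coefficients of Jack characters: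
`θ_μ^{(α)} θ_ν^{(α)} = ∑_π g^π_{μ,ν}(α) θ_π^{(α)}` (as functions on Young diagrams,
with finitely many nonzero terms). -/
def IsStructCoeffs (J : JPartition → SymA) (g : JPartition → JPartition → JPartition → F) :
    Prop :=
  (∀ mu nu : JPartition, {pi : JPartition | g pi mu nu ≠ 0}.Finite) ∧
  ∀ mu nu lam : JPartition,
    theta J mu lam * theta J nu lam = ∑ᶠ pi : JPartition, g pi mu nu * theta J pi lam


/-- The polynomial algebra `ℚ(α)[p₁,p₂,…][y₀,y₁,…]` containing the catalytic variables. -/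
abbrev PY : Type := MvPolynomial (ℕ+ ⊕ ℕ) F

/-- The variable `p_i` inside `PY`. -/
def pv (i : ℕ+) : PY := MvPolynomial.X (Sum.inl i)

/-- The catalytic variable `y_j` inside `PY`. -/
def yv (j : ℕ) : PY := MvPolynomial.X (Sum.inr j)

/-- The operator `Y₊ = ∑_{i≥0} y_{i+1} ∂/∂y_i`. -/
def Yplus (f : PY) : PY := ∑ᶠ j : ℕ, yv (j + 1) * MvPolynomial.pderiv (Sum.inr j) f

/-- The operator
`Γ_Y = (1+b) ∑_{i,j≥1} y_{i+j} j ∂²/(∂y_{i-1}∂p_j) + ∑_{i,j≥1} y_i p_j ∂/∂y_{i+j-1}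
      + b ∑_{i≥1} y_{i+1} i ∂/∂y_i`, with `b = α - 1`. -/
def GammaY (f : PY) : PY :=
  alpha • (∑ᶠ i : ℕ+, ∑ᶠ j : ℕ+, ((j : ℕ) : F) •
      (yv ((i : ℕ) + (j : ℕ)) *
        MvPolynomial.pderiv (Sum.inl j) (MvPolynomial.pderiv (Sum.inr ((i : ℕ) - 1)) f)))
  + (∑ᶠ i : ℕ+, ∑ᶠ j : ℕ+,
      yv (i : ℕ) * pv j * MvPolynomial.pderiv (Sum.inr ((i : ℕ) + (j : ℕ) - 1)) f)
  + (alpha - 1) • (∑ᶠ i : ℕ+, ((i : ℕ) : F) •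
      (yv ((i : ℕ) + 1) * MvPolynomial.pderiv (Sum.inr (i : ℕ)) f))

/-- The operator `Θ_Y = ∑_{i≥1} p_i ∂/∂y_i`. -/
def ThetaY (f : PY) : PY := ∑ᶠ i : ℕ+, pv i * MvPolynomial.pderiv (Sum.inr (i : ℕ)) f

/-- Ordered composite of the operators `Y₊` (for `true`) and `Γ_Y` (for `false`). -/
def wordOp : List Bool → PY → PY
  | [], f => f
  | b :: w, f => (if b then Yplus else GammaY) (wordOp w f)

/-- Projection `PY → SymA` killing the catalytic variables. -/
def dropY : PY →ₐ[F] SymA :=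
  MvPolynomial.aeval fun v => match v with
    | Sum.inl i => MvPolynomial.X i
    | Sum.inr _ => 0

/-- `Bc n ℓ` is the coefficient of `u^ℓ` in the operator
`B_n^{(α)}(p, u) = Θ_Y (Γ_Y + u Y₊)^n (y₀ / (1+b))`, viewed as an operator on `ℚ(α)[p]`. -/
def Bc (n ℓ : ℕ) (f : SymA) : SymA :=
  dropY (ThetaY (∑ s ∈ Finset.univ.filter
      (fun s : Fin n → Bool => (Finset.univ.filter fun i => s i = true).card = ℓ),
    wordOp (List.ofFn s) (alpha⁻¹ • (yv 0 * MvPolynomial.rename Sum.inl f))))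

/-- Matrix entries of `Bc n ℓ` in the basis of power-sum monomials. -/
def Bmat (n ℓ : ℕ) (m m' : Exp) : F :=
  MvPolynomial.coeff m (Bc n ℓ (MvPolynomial.monomial m' 1))

/-- The adjoint of `Bc n ℓ` with respect to the `α`-deformed Hall scalar product
(`⟨Bperp f, g⟩ = ⟨f, Bc g⟩`), given by its matrix in the power-sum basis. -/
def Bperp (n ℓ : ℕ) (f : SymA) : SymA :=
  ∑ m' ∈ f.support, MvPolynomial.coeff m' f •
    ∑ᶠ m : Exp, (Bmat n ℓ m' m * zalpha m' / zalpha m) • (MvPolynomial.monomial m (1 : F))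



/-- The `p`-coefficient (at `t^K`) of the series
`G_k^{(α)}(t, p, q^{(0)}, …, q^{(k)})
  = ∑ (g^π_{μ^{(0)},…,μ^{(k)}}/(z_π α^{ℓ(π)})) t^{∑|μ^{(j)}|-|π|} p_π ∏_j q^{(j)}_{μ^{(j)}}`
at the multi-index `(μ^{(0)}, …, μ^{(k)})` of monomials in the alphabets
`q^{(0)}, …, q^{(k)}`. -/
def GkSeriesCoef (k : ℕ) (g : (Fin (k + 1) → JPartition) → JPartition → F)
    (mus : Fin (k + 1) → JPartition) (K : ℕ) : SymA :=
  ∑ᶠ pi : JPartition, if psize pi + K = ∑ j, psize (mus j)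
    then (g mus pi / zalpha (toExp pi)) • pPow pi else 0

section
namespace JK
open MvPolynomial (X)
variable {K : Type*} [Field K]

/-- power sums indexed by naturals, with `P 0 = 0` -/
def Pn (n : ℕ) : MvPolynomial ℕ+ K := if h : 0 < n then X ⟨n, h⟩ else 0

@[simp] lemma Pn_zero : (Pn 0 : MvPolynomial ℕ+ K) = 0 := by simp [Pn]
lemma Pn_coe (i : ℕ+) : (Pn (i : ℕ) : MvPolynomial ℕ+ K) = X i := by
  simp only [Pn, i.pos, dif_pos]; rfl

/-- The `y`-linear module. -/
abbrev MM (K : Type*) [Field K] := Polynomial (MvPolynomial ℕ+ K)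

/-- monomial map -/
def mon (k : ℕ) : MvPolynomial ℕ+ K →ₗ[K] MM K :=
  (Polynomial.monomial k : MvPolynomial ℕ+ K →ₗ[MvPolynomial ℕ+ K] MM K).restrictScalars K

lemma mon_apply (k : ℕ) (f : MvPolynomial ℕ+ K) : mon k f = Polynomial.monomial k f := rfl

lemma mon_ind {p : MM K → Prop} (x : MM K) (h0 : ∀ k f, p (mon k f))
    (ha : ∀ x y, p x → p y → p (x + y)) : p x :=
  Polynomial.induction_on' x ha h0

lemma mon_ext {V : Type*} [AddCommGroup V] [Module K V] {A B : MM K →ₗ[K] V}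
    (h : ∀ k f, A (mon k f) = B (mon k f)) : A = B := by
  ext1 x
  induction x using mon_ind with
  | h0 k f => exact h k f
  | ha x y hx hy => simp [hx, hy]

lemma sum_mon_eq {V : Type*} [AddCommGroup V] [Module K V] (A B : MM K →ₗ[K] V)
    (h : ∀ k f, A (mon k f) = B (mon k f)) (x) : A x = B x := by rw [mon_ext h]

def lif {V : Type*} [AddCommGroup V] [Module K V] (φ : ℕ → MvPolynomial ℕ+ K →ₗ[K] V) :
    MM K →ₗ[K] V := Polynomial.lsum φ

@[simp] lemma lif_mon {V : Type*} [AddCommGroup V] [Module K V]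
    (φ : ℕ → MvPolynomial ℕ+ K →ₗ[K] V) (k : ℕ) (f) : lif φ (mon k f) = φ k f := by
  simp [lif, mon_apply, Polynomial.lsum_apply, Polynomial.sum_monomial_index]

/-- multiplication by `Y ^ m` -/
def yp (m : ℕ) : MM K →ₗ[K] MM K := lif fun k => mon (k + m)
def NN : MM K →ₗ[K] MM K := lif fun k => (k : K) • mon k
def ml (f : MvPolynomial ℕ+ K) : MM K →ₗ[K] MM K := lif fun k => mon k ∘ₗ LinearMap.mulLeft K f
def tl (A : MvPolynomial ℕ+ K →ₗ[K] MvPolynomial ℕ+ K) : MM K →ₗ[K] MM K :=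
  lif fun k => mon k ∘ₗ A
def ddD : Derivation K (MvPolynomial ℕ+ K) (MM K) :=
  MvPolynomial.mkDerivation K fun i => ((i : ℕ) : K) • mon (i : ℕ) 1
def dd : MvPolynomial ℕ+ K →ₗ[K] MM K := (ddD : Derivation K (MvPolynomial ℕ+ K) (MM K)).toLinearMap
def dl : MM K →ₗ[K] MM K := lif fun k => yp k ∘ₗ dd
def CC : MM K →ₗ[K] MM K :=
  lif fun k => ∑ j ∈ Finset.range (k + 1), mon (k - j) ∘ₗ LinearMap.mulLeft K (Pn j)
def Th : MM K →ₗ[K] MvPolynomial ℕ+ K := lif fun k => LinearMap.mulLeft K (Pn k)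
def Dm (m : ℕ) : MvPolynomial ℕ+ K →ₗ[K] MvPolynomial ℕ+ K :=
  Th ∘ₗ yp m ∘ₗ dd
def hh (n : ℕ) : MvPolynomial ℕ+ K := ∑ j ∈ Finset.range (n + 1), Pn j * Pn (n - j)

@[simp] lemma yp_mon (m k : ℕ) (f : MvPolynomial ℕ+ K) : yp m (mon k f) = mon (k + m) f := by
  simp [yp]
@[simp] lemma NN_mon (k : ℕ) (f : MvPolynomial ℕ+ K) : NN (mon k f) = (k : K) • mon k f := by
  simp [NN]
@[simp] lemma ml_mon (g : MvPolynomial ℕ+ K) (k : ℕ) (f) : ml g (mon k f) = mon k (g * f) := by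
  simp [ml]
@[simp] lemma tl_mon (A : MvPolynomial ℕ+ K →ₗ[K] MvPolynomial ℕ+ K) (k : ℕ) (f) :
    tl A (mon k f) = mon k (A f) := by simp [tl]
@[simp] lemma dl_mon (k : ℕ) (f : MvPolynomial ℕ+ K) : dl (mon k f) = yp k (dd f) := by simp [dl]
lemma CC_mon (k : ℕ) (f : MvPolynomial ℕ+ K) :
    CC (mon k f) = ∑ j ∈ Finset.range (k + 1), mon (k - j) (Pn j * f) := by simp [CC]
@[simp] lemma Th_mon (k : ℕ) (f : MvPolynomial ℕ+ K) : Th (mon k f) = Pn k * f := by simp [Th]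
lemma Dm_apply (m : ℕ) (f : MvPolynomial ℕ+ K) : Dm m f = Th (yp m (dd f)) := rfl

lemma smul_eq_ml (g : MvPolynomial ℕ+ K) (x : MM K) : g • x = ml g x := by
  induction x using mon_ind with
  | h0 k f => rw [ml_mon, mon_apply, Polynomial.smul_monomial]; rfl
  | ha x y hx hy => simp [hx, hy]

-- commutation
@[simp] lemma yp_yp (m n : ℕ) (x : MM K) : yp m (yp n x) = yp (m + n) x := by
  induction x using mon_ind with
  | h0 k f => simp only [yp_mon]; rw [show k + n + m = k + (m + n) by omega]
  | ha x y hx hy => simp [hx, hy]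
@[simp] lemma yp_zero (x : MM K) : yp 0 x = x := by
  induction x using mon_ind with
  | h0 k f => simp
  | ha x y hx hy => simp [hx, hy]
lemma NN_yp (m : ℕ) (x : MM K) : NN (yp m x) = yp m (NN x) + (m : K) • yp m x := by
  induction x using mon_ind with
  | h0 k f => simp; module
  | ha x y hx hy => simp [hx, hy]; module
lemma ml_yp (g : MvPolynomial ℕ+ K) (m : ℕ) (x : MM K) : ml g (yp m x) = yp m (ml g x) := by
  induction x using mon_ind with
  | h0 k f => simp
  | ha x y hx hy => simp [hx, hy]
lemma NN_ml (g : MvPolynomial ℕ+ K) (x : MM K) : NN (ml g x) = ml g (NN x) := by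
  induction x using mon_ind with
  | h0 k f => simp
  | ha x y hx hy => simp [hx, hy]
lemma CC_ml (g : MvPolynomial ℕ+ K) (x : MM K) : CC (ml g x) = ml g (CC x) := by
  induction x using mon_ind with
  | h0 k f => simp [CC_mon, mul_left_comm]
  | ha x y hx hy => simp [hx, hy]
lemma Th_ml (g : MvPolynomial ℕ+ K) (x : MM K) : Th (ml g x) = g * Th x := by
  induction x using mon_ind with
  | h0 k f => simp [mul_left_comm]
  | ha x y hx hy => simp [hx, hy, mul_add]
lemma tl_yp (A : MvPolynomial ℕ+ K →ₗ[K] MvPolynomial ℕ+ K) (m : ℕ) (x : MM K) :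
    tl A (yp m x) = yp m (tl A x) := by
  induction x using mon_ind with
  | h0 k f => simp
  | ha x y hx hy => simp [hx, hy]
lemma NN_tl (A : MvPolynomial ℕ+ K →ₗ[K] MvPolynomial ℕ+ K) (x : MM K) :
    NN (tl A x) = tl A (NN x) := by
  induction x using mon_ind with
  | h0 k f => simp
  | ha x y hx hy => simp [hx, hy]
lemma dl_yp (m : ℕ) (x : MM K) : dl (yp m x) = yp m (dl x) := by
  induction x using mon_ind with
  | h0 k f => simp only [yp_mon, dl_mon, yp_yp]; rw [Nat.add_comm]
  | ha x y hx hy => simp [hx, hy]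
lemma ml_mul (f g : MvPolynomial ℕ+ K) (x : MM K) : ml (f * g) x = ml f (ml g x) := by
  simp only [← smul_eq_ml, mul_smul]
lemma ml_comm (f g : MvPolynomial ℕ+ K) (x : MM K) : ml f (ml g x) = ml g (ml f x) := by
  rw [← ml_mul, ← ml_mul, mul_comm]
lemma ml_add (f g : MvPolynomial ℕ+ K) (x : MM K) : ml (f + g) x = ml f x + ml g x := by
  simp only [← smul_eq_ml, add_smul]

@[simp] lemma dd_one : dd (1 : MvPolynomial ℕ+ K) = 0 := Derivation.map_one_eq_zero ddD
lemma dd_Pn (i : ℕ) : dd (Pn i : MvPolynomial ℕ+ K) = (i : K) • mon i 1 := by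
  rcases Nat.eq_zero_or_pos i with rfl | h
  · simp
  · have := Pn_coe (K := K) ⟨i, h⟩
    simp only [PNat.mk_coe] at this
    rw [this]; exact MvPolynomial.mkDerivation_X K _ _
lemma dd_mul (f g : MvPolynomial ℕ+ K) : dd (f * g) = ml f (dd g) + ml g (dd f) := by
  rw [← smul_eq_ml, ← smul_eq_ml]; exact Derivation.leibniz ddD f g
lemma dd_Pmul (i : ℕ) (f : MvPolynomial ℕ+ K) :
    dd (Pn i * f) = ml (Pn i) (dd f) + (i : K) • mon i f := by
  rw [dd_mul, dd_Pn]; simp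
lemma dl_Pml (i : ℕ) (x : MM K) :
    dl (ml (Pn i) x) = ml (Pn i) (dl x) + (i : K) • yp i x := by
  induction x using mon_ind with
  | h0 k f => simp [dd_Pmul, ml_yp, add_comm]
  | ha x y hx hy => simp [hx, hy]; module
lemma Dm_P (m i : ℕ) (f : MvPolynomial ℕ+ K) :
    Dm m (Pn i * f) = Pn i * Dm m f + (i : K) • (Pn (m + i) * f) := by
  simp [Dm_apply, dd_Pmul, ← ml_yp, Th_ml, add_comm]
@[simp] lemma Dm_one (m : ℕ) : Dm m (1 : MvPolynomial ℕ+ K) = 0 := by simp [Dm_apply]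

/-- induction principle on the polynomial algebra -/
lemma lam_ind {V : Type*} [AddCommGroup V] [Module K V] (φ : MvPolynomial ℕ+ K →ₗ[K] V)
    (μ : ℕ → V → V) (hμ : ∀ i, μ i 0 = 0)
    (h1 : φ 1 = 0) (hP : ∀ i f, φ (Pn i * f) = μ i (φ f)) (f) : φ f = 0 := by
  induction f using MvPolynomial.induction_on with
  | C a =>
    rw [show (MvPolynomial.C a : MvPolynomial ℕ+ K) = a • 1 by
      rw [MvPolynomial.smul_eq_C_mul, mul_one]]
    simp [h1]
  | add p q hp hq => simp [hp, hq]
  | mul_X p i hp => rw [← Pn_coe, mul_comm, hP, hp, hμ]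

lemma MM_ind (φ : MM K →ₗ[K] MM K)
    (h1 : ∀ k, φ (mon k 1) = 0) (hP : ∀ i x, φ (ml (Pn i) x) = ml (Pn i) (φ x)) (x) :
    φ x = 0 := by
  induction x using mon_ind with
  | h0 k f =>
    refine lam_ind (φ ∘ₗ mon k) (fun i => ml (Pn i)) (by simp) (by simpa using h1 k) ?_ f
    intro i f
    simpa using hP i (mon k f)
  | ha x y hx hy => simp [hx, hy]

lemma tl_Dm_ml (m i : ℕ) (x : MM K) :
    tl (Dm m) (ml (Pn i) x) = ml (Pn i) (tl (Dm m) x) + (i : K) • ml (Pn (m + i)) x := by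
  induction x using mon_ind with
  | h0 k f => simp [Dm_P]
  | ha x y hx hy => simp [hx, hy]; module

lemma NN_dd_Dm (m : ℕ) (f : MvPolynomial ℕ+ K) :
    tl (Dm m) (dd f) = dd (Dm m f) - (m : K) • yp m (dd f) - yp m (NN (dd f)) := by
  have := lam_ind (tl (Dm m) ∘ₗ dd - dd ∘ₗ Dm m + (m : K) • (yp m ∘ₗ dd) + yp m ∘ₗ NN ∘ₗ dd)
    (fun i => ml (Pn i)) (by simp) (by simp) ?_ f
  · simp only [LinearMap.add_apply, LinearMap.sub_apply, LinearMap.comp_apply,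
      LinearMap.smul_apply] at this
    linear_combination (norm := module) this
  · intro i f
    simp only [LinearMap.add_apply, LinearMap.sub_apply, LinearMap.comp_apply,
      LinearMap.smul_apply, dd_Pmul, map_add, map_sub, map_smul, tl_Dm_ml, Dm_P, NN_ml, tl_mon,
      ← ml_yp, NN_mon, yp_mon]
    rw [Nat.add_comm m i]
    push_cast
    module

lemma tl_Dm_dl (m : ℕ) (x : MM K) :
    tl (Dm m) (dl x) = dl (tl (Dm m) x) - (m : K) • yp m (dl x) - yp m (NN (dl x))
      + yp m (dl (NN x)) := by
  induction x using mon_ind with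
  | h0 k f =>
    simp only [dl_mon, tl_yp, NN_dd_Dm, tl_mon, NN_mon, NN_yp, map_add, map_sub, map_smul, yp_yp]
    rw [Nat.add_comm k m]
    module
  | ha x y hx hy => simp only [hx, hy, map_add]; module

lemma CC_dm (m : ℕ) (k : ℕ) (f : MvPolynomial ℕ+ K) :
    tl (Dm m) (CC (mon k f)) = CC (tl (Dm m) (mon k f))
      + ∑ j ∈ Finset.range (k + 1), (j : K) • mon (k - j) (Pn (m + j) * f) := by
  simp only [CC_mon, map_sum, tl_mon, Dm_P, map_add, map_smul, Finset.sum_add_distrib]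

lemma dl_hh (m : ℕ) (x : MM K) : dl (ml (hh m) x) = ml (hh m) (dl x) +
    (2 : K) • ∑ j ∈ Finset.range (m + 1), ((m : K) - j) • yp (m - j) (ml (Pn j) x) := by
  have hml : ∀ x : MM K, ml (hh m) x =
      ∑ j ∈ Finset.range (m + 1), ml (Pn j) (ml (Pn (m - j)) x) := by
    intro x
    simp only [← smul_eq_ml, hh, Finset.sum_smul, mul_smul]
  rw [hml, hml]
  simp only [map_sum, dl_Pml, map_add, map_smul, Finset.sum_add_distrib, two_smul]
  have h1 : ∑ j ∈ Finset.range (m + 1), ((m - j : ℕ) : K) • ml (Pn j) (yp (m - j) x)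
      = ∑ j ∈ Finset.range (m + 1), ((m : K) - j) • yp (m - j) (ml (Pn j) x) := by
    refine Finset.sum_congr rfl fun j hj => ?_
    have : j ≤ m := by simpa [Nat.lt_succ_iff] using hj
    rw [Nat.cast_sub this, ml_yp]
  have h2 : ∑ j ∈ Finset.range (m + 1), (j : K) • yp j (ml (Pn (m - j)) x)
      = ∑ j ∈ Finset.range (m + 1), ((m : K) - j) • yp (m - j) (ml (Pn j) x) := by
    rw [← Finset.sum_range_reflect]
    refine Finset.sum_congr rfl fun j hj => ?_
    have : j ≤ m := by simpa [Nat.lt_succ_iff] using hj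
    rw [show m + 1 - 1 - j = m - j by omega, show m - (m - j) = j by omega, Nat.cast_sub this]
  rw [h1, h2]; abel

/-- The identity `E2`. -/
lemma E2 (m : ℕ) (x : MM K) :
    (2 : K) • (tl (Dm m) (yp 1 (CC x)) - yp 1 (CC (tl (Dm m) x)))
    - (2 : K) • yp 1 (∑ j ∈ Finset.range (m + 1), ((m : K) - j) • yp (m - j) (ml (Pn j) x))
    + (2 : K) • NN (yp 1 (CC (yp m x))) - (2 : K) • yp 1 (CC (yp m x))
    - (2 : K) • yp 1 (CC (yp m (NN x))) = 0 := by
  induction x using mon_ind with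
  | h0 k f =>
    have key : ∑ j ∈ Finset.range (k + 1), (j : K) • mon (k - j + 1) (Pn (m + j) * f)
      - ∑ j ∈ Finset.range (m + 1), ((m : K) - j) • mon (k + (m - j) + 1) (Pn j * f)
      + ∑ j ∈ Finset.range (k + m + 1), ((k + m - j : ℕ) + 1 - 1 - (k : K)) •
        mon (k + m - j + 1) (Pn j * f) = 0 := by
      have a1 : ∑ j ∈ Finset.range (k + m + 1), ((k + m - j : ℕ) + 1 - 1 - (k : K)) •
        mon (k + m - j + 1) (Pn j * f) =
          ∑ j ∈ Finset.range m, ((m : K) - j) • mon (k + (m - j) + 1) (Pn j * f)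
          - ∑ j ∈ Finset.range (k + 1), (j : K) • mon (k - j + 1) (Pn (m + j) * f) := by
        rw [show k + m + 1 = m + (k + 1) by omega, Finset.sum_range_add _ m (k + 1),
          sub_eq_add_neg, ← Finset.sum_neg_distrib]
        refine congrArg₂ _ (Finset.sum_congr rfl fun j hj => ?_)
          (Finset.sum_congr rfl fun j hj => ?_)
        · have : j < m := by simpa using hj
          rw [Nat.cast_sub (by omega), show k + m - j = k + (m - j) by omega]; push_cast; module
        · have : j ≤ k := by simpa [Nat.lt_succ_iff] using hj
          rw [show k + m - (m + j) = k - j by omega, Nat.cast_sub this]; module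
      have a2 := Finset.sum_range_succ
        (fun j => ((m : K) - j) • mon (k + (m - j) + 1) (Pn j * f)) m
      simp only [sub_self, zero_smul, add_zero] at a2
      rw [a1, a2]; abel
    have b1 : ∑ j ∈ Finset.range (k + m + 1), ((k + m - j : ℕ) + 1 - 1 - (k : K)) •
        mon (k + m - j + 1) (Pn j * f) =
        NN (yp 1 (CC (yp m (mon k f)))) - yp 1 (CC (yp m (mon k f)))
        - yp 1 (CC (yp m (NN (mon k f)))) := by
      simp only [NN_mon, map_smul, yp_mon, CC_mon, map_sum]
      rw [Finset.smul_sum, ← Finset.sum_sub_distrib, ← Finset.sum_sub_distrib]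
      refine Finset.sum_congr rfl fun j hj => ?_
      push_cast; module
    have b2 : ∑ j ∈ Finset.range (m + 1), ((m : K) - j) • mon (k + (m - j) + 1) (Pn j * f) =
        yp 1 (∑ j ∈ Finset.range (m + 1), ((m : K) - j) • yp (m - j) (ml (Pn j) (mon k f))) := by
      simp only [map_sum, map_smul, yp_mon, ml_mon]
    have b3 : ∑ j ∈ Finset.range (k + 1), (j : K) • mon (k - j + 1) (Pn (m + j) * f) =
        tl (Dm m) (yp 1 (CC (mon k f))) - yp 1 (CC (tl (Dm m) (mon k f))) := by
      rw [tl_yp, CC_dm]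
      simp only [map_add, map_sum, map_smul, yp_mon]; abel
    rw [b1, b2, b3] at key
    linear_combination (norm := module) (2 : K) • key
  | ha x y hx hy =>
    simp only [map_add, smul_add, Finset.sum_add_distrib]
    linear_combination (norm := module) hx + hy
end JK
end

section
namespace JK
open MvPolynomial (X)
variable {K : Type*} [Field K]

def Gam (al u : K) : MM K →ₗ[K] MM K :=
  al • (yp 1 ∘ₗ dl) + yp 1 ∘ₗ CC + (al - 1) • (yp 1 ∘ₗ NN) + u • yp 1
def RR (al u : K) : MvPolynomial ℕ+ K →ₗ[K] MvPolynomial ℕ+ K := Th ∘ₗ Gam al u ∘ₗ dd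
def Rh (al u : K) : MM K →ₗ[K] MM K :=
  tl (RR al u) + (2 * al) • (yp 1 ∘ₗ dl ∘ₗ NN) + (2 : K) • (NN ∘ₗ yp 1 ∘ₗ CC) - yp 1 ∘ₗ CC
   + (al - 1) • (yp 1 ∘ₗ NN ∘ₗ NN) + u • (yp 1 ∘ₗ NN)

lemma Gam_apply (al u : K) (x : MM K) : Gam al u x =
    al • yp 1 (dl x) + yp 1 (CC x) + (al - 1) • yp 1 (NN x) + u • yp 1 x := rfl
lemma RR_apply (al u : K) (f) : RR al u f = Th (Gam al u (dd f)) := rfl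
lemma Rh_apply (al u : K) (x : MM K) : Rh al u x =
    tl (RR al u) x + (2 * al) • yp 1 (dl (NN x)) + (2 : K) • NN (yp 1 (CC x)) - yp 1 (CC x)
   + (al - 1) • yp 1 (NN (NN x)) + u • yp 1 (NN x) := rfl

lemma Gam_P (al u : K) (i : ℕ) (x : MM K) :
    Gam al u (ml (Pn i) x) = ml (Pn i) (Gam al u x) + (al * i) • yp (i + 1) x := by
  simp only [Gam_apply, dl_Pml, map_add, map_smul, NN_ml, CC_ml, ml_yp, yp_yp]
  rw [Nat.add_comm 1 i]; module

lemma Th_yC (i : ℕ) (f : MvPolynomial ℕ+ K) : Th (yp 1 (CC (mon i f))) = hh (i + 1) * f := by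
  simp only [CC_mon, map_sum, yp_mon, Th_mon, hh, Finset.sum_mul]
  rw [Finset.sum_range_succ _ (i + 1)]
  simp only [Nat.sub_self, Pn_zero, mul_zero, zero_mul, add_zero]
  refine Finset.sum_congr rfl fun j hj => ?_
  have : j ≤ i := by simpa [Nat.lt_succ_iff] using hj
  rw [show i - j + 1 = i + 1 - j by omega]; ring

lemma RR_P (al u : K) (i : ℕ) (f : MvPolynomial ℕ+ K) :
    RR al u (Pn i * f) = Pn i * RR al u f + (i : K) • ((2 * al) • Dm (i + 1) f
      + hh (i + 1) * f + ((al - 1) * i + u) • (Pn (i + 1) * f)) := by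
  simp only [RR_apply, dd_Pmul, map_add, map_smul, Gam_P, Th_ml, Gam_apply al u (mon i f),
    dl_mon, yp_yp, Th_yC, NN_mon, yp_mon, Th_mon, ← Dm_apply]
  rw [Nat.add_comm 1 i]; module

lemma RR_one (al u : K) : RR al u 1 = 0 := by simp [RR_apply]

def QQ (al u : K) (i : ℕ) (x : MM K) : MM K := (2 * al) • tl (Dm (i + 1)) x + ml (hh (i + 1)) x
  + ((al - 1) * i + u) • ml (Pn (i + 1)) x + (2 * al) • yp (i + 1) (NN x)

lemma tl_RR_P (al u : K) (i : ℕ) (x : MM K) :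
    tl (RR al u) (ml (Pn i) x) = ml (Pn i) (tl (RR al u) x) + (i : K) • ((2 * al) •
      tl (Dm (i + 1)) x + ml (hh (i + 1)) x + ((al - 1) * i + u) • ml (Pn (i + 1)) x) := by
  induction x using mon_ind with
  | h0 k f => simp only [tl_mon, ml_mon, RR_P, map_add, map_smul]
  | ha x y hx hy => simp only [map_add, hx, hy]; module

lemma Rh_P (al u : K) (i : ℕ) (x : MM K) :
    Rh al u (ml (Pn i) x) = ml (Pn i) (Rh al u x) + (i : K) • QQ al u i x := by
  simp only [Rh_apply, QQ, tl_RR_P, NN_ml, CC_ml, map_add, map_sub, map_smul, dl_Pml, ml_yp,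
    yp_yp, ← ml_yp]
  rw [Nat.add_comm 1 i]; module

lemma QGam (al u : K) (i : ℕ) (x : MM K) :
    QQ al u i (Gam al u x) - (Gam al u (QQ al u i x)) + al • Rh al u (yp (i + 1) x)
    - al • yp (i + 1) (Rh al u x) - al • yp (i + 1) (Gam al u x) - al • Gam al u (yp (i + 1) x)
    = 0 := by
  have e2 := E2 (i + 1) x
  have hd := dl_hh (i + 1) x
  have hD := tl_Dm_dl (i + 1) x
  simp only [QQ, Gam_apply, Rh_apply, map_add, map_sub, map_smul, tl_yp, ml_yp, CC_ml, NN_ml,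
    dl_yp, dl_Pml, NN_yp, NN_tl, hd, hD, yp_yp, ← ml_yp] at e2 ⊢
  simp only [ml_yp] at e2 ⊢
  rw [Nat.add_comm 1 (i + 1)]
  push_cast at e2 ⊢
  linear_combination (norm := module) al • e2

lemma quad (k : ℕ) : ∑ j ∈ Finset.range (k + 1), ∑ i ∈ Finset.range (k + 1 - j + 1),
      (1 - 2 * (i : K)) • (mon (k + 2 - i - j) (Pn i * Pn j) : MM K)
     + ∑ j ∈ Finset.range (k + 1), (j : K) • mon (k + 1 - j) (hh (j + 1)) = 0 := by
  have h1 : ∑ j ∈ Finset.range (k + 1), ∑ i ∈ Finset.range (k + 1 - j + 1),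
      (1 - 2 * (i : K)) • (mon (k + 2 - i - j) (Pn i * Pn j) : MM K) =
      ∑ j ∈ Finset.range (k + 2), ∑ i ∈ Finset.range (k + 2 - j),
      (1 - 2 * (i : K)) • (mon (k + 2 - i - j) (Pn i * Pn j) : MM K) := by
    rw [Finset.sum_range_succ _ (k + 1)]
    rw [show k + 2 - (k + 1) = 1 by omega]
    simp only [Finset.range_one, Finset.sum_singleton, Pn_zero, zero_mul, map_zero, smul_zero,
      add_zero]
    refine Finset.sum_congr rfl fun j hj => ?_
    have : j ≤ k := by simpa [Nat.lt_succ_iff] using hj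
    rw [show k + 1 - j + 1 = k + 2 - j by omega]
  rw [h1, ← Finset.sum_range_diag_flip (k + 2)
    (fun j i => (1 - 2 * (i : K)) • (mon (k + 2 - i - j) (Pn i * Pn j) : MM K))]
  have h2 : ∑ j ∈ Finset.range (k + 1), (j : K) • (mon (k + 1 - j) (hh (j + 1)) : MM K)
     = ∑ n ∈ Finset.range (k + 2), ((n : K) - 1) • mon (k + 2 - n) (hh n) := by
    rw [Finset.sum_range_succ' _ (k + 1)]
    simp only [hh, Finset.range_one, zero_add, Finset.sum_singleton, Pn_zero, zero_mul, map_zero,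
      smul_zero, add_zero]
    refine Finset.sum_congr rfl fun j hj => ?_
    rw [show k + 2 - (j + 1) = k + 1 - j by omega]; push_cast; simp
  rw [h2, ← Finset.sum_add_distrib]
  refine Finset.sum_eq_zero fun n hn => ?_
  have e1 : ∑ j ∈ Finset.range (n + 1), (1 - 2 * ((n - j : ℕ) : K)) •
      (mon (k + 2 - (n - j) - j) (Pn (n - j) * Pn j) : MM K) =
      ∑ j ∈ Finset.range (n + 1), (1 - 2 * (n : K) + 2 * j) •
      (mon (k + 2 - n) (Pn (n - j) * Pn j) : MM K) := by
    refine Finset.sum_congr rfl fun j hj => ?_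
    have : j ≤ n := by simpa [Nat.lt_succ_iff] using hj
    rw [show k + 2 - (n - j) - j = k + 2 - n by omega, Nat.cast_sub this]; module
  have e2 : ∑ j ∈ Finset.range (n + 1), (j : K) •
      (mon (k + 2 - n) (Pn (n - j) * Pn j) : MM K) =
      ∑ j ∈ Finset.range (n + 1), ((n : K) - j) •
      (mon (k + 2 - n) (Pn (n - j) * Pn j) : MM K) := by
    rw [← Finset.sum_range_reflect]
    refine Finset.sum_congr rfl fun j hj => ?_
    have : j ≤ n := by simpa [Nat.lt_succ_iff] using hj
    rw [show n + 1 - 1 - j = n - j by omega, show n - (n - j) = j by omega, Nat.cast_sub this,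
      mul_comm]
  have e3 : (mon (k + 2 - n) (hh n) : MM K) = ∑ j ∈ Finset.range (n + 1),
      (mon (k + 2 - n) (Pn (n - j) * Pn j) : MM K) := by
    simp only [hh, map_sum, mul_comm]
  have e4 : ∑ j ∈ Finset.range (n + 1), (1 - 2 * (n : K) + 2 * j) •
      (mon (k + 2 - n) (Pn (n - j) * Pn j) : MM K) =
      (1 - 2 * (n : K)) • ∑ j ∈ Finset.range (n + 1), (mon (k + 2 - n) (Pn (n - j) * Pn j) : MM K)
      + ∑ j ∈ Finset.range (n + 1), (j : K) • (mon (k + 2 - n) (Pn (n - j) * Pn j) : MM K)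
      + ∑ j ∈ Finset.range (n + 1), (j : K) • (mon (k + 2 - n) (Pn (n - j) * Pn j) : MM K) := by
    rw [Finset.smul_sum, ← Finset.sum_add_distrib, ← Finset.sum_add_distrib]
    refine Finset.sum_congr rfl fun j hj => ?_
    module
  rw [e1, e3, e4]
  nth_rewrite 1 [e2]
  simp only [sub_smul, Finset.sum_sub_distrib, ← Finset.smul_sum]
  module
end JK
end

section
namespace JK
open MvPolynomial (X)
variable {K : Type*} [Field K]

lemma Gam_Y (al u : K) (k : ℕ) : Gam al u (mon k 1) =
    ∑ j ∈ Finset.range (k + 1), ml (Pn j) (mon (k + 1 - j) 1)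
      + ((al - 1) * k + u) • mon (k + 1) 1 := by
  simp only [Gam_apply, dl_mon, dd_one, map_zero, smul_zero, zero_add, CC_mon, map_sum, yp_mon,
    NN_mon, map_smul, ml_mon]
  rw [Finset.sum_congr rfl (g := fun j => mon (k + 1 - j) (Pn j * 1))]
  · module
  · intro j hj
    have : j ≤ k := by simpa [Nat.lt_succ_iff] using hj
    rw [show k - j + 1 = k + 1 - j by omega]

lemma Rh_Y (al u : K) (k : ℕ) : Rh al u (mon k 1) =
    ∑ j ∈ Finset.range (k + 1), (2 * (k + 1 - j : K) - 1) • ml (Pn j) (mon (k + 1 - j) 1)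
      + ((al - 1) * k * k + u * k) • mon (k + 1) 1 := by
  simp only [Rh_apply, tl_mon, RR_one, dl_mon, dd_one, map_zero, smul_zero, zero_add, CC_mon,
    map_sum, yp_mon, NN_mon, map_smul, ml_mon]
  rw [Finset.smul_sum, ← Finset.sum_sub_distrib]
  rw [Finset.sum_congr rfl
    (g := fun j : ℕ => (2 * (k + 1 - j : K) - 1) • mon (k + 1 - j) (Pn j * 1))]
  · module
  · intro j hj
    have : j ≤ k := by simpa [Nat.lt_succ_iff] using hj
    rw [show k - j + 1 = k + 1 - j by omega, Nat.cast_sub (by omega)]; push_cast; module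

lemma QQ_Y (al u : K) (j c : ℕ) : QQ al u j (mon c 1) = ml (hh (j + 1)) (mon c 1)
    + ((al - 1) * j + u) • ml (Pn (j + 1)) (mon c 1) + (2 * al * c) • mon (c + j + 1) 1 := by
  simp only [QQ, tl_mon, Dm_one, map_zero, smul_zero, zero_add, NN_mon, map_smul, yp_mon]
  rw [← add_assoc c j 1]; module

lemma Z_A (al u : K) (k : ℕ) : Rh al u (Gam al u (mon k 1)) = ∑ j ∈ Finset.range (k + 1),
      (ml (Pn j) (Rh al u (mon (k + 1 - j) 1)) + (j : K) • QQ al u j (mon (k + 1 - j) 1))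
      + ((al - 1) * k + u) • Rh al u (mon (k + 1) 1) := by
  conv_lhs => rw [Gam_Y]
  simp only [map_add, map_sum, map_smul, Rh_P]

lemma Gam_PY (al u : K) (k j : ℕ) (hj : j ∈ Finset.range (k + 1)) :
    Gam al u (ml (Pn j) (mon (k + 1 - j) 1)) = ml (Pn j) (Gam al u (mon (k + 1 - j) 1))
        + (al * j) • mon (k + 2) 1 := by
  have : j ≤ k := by simpa [Nat.lt_succ_iff] using hj
  rw [Gam_P, yp_mon, show k + 1 - j + (j + 1) = k + 2 by omega]

lemma Z_B (al u : K) (k : ℕ) : Gam al u (Rh al u (mon k 1)) = ∑ j ∈ Finset.range (k + 1),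
      (2 * (k + 1 - j : K) - 1) • (ml (Pn j) (Gam al u (mon (k + 1 - j) 1))
        + (al * j) • mon (k + 2) 1)
      + ((al - 1) * k * k + u * k) • Gam al u (mon (k + 1) 1) := by
  conv_lhs => rw [Rh_Y]
  rw [map_add, map_sum, map_smul]
  refine congrArg₂ (· + ·) (Finset.sum_congr rfl fun j hj => ?_) rfl
  rw [map_smul, Gam_PY _ _ _ _ hj]

lemma Z_C (al u : K) (k : ℕ) : Gam al u (Gam al u (mon k 1)) = ∑ j ∈ Finset.range (k + 1),
      (ml (Pn j) (Gam al u (mon (k + 1 - j) 1))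
        + (al * j) • mon (k + 2) 1)
      + ((al - 1) * k + u) • Gam al u (mon (k + 1) 1) := by
  conv_lhs => rw [Gam_Y]
  rw [map_add, map_sum, map_smul]
  refine congrArg₂ (· + ·) (Finset.sum_congr rfl fun j hj => ?_) rfl
  rw [Gam_PY _ _ _ _ hj]

lemma Z_T (al u : K) (k j : ℕ) (hj : j ∈ Finset.range (k + 1)) :
      (ml (Pn j) (Rh al u (mon (k + 1 - j) 1)) + (j : K) • QQ al u j (mon (k + 1 - j) 1))
      - (2 * (k + 1 - j : K) - 1) • (ml (Pn j) (Gam al u (mon (k + 1 - j) 1))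
        + (al * j) • mon (k + 2) 1) - (ml (Pn j) (Gam al u (mon (k + 1 - j) 1))
        + (al * j) • mon (k + 2) 1)
      = (∑ i ∈ Finset.range (k + 1 - j + 1), (1 - 2 * (i : K)) •
          (mon (k + 2 - i - j) (Pn i * Pn j) : MM K)
        + (j : K) • mon (k + 1 - j) (hh (j + 1)))
        + (((j : K) * ((al - 1) * j + u)) • mon (k + 1 - j) (Pn (j + 1))
        - ((k + 1 - j : K) * ((al - 1) * (k + 1 - j) + u)) • mon (k + 2 - j) (Pn j)) := by
  have hjk : j ≤ k := by simpa [Nat.lt_succ_iff] using hj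
  obtain ⟨c, rfl⟩ : ∃ c, k = j + c := ⟨k - j, by omega⟩
  rw [show j + c + 1 - j = c + 1 by omega]
  rw [Rh_Y, Gam_Y, QQ_Y]
  have e1 : ∑ i ∈ Finset.range (c + 1 + 1), (1 - 2 * (i : K)) •
        (mon (j + c + 2 - i - j) (Pn i * Pn j) : MM K)
      = ml (Pn j) (∑ i ∈ Finset.range (c + 1 + 1), (2 * ((c + 1 : ℕ) + 1 - i : K) - 1) •
         ml (Pn i) (mon (c + 1 + 1 - i) 1))
      - (2 * (c + 1 : K)) • ml (Pn j) (∑ i ∈ Finset.range (c + 1 + 1),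
         ml (Pn i) (mon (c + 1 + 1 - i) 1)) := by
    rw [map_sum, map_sum, Finset.smul_sum, ← Finset.sum_sub_distrib]
    refine Finset.sum_congr rfl fun i hi => ?_
    rw [map_smul, ml_mon, ml_mon, show c + 1 + 1 - i = j + c + 2 - i - j by omega, mul_one,
      mul_comm (Pn j)]
    push_cast; module
  rw [e1, map_add, map_add, map_smul, map_smul, ml_mon, ml_mon, ml_mon,
    show j + c + 2 - j = c + 1 + 1 by omega, show c + 1 + j + 1 = j + c + 2 by omega]
  simp only [mul_one]
  push_cast
  module

lemma Z_L (al u : K) (k : ℕ) :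
    Rh al u (mon (k + 1) 1) - (k + 1 : K) • Gam al u (mon (k + 1) 1)
      = ∑ i ∈ Finset.range (k + 2), (k + 2 - 2 * i : K) • mon (k + 2 - i) (Pn i) := by
  rw [Rh_Y, Gam_Y]
  have : ∑ i ∈ Finset.range (k + 2), (k + 2 - 2 * i : K) • (mon (k + 2 - i) (Pn i) : MM K)
     = ∑ j ∈ Finset.range (k + 1 + 1), (2 * ((k + 1 : ℕ) + 1 - j : K) - 1) •
        ml (Pn j) (mon (k + 1 + 1 - j) 1) - (k + 1 : K) • ∑ j ∈ Finset.range (k + 1 + 1),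
        ml (Pn j) (mon (k + 1 + 1 - j) 1) := by
    rw [Finset.smul_sum, ← Finset.sum_sub_distrib]
    refine Finset.sum_congr rfl fun j hj => ?_
    rw [ml_mon, mul_one]
    push_cast; module
  rw [this]
  push_cast; module

lemma Z_lin (al u : K) (k : ℕ) :
    ∑ j ∈ Finset.range (k + 1), (((j : K) * ((al - 1) * j + u)) • mon (k + 1 - j) (Pn (j + 1))
      - ((k + 1 - j : K) * ((al - 1) * (k + 1 - j) + u)) • (mon (k + 2 - j) (Pn j) : MM K))
    + ((al - 1) * k + u) •
      ∑ i ∈ Finset.range (k + 2), (k + 2 - 2 * i : K) • (mon (k + 2 - i) (Pn i) : MM K) = 0 := by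
  have h1 : ∑ j ∈ Finset.range (k + 1), ((j : K) * ((al - 1) * j + u)) •
      (mon (k + 1 - j) (Pn (j + 1)) : MM K) = ∑ i ∈ Finset.range (k + 2),
      ((i - 1 : K) * ((al - 1) * (i - 1) + u)) • (mon (k + 2 - i) (Pn i) : MM K) := by
    rw [Finset.sum_range_succ' _ (k + 1)]
    simp only [Pn_zero, map_zero, smul_zero, add_zero]
    refine Finset.sum_congr rfl fun j hj => ?_
    rw [show k + 2 - (j + 1) = k + 1 - j by omega]; push_cast; simp
  have h2 : ∑ j ∈ Finset.range (k + 1), ((k + 1 - j : K) * ((al - 1) * (k + 1 - j) + u)) •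
      (mon (k + 2 - j) (Pn j) : MM K) = ∑ j ∈ Finset.range (k + 2),
      ((k + 1 - j : K) * ((al - 1) * (k + 1 - j) + u)) • (mon (k + 2 - j) (Pn j) : MM K) := by
    rw [Finset.sum_range_succ _ (k + 1)]
    push_cast
    rw [sub_self, zero_mul, zero_smul, add_zero]
  rw [Finset.sum_sub_distrib, h1, h2, ← Finset.sum_sub_distrib, Finset.smul_sum,
    ← Finset.sum_add_distrib]
  refine Finset.sum_eq_zero fun j hj => ?_
  module

lemma Z_Y (al u : K) (k : ℕ) : Rh al u (Gam al u (mon k 1)) =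
    Gam al u (Rh al u (mon k 1)) + Gam al u (Gam al u (mon k 1)) := by
  have hT := Finset.sum_congr rfl (fun j hj => Z_T al u k j hj)
  rw [Finset.sum_sub_distrib, Finset.sum_sub_distrib, Finset.sum_add_distrib (s := _)
    (f := fun j => _ + _), Finset.sum_add_distrib (f := fun j => ∑ i ∈ _, _), quad] at hT
  have hL := Z_L al u k
  have hl := Z_lin al u k
  rw [Z_A, Z_B, Z_C]
  rw [← hL] at hl
  linear_combination (norm := module) hT + hl

/-- `[R̂, Γ] = Γ²` -/
theorem Rh_Gam (al u : K) (x : MM K) : Rh al u (Gam al u x) =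
    Gam al u (Rh al u x) + Gam al u (Gam al u x) := by
  have := MM_ind (Rh al u ∘ₗ Gam al u - Gam al u ∘ₗ Rh al u - Gam al u ∘ₗ Gam al u) ?_ ?_ x
  · simp only [LinearMap.sub_apply, LinearMap.comp_apply] at this
    linear_combination (norm := module) this
  · intro k
    simp only [LinearMap.sub_apply, LinearMap.comp_apply, Z_Y]
    abel
  · intro i x
    have := QGam al u i x
    simp only [LinearMap.sub_apply, LinearMap.comp_apply, Gam_P, Rh_P, map_add, map_smul, map_sub]
    linear_combination (norm := module) (i : K) • this

end JK
end

section
namespace JK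
open MvPolynomial (X)
variable {K : Type*} [Field K]

lemma Th_NyC (i : ℕ) (f : MvPolynomial ℕ+ K) :
    (2 : K) • Th (NN (yp 1 (CC (mon i f)))) = (i + 1 : K) • (hh (i + 1) * f) := by
  have h1 : Th (NN (yp 1 (CC (mon i f)))) = ∑ j ∈ Finset.range (i + 2),
      (i + 1 - j : K) • (Pn j * Pn (i + 1 - j) * f) := by
    simp only [CC_mon, map_sum, yp_mon, NN_mon, map_smul, Th_mon]
    rw [Finset.sum_range_succ _ (i + 1)]
    simp only [Nat.sub_self, Pn_zero, mul_zero, zero_mul, add_zero, smul_zero]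
    refine Finset.sum_congr rfl fun j hj => ?_
    have : j ≤ i := by simpa [Nat.lt_succ_iff] using hj
    rw [show i - j + 1 = i + 1 - j by omega, Nat.cast_sub (by omega), mul_left_comm, mul_assoc]
    push_cast; rfl
  have h2 : Th (NN (yp 1 (CC (mon i f)))) = ∑ j ∈ Finset.range (i + 2),
      (j : K) • (Pn j * Pn (i + 1 - j) * f) := by
    rw [h1, ← Finset.sum_range_reflect]
    refine Finset.sum_congr rfl fun j hj => ?_
    have : j ≤ i + 1 := by simpa [Nat.lt_succ_iff] using hj
    rw [show i + 2 - 1 - j = i + 1 - j by omega, Nat.cast_sub (by omega),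
      show i + 1 - (i + 1 - j) = j by omega, mul_comm (Pn j)]
    push_cast
    rw [sub_sub_cancel]
  rw [two_smul]
  nth_rewrite 1 [h1]
  rw [h2, ← Finset.sum_add_distrib, hh, Finset.sum_mul, Finset.smul_sum]
  refine Finset.sum_congr rfl fun j hj => ?_
  module

lemma Th_Rh (al u : K) (x : MM K) : Th (Rh al u x) = RR al u (Th x) := by
  induction x using mon_ind with
  | h0 i f =>
    rw [Th_mon, RR_P]
    simp only [Rh_apply, map_add, map_sub, map_smul, tl_mon, Th_mon, NN_mon, Th_NyC, Th_yC,
      dl_mon, yp_yp, ← Dm_apply, yp_mon]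
    rw [Nat.add_comm 1 i]; module
  | ha x y hx hy => simp only [map_add, hx, hy]

lemma Rh_mon0 (al u : K) (f) : Rh al u (mon 0 f) = mon 0 (RR al u f) := by
  simp [Rh_apply, CC_mon]

lemma Rh_Gam_pow (al u : K) (n : ℕ) (x : MM K) : Rh al u ((Gam al u ^ n) x) =
    (Gam al u ^ n) (Rh al u x) + (n : K) • (Gam al u ^ (n + 1)) x := by
  induction n generalizing x with
  | zero => simp
  | succ n ih =>
    have e : ∀ (m : ℕ) (z : MM K), (Gam al u ^ (m + 1)) z = Gam al u ((Gam al u ^ m) z) :=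
      fun m z => by rw [pow_succ', Module.End.mul_apply]
    rw [e n x, Rh_Gam, ih, e n (Rh al u x), e (n + 1), map_add, map_smul, e n x]
    push_cast; module

/-- The operators `B_n(u)`. -/
def BB (al u : K) (n : ℕ) : Module.End K (MvPolynomial ℕ+ K) :=
  al⁻¹ • (Th ∘ₗ (Gam al u ^ n) ∘ₗ mon 0)

lemma BB_apply (al u : K) (n : ℕ) (f) : BB al u n f = al⁻¹ • Th ((Gam al u ^ n) (mon 0 f)) := rfl

/-- `[R, B_n] = n B_{n+1}` -/
theorem RR_BB (al u : K) (n : ℕ) : (RR al u : Module.End K (MvPolynomial ℕ+ K)) * BB al u n =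
    BB al u n * RR al u + (n : K) • BB al u (n + 1) := by
  refine LinearMap.ext fun f => ?_
  simp only [Module.End.mul_apply, LinearMap.add_apply, LinearMap.smul_apply, BB_apply, map_smul,
    ← Th_Rh, Rh_Gam_pow, Rh_mon0, map_add]
  module

lemma BB_zero (al u : K) : BB al u 0 = 0 := by
  refine LinearMap.ext fun f => ?_; simp [BB_apply]

lemma BB_one (al u : K) (hal : al ≠ 0) (f) :
    BB al u 1 f = Dm 1 f + (u / al) • (Pn 1 * f) := by
  simp [BB_apply, Gam_apply, CC_mon, Dm_apply, smul_smul, hal, div_eq_inv_mul]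

def LL : Module.End K (MvPolynomial ℕ+ K) := Dm 0
def d1 : Module.End K (MvPolynomial ℕ+ K) := (MvPolynomial.pderiv (1 : ℕ+)).toLinearMap

lemma LL_P (i : ℕ) (f : MvPolynomial ℕ+ K) : LL (Pn i * f) = Pn i * LL f + (i : K) • (Pn i * f) := by
  rw [LL, Dm_P, zero_add]

lemma d1_P (i : ℕ) (f : MvPolynomial ℕ+ K) :
    d1 (Pn i * f) = Pn i * d1 f + (if i = 1 then f else 0) := by
  have : d1 (Pn i * f) = Pn i * d1 f + d1 (Pn i) * f := by
    change MvPolynomial.pderiv (1 : ℕ+) _ = _ * MvPolynomial.pderiv (1 : ℕ+) _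
      + MvPolynomial.pderiv (1 : ℕ+) _ * _
    rw [Derivation.leibniz]; simp [mul_comm]
  rw [this]
  congr 1
  rcases Nat.eq_zero_or_pos i with rfl | h
  · simp
  · lift i to ℕ+ using h
    rw [Pn_coe]
    change MvPolynomial.pderiv (1 : ℕ+) _ * _ = _
    by_cases h1 : i = 1
    · subst h1; simp
    · rw [MvPolynomial.pderiv_X_of_ne h1, if_neg (by simpa using h1), zero_mul]

@[simp] lemma d1_one : d1 (1 : MvPolynomial ℕ+ K) = 0 := by
  change MvPolynomial.pderiv (1 : ℕ+) _ = _
  simp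
@[simp] lemma LL_one : LL (1 : MvPolynomial ℕ+ K) = 0 := Dm_one 0

lemma d1_Dm (m : ℕ) (hm : 1 ≤ m) (f : MvPolynomial ℕ+ K) : d1 (Dm m f) = Dm m (d1 f) := by
  have := lam_ind (d1 ∘ₗ Dm m - Dm m ∘ₗ d1) (fun i => (Pn i * ·)) (by simp) (by simp) ?_ f
  · simp only [LinearMap.sub_apply, LinearMap.comp_apply] at this
    exact sub_eq_zero.1 this
  · intro i f
    simp only [LinearMap.sub_apply, LinearMap.comp_apply, Dm_P, d1_P, map_add, map_smul]
    rcases Nat.eq_zero_or_pos i with rfl | hi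
    · simp
    · rw [if_neg (by omega : ¬ (m + i = 1))]
      split_ifs <;> simp <;> ring

lemma d1_LL (f : MvPolynomial ℕ+ K) : d1 (LL f) = LL (d1 f) + d1 f := by
  have := lam_ind (d1 ∘ₗ LL - LL ∘ₗ d1 - d1) (fun i => (Pn i * ·)) (by simp) (by simp) ?_ f
  · simp only [LinearMap.sub_apply, LinearMap.comp_apply] at this
    linear_combination this
  · intro i f
    simp only [LinearMap.sub_apply, LinearMap.comp_apply, LL_P, d1_P, map_add, map_smul]
    split_ifs with h
    · subst h; simp; ring
    · simp; ring

lemma d1_hh (i : ℕ) (f : MvPolynomial ℕ+ K) :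
    d1 (hh (i + 1) * f) = hh (i + 1) * d1 f + (2 : K) • (Pn i * f) := by
  simp only [hh, Finset.sum_mul, map_sum]
  have : ∀ j ∈ Finset.range (i + 1 + 1), d1 (Pn j * Pn (i + 1 - j) * f) =
      Pn j * Pn (i + 1 - j) * d1 f + ((if i = j then Pn i * f else 0)
       + if j = 1 then Pn i * f else 0) := by
    intro j hj
    rw [mul_assoc, d1_P, d1_P]
    have h3 : (i + 1 - j = 1) ↔ i = j := by simp at hj; omega
    simp only [h3]
    have h4 : j = 1 → i + 1 - j = i := by omega
    by_cases h2 : i = j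
    · subst h2
      by_cases h1 : i = 1
      · subst h1; simp; ring
      · simp [h1]; ring
    · by_cases h1 : j = 1
      · rw [if_pos h1, if_pos h1, if_neg h2, if_neg h2, h4 h1]; simp; ring
      · simp [h1, h2]; ring
  rw [Finset.sum_congr rfl this, Finset.sum_add_distrib, Finset.sum_add_distrib]
  rw [Finset.sum_ite_eq, Finset.sum_ite_eq', two_smul]
  simp

lemma d1_RR (al u : K) (f : MvPolynomial ℕ+ K) :
    d1 (RR al u f) = RR al u (d1 f) + (2 : K) • LL f := by
  have := lam_ind (d1 ∘ₗ RR al u - RR al u ∘ₗ d1 - (2 : K) • LL) (fun i => (Pn i * ·))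
    (by simp) (by simp [RR_one]) ?_ f
  · simp only [LinearMap.sub_apply, LinearMap.comp_apply, LinearMap.smul_apply] at this
    linear_combination this
  · intro i f
    simp only [LinearMap.sub_apply, LinearMap.comp_apply, LinearMap.smul_apply, LL_P, d1_P, RR_P,
      map_add, map_smul, d1_hh]
    rw [d1_Dm _ (by omega)]
    rcases Nat.eq_zero_or_pos i with rfl | hi
    · simp [Dm]
    · rw [if_neg (by omega : ¬ (i + 1 = 1))]
      simp only [mul_sub, mul_smul_comm]
      split_ifs with h
      · subst h; module
      · simp only [add_zero, map_zero]; module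

lemma LL_Dm (m : ℕ) (f : MvPolynomial ℕ+ K) : LL (Dm m f) = Dm m (LL f) + (m : K) • Dm m f := by
  have := lam_ind (LL ∘ₗ Dm m - Dm m ∘ₗ LL - (m : K) • Dm m) (fun i => (Pn i * ·))
    (by simp) (by simp) ?_ f
  · simp only [LinearMap.sub_apply, LinearMap.comp_apply, LinearMap.smul_apply] at this
    linear_combination this
  · intro i f
    simp only [LinearMap.sub_apply, LinearMap.comp_apply, LinearMap.smul_apply, LL_P, Dm_P,
      map_add, map_smul, mul_sub, mul_smul_comm]
    push_cast; module

lemma LL_hh (m : ℕ) (f : MvPolynomial ℕ+ K) :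
    LL (hh m * f) = hh m * LL f + (m : K) • (hh m * f) := by
  simp only [hh, Finset.sum_mul, map_sum, Finset.smul_sum, ← Finset.sum_add_distrib]
  refine Finset.sum_congr rfl fun j hj => ?_
  rw [mul_assoc, LL_P, LL_P, Nat.cast_sub (by simpa [Nat.lt_succ_iff] using hj)]
  simp only [mul_add, mul_assoc, mul_smul_comm]
  module

lemma LL_RR (al u : K) (f : MvPolynomial ℕ+ K) :
    LL (RR al u f) = RR al u (LL f) + RR al u f := by
  have := lam_ind (LL ∘ₗ RR al u - RR al u ∘ₗ LL - RR al u) (fun i => (Pn i * ·))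
    (by simp) (by simp [RR_one]) ?_ f
  · simp only [LinearMap.sub_apply, LinearMap.comp_apply] at this
    linear_combination this
  · intro i f
    simp only [LinearMap.sub_apply, LinearMap.comp_apply, LL_P, RR_P, LL_Dm, LL_hh,
      map_add, map_smul, mul_sub]
    push_cast; module

end JK
end

section
namespace JK
open MvPolynomial (X)
variable {K : Type*} [Field K]

lemma RR_BB_apply (al u : K) (n : ℕ) (f) : RR al u (BB al u n f) =
    BB al u n (RR al u f) + (n : K) • BB al u (n + 1) f := by
  simpa using LinearMap.congr_fun (RR_BB al u n) f

section char
variable [CharZero K]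

lemma LL_BB (al u : K) (hal : al ≠ 0) (n : ℕ) (f) :
    LL (BB al u n f) = BB al u n (LL f) + (n : K) • BB al u n f := by
  induction n generalizing f with
  | zero => simp [BB_zero]
  | succ n ih =>
    rcases Nat.eq_zero_or_pos n with rfl | hn
    · rw [zero_add, BB_one _ _ hal, BB_one _ _ hal]
      simp only [map_add, map_smul, LL_Dm, LL_P]; push_cast; module
    · have hn0 : (n : K) ≠ 0 := by exact_mod_cast hn.ne'
      have e : ∀ f, BB al u (n + 1) f =
          (n : K)⁻¹ • (RR al u (BB al u n f) - BB al u n (RR al u f)) := by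
        intro f
        rw [RR_BB_apply, add_sub_cancel_left, smul_smul, inv_mul_cancel₀ hn0, one_smul]
      rw [e, e]
      simp only [map_add, map_sub, map_smul, LL_RR, ih]
      push_cast; module

lemma d1_BB_one (al u : K) (hal : al ≠ 0) (f) :
    d1 (BB al u 1 f) = BB al u 1 (d1 f) + (u / al) • f := by
  rw [BB_one _ _ hal, BB_one _ _ hal]
  simp only [map_add, map_smul, d1_P, if_true, d1_Dm 1 le_rfl]
  module

lemma d1_BB (al u : K) (hal : al ≠ 0) (n : ℕ) (f) :
    d1 (BB al u (n + 2) f) = BB al u (n + 2) (d1 f) + (n + 2 : K) • BB al u (n + 1) f := by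
  have e : ∀ n f, BB al u (n + 2) f =
      (n + 1 : K)⁻¹ • (RR al u (BB al u (n + 1) f) - BB al u (n + 1) (RR al u f)) := by
    intro n f
    have hn0 : (n + 1 : K) ≠ 0 := by exact_mod_cast n.succ_ne_zero
    rw [RR_BB_apply, add_sub_cancel_left, smul_smul]
    push_cast
    rw [inv_mul_cancel₀ hn0, one_smul]
  induction n generalizing f with
  | zero =>
    rw [e, e]
    simp only [map_add, map_sub, map_smul, zero_add, d1_RR, d1_BB_one al u hal]
    rw [LL_BB al u hal]
    push_cast
    simp only [zero_add]; rw [inv_one]; module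
  | succ n ih =>
    have hn0 : (n + 2 : K) ≠ 0 := by exact_mod_cast (n + 1).succ_ne_zero
    rw [e (n + 1) f, e (n + 1) (d1 f)]
    simp only [show n + 1 + 1 = n + 2 from rfl]
    simp only [map_add, map_sub, map_smul, d1_RR, ih, LL_BB al u hal]
    have := RR_BB_apply al u (n + 1) f
    push_cast at this ⊢
    simp only [show n + 1 + 1 = n + 2 from rfl, show n + 1 + 2 = n + 3 from rfl] at this ⊢
    rw [this]
    rw [show (n + 1 + 1 : K) = n + 2 by ring]
    match_scalars <;> field_simp <;> ring

/-- Laplace–Beltrami type operator. -/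
def DD (al : K) : Module.End K (MvPolynomial ℕ+ K) :=
  (2 : K)⁻¹ • (Th ∘ₗ (al • dl + CC + (al - 1) • NN) ∘ₗ dd - (al - 1) • LL)

lemma DD_apply (al : K) (f) : DD al f = (2 : K)⁻¹ • (al • Th (dl (dd f)) + Th (CC (dd f)) +
    (al - 1) • Th (NN (dd f)) - (al - 1) • LL f) := by
  simp [DD]

@[simp] lemma DD_one (al : K) : DD al 1 = 0 := by simp [DD_apply]

lemma Th_C (i : ℕ) (f : MvPolynomial ℕ+ K) : Th (CC (mon i f)) = hh i * f := by
  simp only [CC_mon, map_sum, Th_mon, hh, Finset.sum_mul]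
  refine Finset.sum_congr rfl fun j hj => ?_
  ring

lemma DD_P (al : K) (i : ℕ) (f) : DD al (Pn i * f) = Pn i * DD al f +
    (i : K) • (al • Dm i f + (2 : K)⁻¹ • (hh i * f) + (2⁻¹ * (al - 1) * (i - 1)) • (Pn i * f)) := by
  have h2 : (2 : K) ≠ 0 := two_ne_zero
  simp only [DD_apply, dd_Pmul, LL_P, map_add, map_smul, dl_Pml, CC_ml, NN_ml, Th_ml, Th_C,
    dl_mon, ← Dm_apply, NN_mon, Th_mon, mul_sub, mul_add, mul_smul_comm]
  match_scalars <;> field_simp <;> ring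

lemma Dm_Dm (i : ℕ) (f : MvPolynomial ℕ+ K) :
    Dm i (Dm 1 f) = Dm 1 (Dm i f) + (1 - i : K) • Dm (i + 1) f := by
  have := lam_ind (Dm i ∘ₗ Dm 1 - Dm 1 ∘ₗ Dm i - (1 - i : K) • Dm (i + 1)) (fun i => (Pn i * ·))
    (by simp) (by simp) ?_ f
  · simp only [LinearMap.sub_apply, LinearMap.comp_apply, LinearMap.smul_apply] at this
    linear_combination this
  · intro j f
    simp only [LinearMap.sub_apply, LinearMap.comp_apply, LinearMap.smul_apply, Dm_P,
      map_add, map_smul, mul_sub, mul_smul_comm]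
    rw [show 1 + (i + j) = i + 1 + j by omega, show i + (1 + j) = i + 1 + j by omega]
    push_cast; module

lemma Dm_hh (i : ℕ) (f : MvPolynomial ℕ+ K) :
    Dm 1 (hh i * f) = hh i * Dm 1 f + (i - 1 : K) • (hh (i + 1) * f) := by
  have h1 : Dm 1 (hh i * f) = hh i * Dm 1 f
      + ∑ j ∈ Finset.range (i + 1), (j : K) • (Pn (j + 1) * Pn (i - j) * f)
      + ∑ j ∈ Finset.range (i + 1), ((i - j : ℕ) : K) • (Pn j * Pn (i + 1 - j) * f) := by
    simp only [hh, Finset.sum_mul, map_sum, ← Finset.sum_add_distrib]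
    refine Finset.sum_congr rfl fun j hj => ?_
    have : j ≤ i := by simpa [Nat.lt_succ_iff] using hj
    rw [mul_assoc, Dm_P, Dm_P, show 1 + (i - j) = i + 1 - j by omega, Nat.add_comm 1 j]
    simp only [mul_add, mul_smul_comm, mul_assoc]
    abel
  have h2 : ∑ j ∈ Finset.range (i + 1), (j : K) • (Pn (j + 1) * Pn (i - j) * f)
      = ∑ c ∈ Finset.range (i + 2), (c - 1 : K) • (Pn c * Pn (i + 1 - c) * f) := by
    rw [Finset.sum_range_succ' _ (i + 1)]
    simp
  have h3 : ∑ j ∈ Finset.range (i + 1), ((i - j : ℕ) : K) • (Pn j * Pn (i + 1 - j) * f)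
      = ∑ c ∈ Finset.range (i + 2), (i - c : K) • (Pn c * Pn (i + 1 - c) * f) := by
    rw [Finset.sum_range_succ _ (i + 1)]
    simp only [Nat.sub_self, Pn_zero, mul_zero, zero_mul, smul_zero, add_zero]
    refine Finset.sum_congr rfl fun j hj => ?_
    have : j ≤ i := by simpa [Nat.lt_succ_iff] using hj
    rw [Nat.cast_sub this]
  rw [h1, h2, h3, add_assoc, ← Finset.sum_add_distrib, hh, hh, Finset.sum_mul (s := Finset.range (i + 1 + 1)), Finset.smul_sum]
  congr 1
  refine Finset.sum_congr rfl fun j hj => ?_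
  module

lemma RR_u (al u : K) (f) : RR al u f = RR al 0 f + u • Dm 1 f := by
  simp [RR_apply, Gam_apply, Dm_apply]

lemma DD_Dm (al : K) (f) : DD al (Dm 1 f) = Dm 1 (DD al f) + RR al 0 f := by
  have := lam_ind (DD al ∘ₗ Dm 1 - Dm 1 ∘ₗ DD al - RR al 0) (fun i => (Pn i * ·))
    (by simp) (by simp [RR_one]) ?_ f
  · simp only [LinearMap.sub_apply, LinearMap.comp_apply] at this
    linear_combination this
  · intro i f
    have h2 : (2 : K) ≠ 0 := two_ne_zero
    simp only [LinearMap.sub_apply, LinearMap.comp_apply, Dm_P, DD_P, RR_P, Dm_hh, Dm_Dm,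
      map_add, map_smul, mul_sub, mul_smul_comm]
    rw [Nat.add_comm 1 i]
    push_cast
    match_scalars <;> field_simp <;> ring

lemma DD_P1 (al : K) (f) : DD al (Pn 1 * f) = Pn 1 * DD al f + al • Dm 1 f := by
  rw [DD_P]
  simp [hh, Finset.sum_range_succ]

/-- the pairing `Θ(df dg)` -/
def pr (f g : MvPolynomial ℕ+ K) : MvPolynomial ℕ+ K := Th (dd f * dd g)

lemma ml_eq_C_mul (f : MvPolynomial ℕ+ K) (x : MM K) : ml f x = Polynomial.C f * x := by
  rw [← smul_eq_ml, Polynomial.smul_eq_C_mul]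

lemma mon_mul (k : ℕ) (f : MvPolynomial ℕ+ K) (x : MM K) : mon k f * x = yp k (ml f x) := by
  induction x using mon_ind with
  | h0 j g => rw [ml_mon, yp_mon, mon_apply, mon_apply, mon_apply, Polynomial.monomial_mul_monomial, Nat.add_comm]
  | ha x y hx hy => simp only [map_add, mul_add, hx, hy]

lemma pr_comm (f g : MvPolynomial ℕ+ K) : pr f g = pr g f := by rw [pr, pr, mul_comm]

lemma pr_mul (f g h : MvPolynomial ℕ+ K) : pr f (g * h) = g * pr f h + h * pr f g := by
  simp only [pr, dd_mul, ml_eq_C_mul, mul_add, map_add]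
  rw [mul_left_comm, ← ml_eq_C_mul, Th_ml, mul_left_comm, ← ml_eq_C_mul, Th_ml]

lemma DD_mul (al : K) (f g) : DD al (f * g) = DD al f * g + f * DD al g + al • pr f g := by
  have := lam_ind (DD al ∘ₗ LinearMap.mulRight K g - LinearMap.mulRight K g ∘ₗ DD al
    - LinearMap.mulRight K (DD al g) - al • (Th ∘ₗ LinearMap.mulRight K (dd g) ∘ₗ dd))
    (fun i => (Pn i * ·)) (by simp) (by simp) ?_ f
  · simp only [LinearMap.sub_apply, LinearMap.comp_apply, LinearMap.smul_apply,
      LinearMap.mulRight_apply] at this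
    rw [pr]
    linear_combination this
  · intro i f
    have h1 : Dm i (f * g) = Dm i f * g + f * Dm i g := by
      simp only [Dm_apply, dd_mul, map_add, ← ml_yp, Th_ml]; ring
    have h2 : Th (mon i f * dd g) = f * Dm i g := by
      rw [mon_mul, ← ml_yp, Th_ml, ← Dm_apply]
    have h3 : Th (ml (Pn i) (dd f) * dd g) = Pn i * Th (dd f * dd g) := by
      rw [ml_eq_C_mul, mul_assoc, ← ml_eq_C_mul, Th_ml]
    simp only [LinearMap.sub_apply, LinearMap.comp_apply, LinearMap.smul_apply,
      LinearMap.mulRight_apply, mul_assoc, DD_P, dd_Pmul, add_mul, map_add, map_smul,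
      smul_mul_assoc, h1, h2, h3, mul_sub, mul_smul_comm]
    module

end char
end JK
end

section
namespace JK
section ser
variable {K : Type*} [Field K] [CharZero K] {A : Type*} [Ring A] [Algebra K A]
open PowerSeries

/-- Euler operator on power series -/
def Eu : PowerSeries A →ₗ[K] PowerSeries A where
  toFun f := PowerSeries.mk fun k => (k : K) • coeff k f
  map_add' f g := by ext; simp
  map_smul' c f := by
    ext k
    rw [coeff_mk, RingHom.id_apply, coeff_smul, coeff_smul, coeff_mk, smul_comm]

lemma coeff_Eu (f : PowerSeries A) (k : ℕ) : coeff k (Eu (K := K) f) = (k : K) • coeff k f := by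
  simp [Eu]

lemma Eu_mul (f g : PowerSeries A) : Eu (K := K) (f * g) = Eu (K := K) f * g + f * Eu (K := K) g := by
  ext k
  simp only [coeff_Eu, coeff_mul, map_add, Finset.smul_sum, ← Finset.sum_add_distrib]
  refine Finset.sum_congr rfl fun p hp => ?_
  rw [Finset.HasAntidiagonal.mem_antidiagonal] at hp
  rw [← hp]
  push_cast
  simp only [add_smul, smul_mul_assoc, mul_smul_comm]

lemma Eu_C (a : A) : Eu (K := K) (C a) = 0 := by
  ext k
  rw [coeff_Eu, coeff_C]
  split_ifs with h <;> simp [h]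

lemma Eu_X : Eu (K := K) (X : PowerSeries A) = X := by
  ext k
  rw [coeff_Eu, coeff_X]
  split_ifs with h <;> simp [h]

/-- the exponential series -/
def GG (b : ℕ → A) (c : K) : ℕ → A
  | 0 => 1
  | k + 1 => (c / (k + 1)) • ∑ n : Fin (k + 1), b n * GG b c (k - n)
decreasing_by omega

/-- generating series -/
def GS (b : ℕ → A) (c : K) : PowerSeries A := PowerSeries.mk (GG b c)

lemma GG_succ (b : ℕ → A) (c : K) (k : ℕ) :
    GG b c (k + 1) = (c / (k + 1)) • ∑ n ∈ Finset.range (k + 1), b n * GG b c (k - n) := by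
  rw [GG, Finset.sum_range]

lemma GG_zero (b : ℕ → A) (c : K) : GG b c 0 = 1 := by rw [GG]

lemma Eu_GS (b : ℕ → A) (c : K) :
    Eu (K := K) (GS b c) = c • (X * (PowerSeries.mk b * GS b c)) := by
  ext k
  rw [coeff_Eu]
  cases k with
  | zero => simp
  | succ k =>
    have h : ((k : K) + 1) ≠ 0 := by exact_mod_cast Nat.succ_ne_zero k
    rw [coeff_smul, coeff_succ_X_mul, coeff_mul, GS, coeff_mk, GG_succ, smul_smul,
      Finset.Nat.sum_antidiagonal_eq_sum_range_succ_mk]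
    simp only [coeff_mk, Nat.succ_eq_add_one]
    congr 1
    push_cast
    field_simp

lemma Eu_uniq (S f : PowerSeries A) (c : K) (h : Eu (K := K) f = c • (X * (S * f)))
    (h0 : coeff 0 f = 0) : f = 0 := by
  ext k
  rw [map_zero]
  induction k using Nat.strong_induction_on with
  | _ k ih =>
    cases k with
    | zero => exact h0
    | succ k =>
      have := congrArg (coeff (k + 1)) h
      rw [coeff_Eu, coeff_smul, coeff_succ_X_mul, coeff_mul, Finset.sum_eq_zero, smul_zero] at this
      · refine (smul_eq_zero.mp this).resolve_left ?_
        exact_mod_cast Nat.succ_ne_zero k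
      · intro p hp
        rw [Finset.HasAntidiagonal.mem_antidiagonal] at hp
        rw [ih p.2 (by omega), mul_zero]

lemma coeff_GS (b : ℕ → A) (c : K) (k : ℕ) : coeff k (GS b c) = GG b c k := by simp [GS]

lemma X_comm (f : PowerSeries A) : f * X = X * f := (PowerSeries.commute_X f).eq
lemma X_lcomm (f g : PowerSeries A) : f * (X * g) = X * (f * g) := by
  rw [← mul_assoc, X_comm, mul_assoc]

lemma GG_poly (b : ℕ → A) (k : ℕ) (φ : A →ₗ[K] K) : ∃ P : Polynomial K,
    (∀ c, φ (GG b c (k + 1)) = P.eval c) ∧ P.coeff 0 = 0 ∧ P.coeff 1 = (k + 1 : K)⁻¹ * φ (b k) := by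
  induction k using Nat.strong_induction_on generalizing φ with
  | _ k ih =>
    choose P hP using fun (n : Fin k) => ih (k - 1 - n) (by omega)
      (φ ∘ₗ LinearMap.mulLeft K (b n))
    refine ⟨(Polynomial.C (k + 1 : K)⁻¹ * (∑ n, P n + Polynomial.C (φ (b k)))) * Polynomial.X, ?_, ?_, ?_⟩
    · intro c
      rw [GG_succ, Finset.sum_range_succ, Finset.sum_range]
      have : ∀ n : Fin k, φ (b n * GG b c (k - n)) = (P n).eval c := by
        intro n
        rw [← (hP n).1 c, show k - 1 - n + 1 = k - n by omega]; rfl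
      simp only [map_smul, map_add, map_sum, this, Nat.sub_self, GG_zero, mul_one]
      simp [Polynomial.eval_finset_sum]
      ring
    · simp
    · rw [Polynomial.coeff_mul_X (n := 0)]
      simp [Polynomial.finset_sum_coeff, (hP _).2.1]

section comm
variable (b : ℕ → A)

lemma GG_comm (hb : ∀ m n, b m * b n = b n * b m) (c : K) (a : A) (ha : ∀ n, a * b n = b n * a) (k : ℕ) : a * GG b c k = GG b c k * a := by
  have hS : C a * PowerSeries.mk b = PowerSeries.mk b * C a := by
    ext k; simp [ha]
  have : C a * GS b c - GS b c * C a = 0 := by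
    refine Eu_uniq (PowerSeries.mk b) _ c ?_ ?_
    · rw [map_sub, Eu_mul, Eu_mul, Eu_C, Eu_GS]
      simp only [zero_mul, mul_zero, zero_add, add_zero, mul_smul_comm, smul_mul_assoc, X_lcomm,
        mul_assoc, ← smul_sub, ← mul_sub]
      rw [← mul_assoc, hS, mul_assoc, ← mul_sub]
    · simp [GS, GG_zero]
  have := congrArg (coeff k) this
  simpa [GS, sub_eq_zero] using this

lemma GS_comm (hb : ∀ m n, b m * b n = b n * b m) (c : K) : PowerSeries.mk b * GS b c = GS b c * PowerSeries.mk b := by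
  ext k
  rw [coeff_mul, coeff_mul, ← Finset.Nat.sum_antidiagonal_swap]
  refine Finset.sum_congr rfl fun p hp => ?_
  simp only [Prod.fst_swap, Prod.snd_swap, coeff_mk, coeff_GS]
  exact GG_comm b hb c _ (fun n => hb _ _) _

lemma GS_add (hb : ∀ m n, b m * b n = b n * b m) (c c' : K) : GS b c * GS b c' = GS b (c + c') := by
  rw [← sub_eq_zero]
  refine Eu_uniq (PowerSeries.mk b) _ (c + c') ?_ ?_
  · rw [map_sub, Eu_mul, Eu_GS, Eu_GS, Eu_GS]
    simp only [smul_mul_assoc, mul_smul_comm, X_lcomm, mul_assoc, mul_sub]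
    rw [← mul_assoc (GS b c), ← GS_comm b hb, mul_assoc]
    module
  · simp [GS, GG_zero, coeff_mul]

lemma GG_add (hb : ∀ m n, b m * b n = b n * b m) (c c' : K) (k : ℕ) :
    GG b (c + c') k = ∑ p ∈ Finset.HasAntidiagonal.antidiagonal k, GG b c p.1 * GG b c' p.2 := by
  rw [← coeff_GS, ← GS_add b hb, coeff_mul]; simp [coeff_GS]

lemma GG_R (hb : ∀ m n, b m * b n = b n * b m) (R : A) (hR : ∀ n, R * b n - b n * R = (n + 1 : K) • b (n + 1)) (k : ℕ) :
    (k + 1 : K) • GG b (1 : K) (k + 1) = R * GG b (1 : K) k - GG b (1 : K) k * R + b 0 * GG b (1 : K) k := by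
  set S := PowerSeries.mk b with hS
  set G := GS b (1 : K) with hG
  have hRS : X * (C R * S - S * C R) = Eu (K := K) S := by
    ext k
    rw [coeff_Eu]
    cases k with
    | zero => simp
    | succ k => simp [coeff_succ_X_mul, hS, hR]
  have hb0 : C (b 0) * G = G * C (b 0) := by
    ext k; simp [hG, coeff_GS, GG_comm b hb (1 : K) (b 0) (fun n => hb _ _)]
  have hS0 : C (b 0) * S = S * C (b 0) := by
    ext k; simp [hS, hb]
  have hE : Eu (K := K) G = X * (S * G) := by rw [hG, Eu_GS, one_smul]
  have : C R * G - G * C R - (S - C (b 0)) * G = 0 := by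
    refine Eu_uniq S _ (1 : K) ?_ ?_
    · simp only [map_sub, Eu_mul, Eu_C, sub_zero, hE, ← hRS]
      simp only [mul_sub, sub_mul, mul_add, X_lcomm, mul_assoc, zero_mul, mul_zero, zero_add, add_zero, one_smul]
      have h1 : S * (C (b 0) * G) = C (b 0) * (S * G) := by rw [← mul_assoc, ← hS0, mul_assoc]
      rw [h1]
      abel
    · simp [hG, hS, GS, GG_zero, coeff_mul]
  have h1 : X * (C R * G - G * C R + C (b 0) * G) = Eu (K := K) G := by
    rw [hE]
    congr 1
    rw [sub_mul] at this
    rw [← sub_eq_zero, ← this]; abel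
  have := congrArg (coeff (k + 1)) h1
  rw [coeff_Eu, coeff_succ_X_mul] at this
  simp only [map_add, map_sub, coeff_C_mul, coeff_mul_C, hG, coeff_GS] at this
  rw [this]; push_cast; rfl

lemma GG_L (L : A) (hL : ∀ n, L * b n - b n * L = (n + 1 : K) • b n) (k : ℕ) :
    L * GG b (1 : K) k - GG b (1 : K) k * L = (k : K) • GG b (1 : K) k := by
  set S := PowerSeries.mk b with hS
  set G := GS b (1 : K) with hG
  have hRS : C L * S - S * C L = S + Eu (K := K) S := by
    ext k
    simp [coeff_Eu, hS, hL, add_smul, add_comm]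
  have hE : Eu (K := K) G = X * (S * G) := by rw [hG, Eu_GS, one_smul]
  have : C L * G - G * C L - Eu (K := K) G = 0 := by
    refine Eu_uniq S _ (1 : K) ?_ ?_
    · rw [hE]
      simp only [map_sub, Eu_mul, Eu_C, Eu_X, hE]
      have h1 : C L * (X * (S * G)) = X * (S * (C L * G)) + X * ((S + Eu (K := K) S) * G) := by
        rw [X_lcomm, ← mul_add, ← hRS]; simp only [sub_mul, mul_assoc]; congr 1; abel
      rw [h1]
      simp only [mul_sub, sub_mul, mul_add, add_mul, X_lcomm, mul_assoc, zero_mul, mul_zero, zero_add, add_zero, one_smul]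
      abel
    · simp only [map_sub, coeff_C_mul, coeff_mul_C, hG, coeff_GS, GG_zero, coeff_Eu]; simp
  have := congrArg (coeff k) this
  simp only [map_sub, coeff_C_mul, coeff_mul_C, hG, coeff_GS, coeff_Eu, map_zero] at this
  rw [sub_eq_zero] at this
  exact this

lemma GG_d (d : A) (v : K) (h0 : d * b 0 - b 0 * d = v • 1)
    (hd : ∀ n, d * b (n + 1) - b (n + 1) * d = (n + 2 : K) • b n) (k : ℕ) :
    d * GG b (1 : K) (k + 1) - GG b (1 : K) (k + 1) * d = (v + k) • GG b (1 : K) k := by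
  set S := PowerSeries.mk b with hS
  set G := GS b (1 : K) with hG
  have hRS : C d * S - S * C d = v • 1 + X * (Eu (K := K) S + (2 : K) • S) := by
    ext k
    cases k with
    | zero => simp [hS, h0]
    | succ k =>
      simp only [map_sub, map_add, coeff_C_mul, coeff_mul_C, coeff_succ_X_mul, coeff_Eu, coeff_smul,
        hS, coeff_mk, hd, coeff_one]
      simp [add_smul]
  have hE : Eu (K := K) G = X * (S * G) := by rw [hG, Eu_GS, one_smul]
  have : C d * G - G * C d - X * (v • G + Eu (K := K) G) = 0 := by
    refine Eu_uniq S _ (1 : K) ?_ ?_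
    · rw [hE]
      simp only [map_sub, map_add, map_smul, Eu_mul, Eu_C, Eu_X, hE]
      have h1 : C d * (X * (S * G)) = X * (S * (C d * G)) + X * ((v • 1 + X * (Eu (K := K) S + (2 : K) • S)) * G) := by
        rw [X_lcomm, ← mul_add, ← hRS]; simp only [sub_mul, mul_assoc]; congr 1; abel
      rw [h1]
      simp only [mul_sub, sub_mul, mul_add, add_mul, X_lcomm, mul_assoc, zero_mul, mul_zero, zero_add, add_zero, one_smul,
        smul_mul_assoc, mul_smul_comm, one_mul]
      module
    · simp only [map_sub, coeff_C_mul, coeff_mul_C, hG, coeff_GS, GG_zero, coeff_zero_X_mul]; simp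
  have := congrArg (coeff (k + 1)) this
  simp only [map_sub, map_add, coeff_C_mul, coeff_mul_C, coeff_succ_X_mul, hG, coeff_GS, coeff_Eu, coeff_smul, map_zero] at this
  rw [sub_eq_zero] at this
  rw [this, add_smul]

end comm
end ser
end JK
end

section
namespace JK
open MvPolynomial (X coeff monomial pderiv)

lemma alpha_ne : alpha ≠ 0 := RatFunc.X_ne_zero

lemma zalpha_ne (m : Exp) : zalpha m ≠ 0 := by
  refine mul_ne_zero ?_ (pow_ne_zero _ alpha_ne)
  rw [Ne, map_eq_zero, Finsupp.prod, Finset.prod_eq_zero_iff]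
  rintro ⟨i, -, h⟩
  have h1 : ((i : ℕ) : ℚ) ≠ 0 := by exact_mod_cast i.ne_zero
  have h2 : (Nat.factorial (m i) : ℚ) ≠ 0 := by exact_mod_cast Nat.factorial_ne_zero _
  exact mul_ne_zero h2 (pow_ne_zero _ h1) h

lemma zalpha_add (m : Exp) (i : ℕ+) :
    zalpha (m + Finsupp.single i 1) = zalpha m * (m i + 1) * (i : ℕ) * alpha := by
  have h1 : (m + Finsupp.single i 1).sum (fun _ k => k) = m.sum (fun _ k => k) + 1 := by
    rw [Finsupp.sum_add_index' (by simp) (by simp)]; simp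
  have h2 : ∀ m : Exp, (m.prod fun i k => (Nat.factorial k : ℚ) * ((i : ℕ) : ℚ) ^ k) =
      (Nat.factorial (m i) * ((i : ℕ) : ℚ) ^ (m i)) *
      ((m.erase i).prod fun i k => (Nat.factorial k : ℚ) * ((i : ℕ) : ℚ) ^ k) := by
    intro m
    exact (Finsupp.mul_prod_erase' m i _ (by simp)).symm
  rw [zalpha, zalpha, h1, h2 m, h2 (m + _)]
  have h3 : (m + Finsupp.single i 1).erase i = m.erase i := by
    ext j; by_cases h : j = i
    · subst h; simp
    · simp [Finsupp.erase_ne h, Finsupp.single_apply, Ne.symm h]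
  rw [h3]
  simp only [Finsupp.add_apply, Finsupp.single_eq_same, Nat.factorial_succ, pow_succ, map_mul, map_pow, map_natCast, Nat.cast_mul]
  push_cast
  ring

/-- linear version of hall in the first variable -/
def hallL (g : SymA) : SymA →ₗ[F] F :=
  (MvPolynomial.basisMonomials ℕ+ F).constr F fun m => coeff m g * zalpha m

lemma hallL_mon (g : SymA) (m : Exp) : hallL g (monomial m 1) = coeff m g * zalpha m := by
  have := (MvPolynomial.basisMonomials ℕ+ F).constr_basis F (fun m => coeff m g * zalpha m) m
  simpa [hallL] using this

lemma hallL_apply (f g : SymA) : hallL g f = hall f g := by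
  conv_lhs => rw [f.as_sum]
  rw [map_sum, hall]
  refine Finset.sum_congr rfl fun m _ => ?_
  rw [show monomial m (coeff m f) = coeff m f • monomial m (1 : F) by simp [MvPolynomial.smul_monomial], map_smul, hallL_mon, smul_eq_mul, mul_assoc]

lemma hall_comm (f g : SymA) : hall f g = hall g f := by
  have h : ∀ f g : SymA, hall f g = ∑ m ∈ f.support ∪ g.support, coeff m f * coeff m g * zalpha m := by
    intro f g
    rw [hall]
    refine Finset.sum_subset Finset.subset_union_left fun m _ hm => ?_
    rw [MvPolynomial.notMem_support_iff.mp hm]; simp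
  rw [h f g, h g f, Finset.union_comm]
  refine Finset.sum_congr rfl fun m _ => by ring

@[simp] lemma hall_add_left (f f' g : SymA) : hall (f + f') g = hall f g + hall f' g := by
  simp only [← hallL_apply, map_add]
@[simp] lemma hall_smul_left (c : F) (f g : SymA) : hall (c • f) g = c * hall f g := by
  simp only [← hallL_apply, map_smul, smul_eq_mul]
@[simp] lemma hall_add_right (f g g' : SymA) : hall f (g + g') = hall f g + hall f g' := by
  simp only [hall_comm f, hall_add_left]
@[simp] lemma hall_smul_right (c : F) (f g : SymA) : hall f (c • g) = c * hall f g := by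
  simp only [hall_comm f, hall_smul_left]
@[simp] lemma hall_zero_left (g : SymA) : hall 0 g = 0 := by simp [← hallL_apply]
@[simp] lemma hall_zero_right (g : SymA) : hall g 0 = 0 := by rw [hall_comm, hall_zero_left]
@[simp] lemma hall_sub_left (f f' g : SymA) : hall (f - f') g = hall f g - hall f' g := by
  simp only [← hallL_apply, map_sub]
@[simp] lemma hall_sub_right (f g g' : SymA) : hall f (g - g') = hall f g - hall f g' := by
  simp only [hall_comm f, hall_sub_left]
lemma hall_sum_left {ι : Type*} (s : Finset ι) (f : ι → SymA) (g : SymA) :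
    hall (∑ i ∈ s, f i) g = ∑ i ∈ s, hall (f i) g := by simp only [← hallL_apply, map_sum]
lemma hall_sum_right {ι : Type*} (s : Finset ι) (f : ι → SymA) (g : SymA) :
    hall g (∑ i ∈ s, f i) = ∑ i ∈ s, hall g (f i) := by simp only [hall_comm g, hall_sum_left]

lemma hall_mon (m : Exp) (g : SymA) : hall (monomial m 1) g = coeff m g * zalpha m := by
  rw [← hallL_apply, hallL_mon]

lemma hall_X (i : ℕ+) (f h : SymA) : hall (X i * f) h = alpha * (i : ℕ) * hall f (pderiv i h) := by
  induction f using MvPolynomial.induction_on' with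
  | add f g hf hg => rw [mul_add, hall_add_left, hall_add_left, hf, hg]; ring
  | monomial m a =>
    rw [show monomial m a = a • monomial m (1 : F) by simp [MvPolynomial.smul_monomial],
      mul_smul_comm, hall_smul_left, hall_smul_left, hall_mon,
      show X i * monomial m (1 : F) = monomial (m + Finsupp.single i 1) 1 by
        rw [MvPolynomial.X, MvPolynomial.monomial_mul, one_mul, add_comm], hall_mon, zalpha_add]
    have : coeff m (pderiv i h) = coeff (m + Finsupp.single i 1) h * (m i + 1) := by
      rw [MvPolynomial.coeff_pderiv]
    rw [this]; ring

lemma dd_coeff (k : ℕ+) (h : SymA) : (dd h).coeff (k : ℕ) = ((k : ℕ) : F) • pderiv k h := by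
  induction h using MvPolynomial.induction_on with
  | C a => rw [← mul_one (MvPolynomial.C a), ← MvPolynomial.smul_eq_C_mul, map_smul, Derivation.map_smul]; simp
  | add f g hf hg => rw [map_add, map_add, Polynomial.coeff_add, hf, hg, smul_add]
  | mul_X f i hf =>
    rw [mul_comm, ← Pn_coe, dd_Pmul, Pn_coe, Polynomial.coeff_add, ml_eq_C_mul, Polynomial.coeff_C_mul, hf,
      Derivation.leibniz, Polynomial.coeff_smul, mon_apply, Polynomial.coeff_monomial,
      MvPolynomial.pderiv_X]
    by_cases h : i = k
    · subst h; simp [MvPolynomial.smul_eq_C_mul]; ring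
    · have h' : (i : ℕ) ≠ k := by simpa using h
      simp [h', Pi.single_apply, MvPolynomial.smul_eq_C_mul, h, Ne.symm h]; ring

lemma hall_P (k : ℕ) (f h : SymA) : hall (Pn k * f) h = alpha * hall f ((dd h).coeff k) := by
  rcases Nat.eq_zero_or_pos k with rfl | hk
  · rw [Pn_zero, zero_mul, hall_zero_left]
    have : (dd h).coeff 0 = 0 := by
      induction h using MvPolynomial.induction_on with
      | C a => rw [← mul_one (MvPolynomial.C a), ← MvPolynomial.smul_eq_C_mul, map_smul]; simp
      | add f g hf hg => rw [map_add, Polynomial.coeff_add, hf, hg, add_zero]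
      | mul_X f i hf =>
        rw [mul_comm, ← Pn_coe, dd_Pmul, Polynomial.coeff_add, ml_eq_C_mul, Polynomial.coeff_C_mul, hf]
        rw [Polynomial.coeff_smul, mon_apply, Polynomial.coeff_monomial]; simp
    rw [this]; simp
  · lift k to ℕ+ using hk
    rw [dd_coeff, Pn_coe, hall_X, hall_smul_right]; ring

/-- pairing on the `y`-module -/
def hM (H : MM F) : MM F →ₗ[F] F := lif fun k => hallL (H.coeff k)

lemma hM_mon (H : MM F) (k : ℕ) (f : SymA) : hM H (mon k f) = hall f (H.coeff k) := by
  simp [hM, hallL_apply]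

lemma hM_add (H H' x : MM F) : hM (H + H') x = hM H x + hM H' x := by
  induction x using mon_ind with
  | h0 k f => simp [hM_mon]
  | ha x y hx hy => simp only [map_add, hx, hy]; ring

lemma hM_smul (c : F) (H x : MM F) : hM (c • H) x = c * hM H x := by
  induction x using mon_ind with
  | h0 k f => simp [hM_mon]
  | ha x y hx hy => simp only [map_add, hx, hy]; ring

lemma hM_symm (H x : MM F) : hM H x = hM x H := by
  induction x using mon_ind with
  | h0 k f =>
    induction H using mon_ind with
    | h0 j g =>
      rw [hM_mon, hM_mon, mon_apply, mon_apply, Polynomial.coeff_monomial, Polynomial.coeff_monomial]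
      by_cases h : k = j
      · simp [h, hall_comm f]
      · simp [h, Ne.symm h]
    | ha x y hx hy => rw [hM_add, map_add, hx, hy]
  | ha x y hx hy => rw [hM_add, map_add, hx, hy]

lemma hall_Th (x : MM F) (h : SymA) : hall (Th x) h = alpha * hM (dd h) x := by
  induction x using mon_ind with
  | h0 k f => rw [hM_mon, Th_mon, hall_P]
  | ha x y hx hy => simp only [map_add, hall_add_left, hx, hy]; ring

lemma hM_NN (H x : MM F) : hM H (NN x) = hM (NN H) x := by
  induction x using mon_ind with
  | h0 k f =>
    rw [NN_mon, map_smul, hM_mon, hM_mon]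
    have : (NN H).coeff k = (k : F) • H.coeff k := by
      induction H using mon_ind with
      | h0 j g =>
        rw [NN_mon, mon_apply, Polynomial.coeff_smul, Polynomial.coeff_monomial]
        split_ifs with h
        · rw [h]
        · simp
      | ha x y hx hy => rw [map_add, Polynomial.coeff_add, Polynomial.coeff_add, hx, hy, smul_add]
    rw [this, hall_smul_right, smul_eq_mul]
  | ha x y hx hy => simp only [map_add, hx, hy]

lemma coeff_yp (l k : ℕ) (x : MM F) : (yp l x).coeff k = if l ≤ k then x.coeff (k - l) else 0 := by
  induction x using mon_ind with
  | h0 j f =>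
    rw [yp_mon, mon_apply, mon_apply, Polynomial.coeff_monomial, Polynomial.coeff_monomial]
    by_cases h : l ≤ k
    · by_cases h1 : j + l = k
      · rw [if_pos h1, if_pos h, if_pos (by omega)]
      · rw [if_neg h1, if_pos h, if_neg (by omega)]
    · rw [if_neg h, if_neg (by omega)]
  | ha x y hx hy => rw [map_add, Polynomial.coeff_add, Polynomial.coeff_add, hx, hy]; split_ifs <;> simp

lemma hM_CC (H x : MM F) : hM H (CC x) = alpha * hM (dl H) x := by
  induction x using mon_ind with
  | h0 k f =>
    induction H using mon_ind with
    | h0 l h =>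
      rw [hM_mon, dl_mon, coeff_yp, CC_mon, map_sum]
      simp only [hM_mon]
      simp only [mon_apply, Polynomial.coeff_monomial]
      by_cases hl : l ≤ k
      · rw [if_pos hl, Finset.sum_eq_single (k - l)]
        · rw [if_pos (by omega), hall_P]
        · intro j hj hjl
          rw [Finset.mem_range] at hj
          rw [if_neg (by omega), hall_zero_right]
        · intro hj; rw [Finset.mem_range] at hj; omega
      · rw [if_neg hl, hall_zero_right, mul_zero]
        refine Finset.sum_eq_zero fun j hj => ?_
        rw [if_neg (by omega), hall_zero_right]
    | ha x y hx hy => simp only [map_add, hM_add, hx, hy]; ring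
  | ha x y hx hy => simp only [map_add, hx, hy]; ring

lemma hall_LL (f h : SymA) : hall (LL f) h = hall f (LL h) := by
  have : ∀ f : SymA, LL f = Th (dd f) := fun f => by rw [LL, Dm_apply, yp_zero]
  rw [this, this, hall_Th, hall_comm, hall_Th, hM_symm]

lemma hall_DD (f h : SymA) : hall (DD alpha f) h = hall f (DD alpha h) := by
  have key : ∀ f h : SymA, hall (DD alpha f) h = 2⁻¹ * (alpha * (alpha * hM (dd h) (dl (dd f)) + alpha * hM (dl (dd h)) (dd f) +
      (alpha - 1) * hM (dd h) (NN (dd f))) - (alpha - 1) * hall (LL f) h) := by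
    intro f h
    simp only [DD_apply, hall_smul_left, hall_add_left, hall_sub_left, hall_Th, hM_CC]
    ring
  rw [hall_comm f, key, key, hM_NN, hall_LL, hall_comm f, hM_symm (dd h), hM_symm (dl (dd h)), hM_symm (NN _)]
  ring

lemma hall_self (f : SymA) (hf : hall f f = 0) : f = 0 := by
  obtain ⟨d, hd⟩ := IsLocalization.exist_integer_multiples_of_finset (nonZeroDivisors (Polynomial ℚ))
    (f.support.image fun m => coeff m f)
  have hd0 : algebraMap (Polynomial ℚ) F d ≠ 0 := by
    rw [Ne, map_eq_zero_iff _ (IsFractionRing.injective (Polynomial ℚ) F)]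
    exact nonZeroDivisors.coe_ne_zero d
  have hd' : ∀ m : f.support, ∃ a : Polynomial ℚ, algebraMap (Polynomial ℚ) F a = algebraMap (Polynomial ℚ) F d * coeff m f := by
    intro m
    obtain ⟨a, ha⟩ := hd (coeff m f) (Finset.mem_image_of_mem _ m.2)
    exact ⟨a, by rw [ha, Algebra.smul_def]⟩
  choose a ha using hd'
  have h1 : ∑ m : f.support, (a m) ^ 2 * (Polynomial.C ((m : Exp).prod fun i k => (Nat.factorial k : ℚ) * ((i : ℕ) : ℚ) ^ k) *
      Polynomial.X ^ ((m : Exp).sum fun _ k => k)) = 0 := by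
    apply IsFractionRing.injective (Polynomial ℚ) F
    rw [map_zero, map_sum]
    have h2 : algebraMap (Polynomial ℚ) F d ^ 2 * hall f f = 0 := by rw [hf, mul_zero]
    rw [hall, ← Finset.sum_coe_sort, Finset.mul_sum] at h2
    rw [← h2]
    refine Finset.sum_congr rfl fun m _ => ?_
    rw [map_mul, map_pow, ha, zalpha, map_mul, map_pow, RatFunc.algebraMap_X, RatFunc.algebraMap_C]
    have : algebraMap ℚ F = RatFunc.C := Subsingleton.elim _ _
    rw [this, alpha]
    ring
  have h3 : ∀ m : f.support, a m = 0 := by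
    intro m
    refine Polynomial.eq_zero_of_infinite_isRoot _ (Set.Infinite.mono (s := Set.Ioi (0 : ℚ)) ?_ (Set.Ioi_infinite 0))
    intro t ht
    have ht : 0 < t := ht
    have h4 := congrArg (Polynomial.eval t) h1
    rw [Polynomial.eval_finset_sum, Polynomial.eval_zero, Finset.sum_eq_zero_iff_of_nonneg] at h4
    · have h5 := h4 m (Finset.mem_univ _)
      simp only [Polynomial.eval_mul, Polynomial.eval_pow, Polynomial.eval_C, Polynomial.eval_X] at h5
      have h6 : (0 : ℚ) < ((m : Exp).prod fun i k => (Nat.factorial k : ℚ) * ((i : ℕ) : ℚ) ^ k) * t ^ ((m : Exp).sum fun _ k => k) := by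
        refine mul_pos (Finset.prod_pos fun i _ => ?_) (pow_pos ht _)
        have : 0 < (i : ℕ) := i.pos
        positivity
      have := (mul_eq_zero.mp h5).resolve_right h6.ne'
      exact pow_eq_zero_iff (two_ne_zero) |>.mp this
    · intro m _
      simp only [Polynomial.eval_mul, Polynomial.eval_pow, Polynomial.eval_C, Polynomial.eval_X]
      refine mul_nonneg (sq_nonneg _) (mul_nonneg (Finset.prod_nonneg fun i _ => ?_) (pow_pos ht _).le)
      positivity
  ext m
  rw [MvPolynomial.coeff_zero]
  by_contra hm
  have hm' : m ∈ f.support := MvPolynomial.mem_support_iff.mpr hm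
  have := ha ⟨m, hm'⟩
  rw [h3, map_zero] at this
  exact hm ((mul_eq_zero.mp this.symm).resolve_left hd0)

end JK
end

section
namespace JK
open MvPolynomial (X coeff monomial pderiv)

/-- complete functions -/
def gk (k : ℕ) : SymA := GG (fun n => (Pn (n + 1) : SymA)) (alpha⁻¹) k
lemma gk_zero : gk 0 = 1 := GG_zero _ _

lemma gk_succ (k : ℕ) : (alpha * (k + 1)) • gk (k + 1) = ∑ n ∈ Finset.range (k + 1), Pn (n + 1) * gk (k - n) := by
  have h : ((k : F) + 1) ≠ 0 := by exact_mod_cast Nat.succ_ne_zero k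
  have := alpha_ne
  rw [gk, GG_succ, smul_smul]
  rw [show alpha * ((k : F) + 1) * (alpha⁻¹ / (k + 1)) = 1 by field_simp, one_smul]
  rfl

lemma natCast_ne (k : ℕ) : ((k : F) + 1) ≠ 0 := by exact_mod_cast Nat.succ_ne_zero k

lemma dd_gk (k : ℕ) : alpha • dd (gk k) = ∑ i ∈ Finset.range k, mon (i + 1) (gk (k - 1 - i)) := by
  induction k using Nat.strong_induction_on with
  | _ k ih =>
    cases k with
    | zero => simp [gk_zero]
    | succ k =>
      have h0 : alpha * ((k : F) + 1) ≠ 0 := mul_ne_zero alpha_ne (natCast_ne k)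
      refine smul_right_injective _ h0 ?_
      simp only
      rw [smul_comm, ← map_smul, gk_succ, map_sum, Finset.smul_sum]
      simp only [dd_Pmul, smul_add, ← map_smul (ml _)]
      rw [Finset.sum_add_distrib]
      have h1 : ∑ n ∈ Finset.range (k + 1), ml (Pn (n + 1)) (alpha • dd (gk (k - n)))
          = ∑ i ∈ Finset.range (k + 1), (alpha * (k - i : F)) • mon (i + 1) (gk (k - i)) := by
        calc _ = ∑ n ∈ Finset.range (k + 1), ∑ i ∈ Finset.range (k - n), mon (i + 1) (Pn (n + 1) * gk (k - n - 1 - i)) := by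
              refine Finset.sum_congr rfl fun n hn => ?_
              rw [ih (k - n) (by omega), map_sum]
              simp
          _ = ∑ i ∈ Finset.range (k + 1), ∑ n ∈ Finset.range (k - i), mon (i + 1) (Pn (n + 1) * gk (k - i - 1 - n)) := by
              rw [Finset.sum_comm' (t' := Finset.range (k + 1)) (s' := fun i => Finset.range (k - i))]
              · refine Finset.sum_congr rfl fun n hn => Finset.sum_congr rfl fun i hi => ?_
                rw [show k - i - 1 - n = k - n - 1 - i by omega]
              · intro x y; simp only [Finset.mem_range]; omega
          _ = _ := by
              refine Finset.sum_congr rfl fun i hi => ?_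
              rw [Finset.mem_range] at hi
              obtain ⟨c, rfl⟩ : ∃ c, k = i + c := ⟨k - i, by omega⟩
              rw [← map_sum, ← map_smul]
              cases c with
              | zero => simp
              | succ c =>
                have := gk_succ c
                rw [show i + (c + 1) - i = c + 1 by omega]
                push_cast
                rw [show (i : F) + (c + 1) - i = c + 1 by ring, this]
      rw [h1, ← Finset.sum_add_distrib, Finset.smul_sum]
      refine Finset.sum_congr rfl fun i hi => ?_
      rw [show k + 1 - 1 - i = k - i by omega]
      simp only [Nat.cast_add, Nat.cast_one]
      rw [smul_smul, ← add_smul]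
      congr 1
      ring

/-- coefficient `k - i`, zero if negative -/
lemma coeff_dd_gk (k i : ℕ) : alpha • (dd (gk k)).coeff (i + 1) = if i < k then gk (k - 1 - i) else 0 := by
  rw [← Polynomial.coeff_smul, dd_gk, Polynomial.finset_sum_coeff]
  simp only [mon_apply, Polynomial.coeff_monomial, Nat.add_right_cancel_iff]
  simp

lemma pderiv_gk (i : ℕ+) (k : ℕ) : (alpha * (i : ℕ)) • pderiv i (gk k) = if (i : ℕ) ≤ k then gk (k - i) else 0 := by
  obtain ⟨j, hj⟩ : ∃ j, (i : ℕ) = j + 1 := ⟨i - 1, by have := i.pos; omega⟩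
  have := coeff_dd_gk k j
  rw [← hj, dd_coeff, smul_smul] at this
  rw [this, show k - 1 - j = k - i by omega]
  refine if_congr (by omega) rfl rfl

/-- comultiplication by one variable -/
def Dlt : SymA →ₐ[F] Polynomial SymA :=
  MvPolynomial.aeval fun i : ℕ+ => Polynomial.C (X i) + Polynomial.X ^ (i : ℕ)

/-- skewing operator -/
def qk (k : ℕ) : SymA →ₗ[F] SymA :=
  ((Polynomial.lcoeff SymA k).restrictScalars F) ∘ₗ Dlt.toLinearMap

lemma qk_apply (k : ℕ) (f : SymA) : qk k f = (Dlt f).coeff k := rfl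

lemma qk_one (k : ℕ) : qk k 1 = if k = 0 then 1 else 0 := by
  rw [qk_apply, map_one, Polynomial.coeff_one]

lemma qk_X (k : ℕ) (i : ℕ+) (f : SymA) : qk k (X i * f) = X i * qk k f + if (i : ℕ) ≤ k then qk (k - i) f else 0 := by
  rw [qk_apply, map_mul, Dlt, MvPolynomial.aeval_X, ← Dlt, add_mul, Polynomial.coeff_add, Polynomial.coeff_C_mul,
    Polynomial.coeff_X_pow_mul']
  rfl

lemma hall_C (k : F) (h : SymA) : hall (MvPolynomial.C k) h = k * coeff 0 h := by
  rw [← mul_one (MvPolynomial.C k), ← MvPolynomial.smul_eq_C_mul, hall_smul_left, show (1 : SymA) = monomial 0 1 from rfl,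
    hall_mon]
  simp [zalpha]

lemma coeff_zero_gk (k : ℕ) : coeff 0 (gk k) = if k = 0 then 1 else 0 := by
  cases k with
  | zero => simp [gk_zero]
  | succ k =>
    have h0 : alpha * ((k : F) + 1) ≠ 0 := mul_ne_zero alpha_ne (natCast_ne k)
    have := congrArg (coeff 0) (gk_succ k)
    rw [MvPolynomial.coeff_smul, MvPolynomial.coeff_sum, Finset.sum_eq_zero] at this
    · simpa [h0] using this
    · intro n _
      rw [show Pn (n + 1) = X (Nat.succPNat n) from Pn_coe (Nat.succPNat n), ← MvPolynomial.constantCoeff_eq, map_mul, MvPolynomial.constantCoeff_X, zero_mul]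

lemma hall_qk (k : ℕ) (f h : SymA) : hall (qk k f) h = hall f (gk k * h) := by
  induction f using MvPolynomial.induction_on generalizing k h with
  | C a =>
    rw [hall_C, ← mul_one (MvPolynomial.C a), ← MvPolynomial.smul_eq_C_mul, map_smul, qk_one,
      ← MvPolynomial.constantCoeff_eq, map_mul, MvPolynomial.constantCoeff_eq, coeff_zero_gk]
    split_ifs
    · rw [MvPolynomial.smul_eq_C_mul, mul_one, hall_C]; simp [MvPolynomial.constantCoeff_eq]
    · simp
  | add f g hf hg => rw [map_add, hall_add_left, hall_add_left, hf, hg]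
  | mul_X f i hf =>
    rw [mul_comm, qk_X, hall_add_left, hall_X, hall_X, hf, Derivation.leibniz, ← hall_smul_right,
      ← hall_smul_right, smul_add, hall_add_right, smul_eq_mul, smul_eq_mul, mul_comm h, ← smul_mul_assoc (_) (pderiv i (gk k)), pderiv_gk]
    split_ifs
    · rw [hf]
    · simp

lemma evalN_succ (N : ℕ) (f : SymA) :
    MvPolynomial.finSuccEquiv F N (evalN (N + 1) f) = Polynomial.map (evalN N : SymA →+* _) (Dlt f) := by
  have : ((MvPolynomial.finSuccEquiv F N).toAlgHom.comp (evalN (N + 1))) = (Polynomial.mapAlgHom (evalN N)).comp Dlt := by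
    ext i : 1
    simp [evalN, Dlt, MvPolynomial.finSuccEquiv_X_zero, MvPolynomial.finSuccEquiv_X_succ, Fin.sum_univ_succ]
    simp [add_comm]
  exact DFunLike.congr_fun this f

lemma coeff_evalN (N : ℕ) (a : Fin N →₀ ℕ) (f : SymA) :
    coeff a (evalN N f) = hall f (∏ i, gk (a i)) := by
  induction N generalizing f with
  | zero =>
    have ha : a = 0 := Subsingleton.elim _ _
    subst ha
    rw [Finset.univ_eq_empty, Finset.prod_empty, hall_comm, show (1 : SymA) = MvPolynomial.C 1 from rfl, hall_C, one_mul]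
    rw [← MvPolynomial.constantCoeff_eq, ← MvPolynomial.constantCoeff_eq]
    have : (MvPolynomial.constantCoeff).comp (evalN 0 : SymA →+* MvPolynomial (Fin 0) F) = MvPolynomial.constantCoeff := by
      ext <;> simp [evalN]
    exact DFunLike.congr_fun this f
  | succ N ih =>
    obtain ⟨i, m, rfl⟩ : ∃ i m, a = Finsupp.cons i m := ⟨a 0, a.tail, (Finsupp.cons_tail a).symm⟩
    rw [← MvPolynomial.finSuccEquiv_coeff_coeff, evalN_succ, Polynomial.coeff_map, ← qk_apply]
    rw [RingHom.coe_coe, ih, hall_qk, Fin.prod_univ_succ]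
    simp

/-- products of complete functions -/
def gP (mu : JPartition) : SymA := (mu.map fun i : ℕ+ => gk (i : ℕ)).prod

lemma prod_getD (l : List ℕ) (N : ℕ) (h : l.length ≤ N) :
    ∏ j ∈ Finset.range N, gk (l.getD j 0) = (l.map gk).prod := by
  induction l generalizing N with
  | nil => simp [gk_zero]
  | cons a l ih =>
    obtain ⟨M, rfl⟩ : ∃ M, N = M + 1 := ⟨N - 1, by simp at h; omega⟩
    rw [Finset.prod_range_succ', List.map_cons, List.prod_cons, ← ih M (by simpa using h)]
    simp [mul_comm]

lemma coe_bind (l : JPartition) : (Multiset.map (fun i => i) (do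
      let a ← l
      pure (a : ℕ)) : Multiset ℕ) = l.map (fun i : ℕ+ => (i : ℕ)) := by
  rw [Multiset.map_id']
  simp [Multiset.bind_def, Multiset.pure_def, Multiset.bind_singleton]

lemma psize_eq (l : JPartition) : psize l = (l.map (fun i : ℕ+ => (i : ℕ))).sum := by
  rw [psize, coe_bind]

lemma sortedParts_coe (mu : JPartition) : ((sortedParts mu : List ℕ) : Multiset ℕ) = mu.map (fun i : ℕ+ => (i : ℕ)) := by
  rw [sortedParts, Multiset.coe_reverse, Multiset.sort_eq, coe_bind]

lemma sortedParts_length (mu : JPartition) : (sortedParts mu).length = plen mu := by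
  rw [← Multiset.coe_card, sortedParts_coe, Multiset.card_map, plen]

lemma gP_sorted (mu : JPartition) : ((sortedParts mu).map gk).prod = gP mu := by
  rw [gP, ← Multiset.prod_coe, ← Multiset.map_coe, sortedParts_coe, Multiset.map_map]; rfl

lemma tri {J : JPartition → SymA} (hJ : IsJackFamily J) (l m : JPartition) (h : ¬ dominates m l) :
    hall (J l) (gP m) = 0 := by
  have := hJ.triangular l m h
  rw [coeff_evalN] at this
  rw [← this, ← gP_sorted, ← prod_getD _ (psize l + psize m + plen m) (by rw [sortedParts_length]; omega), Finset.prod_range]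
  rfl

end JK
end

section
namespace JK

lemma part_exists (lam : JPartition) (h : lam ≠ 0) : ∃ s mu, (∀ x ∈ mu, x ≤ s) ∧ lam = s ::ₘ mu := by
  have hne : lam.toFinset.Nonempty := by
    rw [Finset.nonempty_iff_ne_empty]; simpa using h
  obtain ⟨s, hs, hmax⟩ := Finset.exists_max_image lam.toFinset id hne
  refine ⟨s, lam.erase s, ?_, ?_⟩
  · intro x hx; exact hmax x (by rw [Multiset.mem_toFinset]; exact Multiset.mem_of_mem_erase hx)
  · rw [Multiset.cons_erase (by simpa using hs)]

lemma part_ind {p : JPartition → Prop} (h0 : p 0)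
    (hc : ∀ s mu, (∀ x ∈ mu, x ≤ s) → p mu → p (s ::ₘ mu)) (lam : JPartition) : p lam := by
  induction h : Multiset.card lam generalizing lam with
  | zero => rw [Multiset.card_eq_zero] at h; rw [h]; exact h0
  | succ n ih =>
    obtain ⟨s, mu, hs, rfl⟩ := part_exists lam (by rintro rfl; simp at h)
    exact hc s mu hs (ih mu (by simpa using h))

lemma sortedParts_eq (lam : JPartition) : sortedParts lam =
    ((lam.map (fun i : ℕ+ => (i : ℕ))).sort (· ≤ ·)).reverse := by rw [sortedParts, coe_bind]

lemma sortedParts_zero : sortedParts 0 = [] := by simp [sortedParts_eq]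

lemma sortedParts_pw (lam : JPartition) : (sortedParts lam).Pairwise (· ≥ ·) := by
  rw [sortedParts_eq, List.pairwise_reverse]
  exact Multiset.pairwise_sort _ _

lemma sortedParts_cons (s : ℕ+) (mu : JPartition) (h : ∀ x ∈ mu, x ≤ s) :
    sortedParts (s ::ₘ mu) = (s : ℕ) :: sortedParts mu := by
  refine List.Perm.eq_of_pairwise' (r := (· ≥ ·)) (sortedParts_pw _) ?_ ?_
  · rw [List.pairwise_cons]
    refine ⟨fun a ha => ?_, sortedParts_pw mu⟩
    rw [← Multiset.mem_coe, sortedParts_coe, Multiset.mem_map] at ha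
    obtain ⟨x, hx, rfl⟩ := ha
    exact_mod_cast h x hx
  · rw [← Multiset.coe_eq_coe, sortedParts_coe, ← Multiset.cons_coe, sortedParts_coe, Multiset.map_cons]

/-- rows of a partition -/
def row (lam : JPartition) (i : ℕ) : ℕ := (sortedParts lam).getD i 0

@[simp] lemma row_zero (i : ℕ) : row 0 i = 0 := by simp [row, sortedParts_zero]
lemma row_cons_zero (s : ℕ+) (mu : JPartition) (h : ∀ x ∈ mu, x ≤ s) : row (s ::ₘ mu) 0 = s := by
  simp [row, sortedParts_cons s mu h]
lemma row_cons_succ (s : ℕ+) (mu : JPartition) (h : ∀ x ∈ mu, x ≤ s) (i : ℕ) :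
    row (s ::ₘ mu) (i + 1) = row mu i := by
  simp [row, sortedParts_cons s mu h]

lemma row_le (s : ℕ) (mu : JPartition) (h : ∀ x ∈ mu, (x : ℕ) ≤ s) (i : ℕ) : row mu i ≤ s := by
  induction mu using part_ind generalizing i with
  | h0 => simp
  | hc t mu ht ih =>
    cases i with
    | zero => rw [row_cons_zero t mu ht]; exact h t (by simp)
    | succ i => rw [row_cons_succ t mu ht]; exact ih (fun x hx => h x (by simp [hx])) i

lemma le_row_zero (mu : JPartition) (x : ℕ+) (hx : x ∈ mu) : (x : ℕ) ≤ row mu 0 := by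
  induction mu using part_ind with
  | h0 => simp at hx
  | hc t mu ht ih =>
    rw [row_cons_zero t mu ht]
    rw [Multiset.mem_cons] at hx
    rcases hx with rfl | hx
    · exact le_rfl
    · exact_mod_cast ht x hx

lemma row_anti1 (lam : JPartition) (i : ℕ) : row lam (i + 1) ≤ row lam i := by
  induction lam using part_ind generalizing i with
  | h0 => simp
  | hc t mu ht ih =>
    cases i with
    | zero => rw [row_cons_zero t mu ht, row_cons_succ t mu ht]
              exact row_le _ _ (fun x hx => by exact_mod_cast ht x hx) _
    | succ i => rw [row_cons_succ t mu ht, row_cons_succ t mu ht]; exact ih i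

lemma row_anti (lam : JPartition) : Antitone (row lam) := antitone_nat_of_succ_le (row_anti1 lam)

lemma row_inj {lam mu : JPartition} (h : ∀ i, row lam i = row mu i) : lam = mu := by
  induction lam using part_ind generalizing mu with
  | h0 =>
    by_contra hne
    obtain ⟨s, nu, hs, rfl⟩ := part_exists mu (Ne.symm hne)
    have := h 0
    rw [row_cons_zero s nu hs] at this
    simp at this
    exact s.ne_zero this.symm
  | hc t lam ht ih =>
    have h0 := h 0
    rw [row_cons_zero t lam ht] at h0
    obtain ⟨s, nu, hs, rfl⟩ := part_exists mu (by rintro rfl; simp at h0)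
    rw [row_cons_zero s nu hs] at h0
    have h1 : t = s := by exact_mod_cast h0
    subst h1
    rw [ih (mu := nu)]
    intro i
    have := h (i + 1)
    rwa [row_cons_succ t lam ht, row_cons_succ t nu hs] at this

lemma row_ge_len (lam : JPartition) (i : ℕ) (h : plen lam ≤ i) : row lam i = 0 := by
  rw [row, List.getD_eq_default]; rwa [sortedParts_length]

lemma plen_cons (s : ℕ+) (mu : JPartition) : plen (s ::ₘ mu) = plen mu + 1 := by simp [plen]
lemma psize_cons (s : ℕ+) (mu : JPartition) : psize (s ::ₘ mu) = s + psize mu := by simp [psize_eq]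
@[simp] lemma psize_zero : psize 0 = 0 := by simp [psize_eq]

lemma sum_row {M : Type*} [AddCommMonoid M] (f : ℕ → M) (hf : f 0 = 0) (lam : JPartition) (N : ℕ) (h : plen lam ≤ N) :
    ∑ i ∈ Finset.range N, f (row lam i) = (lam.map fun i : ℕ+ => f i).sum := by
  induction lam using part_ind generalizing N with
  | h0 => simp [hf]
  | hc t mu ht ih =>
    rw [plen_cons] at h
    obtain ⟨M, rfl⟩ : ∃ M, N = M + 1 := ⟨N - 1, by omega⟩
    rw [Finset.sum_range_succ', row_cons_zero t mu ht]
    simp only [row_cons_succ t mu ht]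
    rw [ih M (by omega), Multiset.map_cons, Multiset.sum_cons, add_comm]

lemma psize_row (lam : JPartition) (N : ℕ) (h : plen lam ≤ N) : ∑ i ∈ Finset.range N, row lam i = psize lam := by
  rw [psize_eq, ← sum_row (fun x => x) rfl lam N h]

lemma topSum_row (lam : JPartition) (k : ℕ) : topSum lam k = ∑ i ∈ Finset.range k, row lam i := by
  have : ∀ (l : List ℕ) (k : ℕ), (l.take k).sum = ∑ i ∈ Finset.range k, l.getD i 0 := by
    intro l
    induction l with
    | nil => simp
    | cons a l ih =>
      intro k
      cases k with
      | zero => simp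
      | succ k => rw [Finset.sum_range_succ', List.take_succ_cons, List.sum_cons, ih]; simp [add_comm]
  exact this _ _

/-- sum of squares of parts -/
def Qn (lam : JPartition) : ℕ := (lam.map fun i : ℕ+ => (i : ℕ) ^ 2).sum

lemma Qn_row (lam : JPartition) (N : ℕ) (h : plen lam ≤ N) : ∑ i ∈ Finset.range N, row lam i ^ 2 = Qn lam := by
  rw [Qn, ← sum_row (fun x => x ^ 2) rfl lam N h]

lemma dom_Q {mu lam : JPartition} (h : dominates mu lam) (hne : mu ≠ lam) : Qn mu < Qn lam := by
  obtain ⟨h1, h2⟩ := h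
  simp only [topSum_row] at h2
  set N := plen mu + plen lam with hN
  have hm := psize_row mu (N + 1) (by omega)
  have hl := psize_row lam (N + 1) (by omega)
  have hm2 := Qn_row mu (N + 1) (by omega)
  have hl2 := Qn_row lam (N + 1) (by omega)
  have abel : ∀ n, ((row mu n : ℤ)) * ∑ i ∈ Finset.range (n + 1), ((row lam i : ℤ) - row mu i) ≤
      ∑ i ∈ Finset.range (n + 1), (row mu i : ℤ) * ((row lam i : ℤ) - row mu i) := by
    intro n
    induction n with
    | zero => simp
    | succ n ih =>
      rw [Finset.sum_range_succ _ (n + 1), Finset.sum_range_succ _ (n + 1)]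
      have a1 : (row mu (n + 1) : ℤ) ≤ row mu n := by exact_mod_cast row_anti1 mu n
      have a2 : 0 ≤ ∑ i ∈ Finset.range (n + 1), ((row lam i : ℤ) - row mu i) := by
        rw [Finset.sum_sub_distrib, sub_nonneg]; exact_mod_cast h2 (n + 1)
      nlinarith
  have hab := abel N
  have h0 : ∑ i ∈ Finset.range (N + 1), ((row lam i : ℤ) - row mu i) = 0 := by
    rw [Finset.sum_sub_distrib, sub_eq_zero]
    have : ∑ i ∈ Finset.range (N + 1), row lam i = ∑ i ∈ Finset.range (N + 1), row mu i := by rw [hl, hm, h1]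
    exact_mod_cast this
  rw [h0, mul_zero] at hab
  obtain ⟨j, hj⟩ : ∃ j, row mu j ≠ row lam j := by
    by_contra hc
    push_neg at hc
    exact hne (row_inj hc)
  have hjN : j ∈ Finset.range (N + 1) := by
    rw [Finset.mem_range]
    by_contra hc
    exact hj (by rw [row_ge_len mu j (by omega), row_ge_len lam j (by omega)])
  have hpos : 0 < ∑ i ∈ Finset.range (N + 1), ((row lam i : ℤ) - row mu i) ^ 2 := by
    refine Finset.sum_pos' (fun i _ => sq_nonneg _) ⟨j, hjN, ?_⟩
    have : (row lam j : ℤ) - row mu j ≠ 0 := by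
      rw [sub_ne_zero]; exact_mod_cast Ne.symm hj
    positivity
  have hid : (Qn lam : ℤ) - Qn mu = 2 * ∑ i ∈ Finset.range (N + 1), (row mu i : ℤ) * ((row lam i : ℤ) - row mu i)
      + ∑ i ∈ Finset.range (N + 1), ((row lam i : ℤ) - row mu i) ^ 2 := by
    rw [← hm2, ← hl2]
    push_cast
    rw [Finset.mul_sum, ← Finset.sum_add_distrib, ← Finset.sum_sub_distrib]
    exact Finset.sum_congr rfl fun i _ => by ring
  have : (Qn mu : ℤ) < Qn lam := by linarith
  exact_mod_cast this

lemma dom_row0 {mu lam : JPartition} (h : dominates mu lam) : row mu 0 ≤ row lam 0 := by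
  have := h.2 1
  simpa [topSum_row] using this

lemma plen_le (lam : JPartition) : plen lam ≤ psize lam := by
  induction lam using part_ind with
  | h0 => simp [plen]
  | hc t mu ht ih => rw [plen_cons, psize_cons]; have := t.pos; omega

lemma fin_size (n : ℕ) : {mu : JPartition | psize mu = n}.Finite := by
  refine Set.Finite.of_injOn (f := fun mu : JPartition => mu.map (fun i : ℕ+ => (i : ℕ)))
    (t := Set.range fun p : Nat.Partition n => p.parts) ?_ ?_ (Set.finite_range _)
  · intro mu hmu
    refine ⟨⟨mu.map (fun i : ℕ+ => (i : ℕ)), ?_, ?_⟩, rfl⟩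
    · intro i hi
      rw [Multiset.mem_map] at hi
      obtain ⟨x, _, rfl⟩ := hi
      exact x.pos
    · rw [← psize_eq]; exact hmu
  · intro a _ b _ h
    exact Multiset.map_injective PNat.coe_injective h

/-- partitions of `n` -/
def Pt (n : ℕ) : Finset JPartition := (fin_size n).toFinset
@[simp] lemma mem_Pt (n : ℕ) (mu : JPartition) : mu ∈ Pt n ↔ psize mu = n := by simp [Pt]

/-- sum of contents -/
def ee (lam : JPartition) : F := ∑ i ∈ Finset.range (plen lam), (alpha * (Nat.choose (row lam i) 2 : ℕ) - i * row lam i)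

lemma ee_row (lam : JPartition) (N : ℕ) (h : plen lam ≤ N) :
    ee lam = ∑ i ∈ Finset.range N, (alpha * (Nat.choose (row lam i) 2 : ℕ) - i * row lam i) := by
  rw [ee]
  refine Finset.sum_subset (Finset.range_mono h) fun i _ hi => ?_
  rw [Finset.mem_range, not_lt] at hi
  rw [row_ge_len lam i hi]; simp

@[simp] lemma ee_zero : ee 0 = 0 := by simp [ee, plen]

lemma ee_cons (s : ℕ+) (mu : JPartition) (h : ∀ x ∈ mu, x ≤ s) :
    ee (s ::ₘ mu) = alpha * (Nat.choose s 2 : ℕ) + ee mu - psize mu := by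
  rw [ee, plen_cons, Finset.sum_range_succ', row_cons_zero s mu h, ee, ← psize_row mu _ le_rfl]
  simp only [row_cons_succ s mu h]
  push_cast
  rw [add_sub_assoc, ← Finset.sum_sub_distrib, zero_mul, sub_zero, add_comm]
  congr 1
  exact Finset.sum_congr rfl fun i _ => by ring

lemma Qn_cons (s : ℕ+) (mu : JPartition) : Qn (s ::ₘ mu) = (s : ℕ) ^ 2 + Qn mu := by simp [Qn]

lemma ee_size_Q {lam mu : JPartition} (hs : psize lam = psize mu) (h : ee lam = ee mu) : Qn lam = Qn mu := by
  have key : ∀ lam : JPartition, ∃ c : ℚ, ee lam = alpha * (Qn lam - psize lam) / 2 + algebraMap ℚ F c := by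
    intro lam
    induction lam using part_ind with
    | h0 => exact ⟨0, by simp [Qn]⟩
    | hc t mu ht ih =>
      obtain ⟨c, hc⟩ := ih
      refine ⟨c - psize mu, ?_⟩
      rw [ee_cons t mu ht, hc, psize_cons, Qn_cons, Nat.cast_choose_two]
      simp only [map_sub, map_natCast]
      push_cast
      ring
  obtain ⟨c, hc⟩ := key lam
  obtain ⟨d, hd⟩ := key mu
  rw [hc, hd, hs] at h
  have hp : algebraMap (Polynomial ℚ) F (Polynomial.X * Polynomial.C (((Qn lam : ℚ) - Qn mu) / 2)) =
      algebraMap (Polynomial ℚ) F (Polynomial.C (d - c)) := by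
    simp only [map_mul, RatFunc.algebraMap_X, RatFunc.algebraMap_C]
    have e : (RatFunc.C : ℚ →+* F) = algebraMap ℚ F := Subsingleton.elim _ _
    rw [e, ← alpha]
    simp only [map_sub, map_natCast, map_div₀, map_ofNat]
    linear_combination h
  have hp2 := congrArg (fun p => Polynomial.coeff p 1) (IsFractionRing.injective (Polynomial ℚ) F hp)
  simp only [Polynomial.coeff_X_mul, Polynomial.coeff_C_zero, Polynomial.coeff_C_succ] at hp2
  have : (Qn lam : ℚ) = Qn mu := by linarith
  exact_mod_cast this

end JK
end

section
namespace JK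
open MvPolynomial

lemma hall_Pg (i r : ℕ) (hi : 0 < i) (f : SymA) : hall (Pn i * f) (gk (i + r)) = hall f (gk r) := by
  obtain ⟨i, rfl⟩ := Nat.exists_eq_succ_of_ne_zero hi.ne'
  have h := coeff_dd_gk (i + 1 + r) i
  rw [if_pos (by omega), show i + 1 + r - 1 - i = r by omega] at h
  rw [hall_P, Nat.succ_eq_add_one, ← hall_smul_right, h]

lemma hall_Pg0 (i k : ℕ) (hi : k < i) (f : SymA) : hall (Pn i * f) (gk k) = 0 := by
  obtain ⟨i, rfl⟩ := Nat.exists_eq_succ_of_ne_zero (Nat.pos_of_ne_zero (by omega : i ≠ 0)).ne'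
  have h := coeff_dd_gk k i
  rw [if_neg (by omega)] at h
  rw [hall_P, Nat.succ_eq_add_one, ← hall_smul_right, h, hall_zero_right]

/-- `hall f (gk (k - i))` with the convention that negative indices give zero -/
def hg (f : SymA) (k i : ℕ) : F := if i ≤ k then hall f (gk (k - i)) else 0

lemma hg_P (f : SymA) (k i j : ℕ) (hi : 0 < i) : hg (Pn i * f) k j = hg f k (i + j) := by
  unfold hg
  by_cases h : i + j ≤ k
  · rw [if_pos (by omega), if_pos h]
    conv_lhs => rw [show k - j = i + (k - (i + j)) by omega]
    rw [hall_Pg _ _ hi]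
  · rw [if_neg h]
    split_ifs with h2
    · rw [hall_Pg0 _ _ (by omega)]
    · rfl

lemma hg_mul_cast (f : SymA) (k i : ℕ) : (k - i : F) * hg f k i = if i ≤ k then ((k - i : ℕ) : F) * hall f (gk (k - i)) else 0 := by
  unfold hg
  split_ifs with h
  · rw [Nat.cast_sub h]
  · simp

def hgL (k i : ℕ) : SymA →ₗ[F] F := if i ≤ k then hallL (gk (k - i)) else 0
lemma hgL_apply (k i : ℕ) (f : SymA) : hgL k i f = hg f k i := by
  unfold hgL hg; split_ifs <;> simp [hallL_apply]

lemma hg_one (k i : ℕ) : hg 1 k i = if i = k then 1 else 0 := by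
  unfold hg
  rw [← C_1]
  simp only [hall_C, coeff_zero_gk]
  split_ifs <;> first | omega | simp


lemma P_ind {p : SymA → Prop} (h1 : p 1) (ha : ∀ f g, p f → p g → p (f + g)) (hs : ∀ (c : F) f, p f → p (c • f))
    (hP : ∀ i f, 0 < i → p f → p (Pn i * f)) (f : SymA) : p f := by
  induction f using MvPolynomial.induction_on with
  | C a =>
    rw [show (MvPolynomial.C a : SymA) = a • 1 by rw [MvPolynomial.smul_eq_C_mul, mul_one]]
    exact hs _ _ h1
  | add p q hp hq => exact ha _ _ hp hq
  | mul_X p i hp => rw [← Pn_coe, mul_comm]; exact hP _ _ i.pos hp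

lemma hg_add (f g : SymA) (k i : ℕ) : hg (f + g) k i = hg f k i + hg g k i := by simp [← hgL_apply]
lemma hg_smul (c : F) (f : SymA) (k i : ℕ) : hg (c • f) k i = c * hg f k i := by simp [← hgL_apply]

lemma hg_Dm (k i j : ℕ) (hij : 0 < i) (f : SymA) : hg (Dm i f) k j = (k - (i + j)) * hg f k (i + j) := by
  induction f using P_ind generalizing j with
  | h1 =>
    rw [Dm_one, ← hgL_apply, map_zero, hg_one]
    split_ifs with h
    · rw [← h]; push_cast; ring
    · ring
  | ha f g hf hg => simp only [map_add, hg_add, hf, hg]; ring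
  | hs c f hf => simp only [map_smul, hg_smul, hf]; ring
  | hP l f hl hf =>
    rw [Dm_P, hg_add, hg_smul, hg_P _ _ _ _ hl, hg_P _ _ _ _ hl, hf, hg_P _ _ _ _ (by omega),
      show i + (l + j) = l + (i + j) by ring, show i + l + j = l + (i + j) by ring]
    push_cast; ring

lemma hg_hh (k i : ℕ) (j : ℕ) (f : SymA) : hg (hh (i + 1) * f) k j = i * hg f k (i + 1 + j) := by
  rw [hh, Finset.sum_mul, ← hgL_apply, map_sum, Finset.sum_range_succ, Finset.sum_range_succ']
  simp only [Pn_zero, zero_mul, Nat.sub_self, mul_zero, map_zero, add_zero]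
  rw [Finset.sum_congr rfl (g := fun _ => hg f k (i + 1 + j))]
  · simp
  · intro x hx
    rw [Finset.mem_range] at hx
    rw [mul_assoc, hgL_apply, hg_P _ _ _ _ (by omega), hg_P _ _ _ _ (by omega)]
    congr 1; omega

lemma hg_DD (k j : ℕ) (f : SymA) : hg (DD alpha f) k j = alpha * ((k - j) * (k - j - 1) / 2) * hg f k j := by
  induction f using P_ind generalizing j with
  | h1 =>
    rw [DD_one, ← hgL_apply, map_zero, hg_one]
    split_ifs with h
    · rw [← h]; ring
    · ring
  | ha f g hf hg => simp only [map_add, hg_add, hf, hg]; ring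
  | hs c f hf => simp only [map_smul, hg_smul, hf]; ring
  | hP l f hl hf =>
    obtain ⟨l, rfl⟩ := Nat.exists_eq_succ_of_ne_zero hl.ne'
    rw [Nat.succ_eq_add_one] at *
    rw [DD_P]
    simp only [hg_add, hg_smul]
    rw [hg_hh, hg_Dm _ _ _ hl, hg_P _ _ _ _ hl, hg_P _ _ _ _ hl, hf]
    push_cast
    field_simp
    ring

lemma hall_ext {f g : SymA} (h : ∀ x, hall x f = hall x g) : f = g := by
  rw [← sub_eq_zero]
  exact hall_self _ (by rw [hall_sub_right, h, sub_self])

lemma DD_gk (k : ℕ) : DD alpha (gk k) = (alpha * (Nat.choose k 2 : ℕ)) • gk k := by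
  refine hall_ext fun x => ?_
  rw [← hall_DD, hall_smul_right]
  have := hg_DD k 0 x
  simp only [hg, Nat.zero_le, if_true, Nat.sub_zero] at this
  rw [this, Nat.cast_choose_two]
  push_cast; ring

/-- `α² pr` -/
lemma pr_gk (k l : ℕ) : alpha • alpha • pr (gk k) (gk l) =
    ∑ i ∈ Finset.range k, ∑ j ∈ Finset.range l, Pn (i + j + 2) * (gk (k - 1 - i) * gk (l - 1 - j)) := by
  have h : alpha • alpha • pr (gk k) (gk l) = Th ((alpha • dd (gk k)) * (alpha • dd (gk l))) := by
    rw [smul_mul_assoc, mul_smul_comm, map_smul, map_smul, pr]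
  rw [h, dd_gk, dd_gk, Finset.sum_mul, map_sum]
  refine Finset.sum_congr rfl fun i _ => ?_
  rw [Finset.mul_sum, map_sum]
  refine Finset.sum_congr rfl fun j _ => ?_
  rw [mon_mul, ml_mon, yp_mon, Th_mon]
  congr 2; omega

lemma gk_succ2 (k : ℕ) : ∑ n ∈ Finset.range k, Pn (n + 2) * gk (k - 1 - n) = (alpha * (k + 1)) • gk (k + 1) - Pn 1 * gk k := by
  rw [gk_succ, Finset.sum_range_succ']
  simp only [Nat.sub_zero, zero_add, add_sub_cancel_right]
  refine Finset.sum_congr rfl fun i _ => ?_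
  congr 2; omega

lemma pr_rec (k l : ℕ) : alpha • pr (gk k) (gk (l + 1)) = alpha • pr (gk (k + 1)) (gk l)
    + (k + 1 : F) • (gk (k + 1) * gk l) - (l + 1 : F) • (gk k * gk (l + 1)) := by
  have h : alpha • alpha • pr (gk k) (gk (l + 1)) = alpha • (alpha • pr (gk (k + 1)) (gk l)
    + (k + 1 : F) • (gk (k + 1) * gk l) - (l + 1 : F) • (gk k * gk (l + 1))) := by
    have e1 : alpha • alpha • pr (gk k) (gk (l + 1)) =
        (∑ i ∈ Finset.range k, ∑ j ∈ Finset.range l, Pn (i + j + 3) * (gk (k - 1 - i) * gk (l - 1 - j)))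
        + (∑ n ∈ Finset.range k, Pn (n + 2) * gk (k - 1 - n)) * gk l := by
      rw [pr_gk, Finset.sum_mul, ← Finset.sum_add_distrib]
      refine Finset.sum_congr rfl fun i _ => ?_
      rw [Finset.sum_range_succ']
      congr 1
      · refine Finset.sum_congr rfl fun j _ => ?_
        rw [show l + 1 - 1 - (j + 1) = l - 1 - j by omega]; rfl
      · simp [mul_assoc]
    have e2 : alpha • alpha • pr (gk (k + 1)) (gk l) =
        (∑ i ∈ Finset.range k, ∑ j ∈ Finset.range l, Pn (i + j + 3) * (gk (k - 1 - i) * gk (l - 1 - j)))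
        + (∑ n ∈ Finset.range l, Pn (n + 2) * gk (l - 1 - n)) * gk k := by
      rw [pr_gk, Finset.sum_range_succ']
      congr 1
      · refine Finset.sum_congr rfl fun i _ => Finset.sum_congr rfl fun j _ => ?_
        rw [show k + 1 - 1 - (i + 1) = k - 1 - i by omega, show i + 1 + j + 2 = i + j + 3 by omega]
      · rw [Finset.sum_mul]
        refine Finset.sum_congr rfl fun j _ => ?_
        simp only [zero_add, Nat.add_sub_cancel, Nat.sub_zero]
        ring
    rw [smul_sub, smul_add, e1, e2, gk_succ2, gk_succ2, sub_mul, sub_mul, smul_mul_assoc, smul_mul_assoc,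
      mul_comm (gk (l + 1)) (gk k), smul_smul, smul_smul,
      show Pn 1 * gk l * gk k = Pn 1 * gk k * gk l by ring]
    abel
  exact smul_right_injective _ alpha_ne h

lemma pr_span (l : ℕ) : ∀ k, alpha • pr (gk k) (gk l) + (l : F) • (gk k * gk l) ∈
    Submodule.span F {x : SymA | ∃ r, 1 ≤ r ∧ r ≤ l ∧ x = gk (k + r) * gk (l - r)} := by
  induction l with
  | zero => intro k; simp [pr, gk_zero]
  | succ l ih =>
    intro k
    have e : alpha • pr (gk k) (gk (l + 1)) + ((l + 1 : ℕ) : F) • (gk k * gk (l + 1)) =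
      (alpha • pr (gk (k + 1)) (gk l) + (l : F) • (gk (k + 1) * gk l)) + (k + 1 - l : F) • (gk (k + 1) * gk l) := by
      rw [pr_rec]
      simp only [Nat.cast_add, Nat.cast_one, add_smul, sub_smul, one_smul]
      abel
    rw [e]
    refine Submodule.add_mem _ (Submodule.span_mono ?_ (ih (k + 1))) (Submodule.smul_mem _ _ (Submodule.subset_span ?_))
    · rintro x ⟨r, h1, h2, rfl⟩
      refine ⟨r + 1, by omega, by omega, ?_⟩
      rw [show l + 1 - (r + 1) = l - r by omega, show k + 1 + r = k + (r + 1) by omega]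
    · exact ⟨1, by omega, by omega, by simp⟩

lemma gk_mul_gP (k : ℕ) (rho : JPartition) : ∃ rho' : JPartition, gk k * gP rho = gP rho' ∧
    psize rho' = k + psize rho ∧ Qn rho' = k ^ 2 + Qn rho := by
  rcases Nat.eq_zero_or_pos k with rfl | h
  · exact ⟨rho, by simp [gk_zero]⟩
  · lift k to ℕ+ using h
    exact ⟨k ::ₘ rho, by simp [gP], psize_cons _ _, Qn_cons _ _⟩

/-- span of the lower terms -/
def Ug (n q : ℕ) : Submodule F SymA := Submodule.span F {x | ∃ rho, psize rho = n ∧ q < Qn rho ∧ x = gP rho}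

lemma gk_mul_Ug (k n q : ℕ) (x : SymA) (hx : x ∈ Ug n q) : gk k * x ∈ Ug (k + n) (k ^ 2 + q) := by
  induction hx using Submodule.span_induction with
  | mem x h =>
    obtain ⟨rho, h1, h2, rfl⟩ := h
    obtain ⟨r, e1, e2, e3⟩ := gk_mul_gP k rho
    rw [e1]
    exact Submodule.subset_span ⟨r, by omega, by omega, rfl⟩
  | zero => simp
  | add x y _ _ hx hy => rw [mul_add]; exact Submodule.add_mem _ hx hy
  | smul c x _ hx => rw [mul_smul_comm]; exact Submodule.smul_mem _ _ hx

lemma gP_cons (l : ℕ+) (mu : JPartition) : gP (l ::ₘ mu) = gk l * gP mu := by simp [gP]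
lemma gP_zero : gP 0 = 1 := by simp [gP]

lemma pr_gP (s : ℕ) (mu : JPartition) (h : ∀ x ∈ mu, (x : ℕ) ≤ s) :
    alpha • pr (gk s) (gP mu) + (psize mu : F) • (gk s * gP mu) ∈ Ug (s + psize mu) (s ^ 2 + Qn mu) := by
  induction mu using Multiset.induction with
  | empty => simp [gP_zero, pr]
  | cons l mu ih =>
    have e : alpha • pr (gk s) (gP (l ::ₘ mu)) + (psize (l ::ₘ mu) : F) • (gk s * gP (l ::ₘ mu)) =
      gk l * (alpha • pr (gk s) (gP mu) + (psize mu : F) • (gk s * gP mu)) +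
      gP mu * (alpha • pr (gk s) (gk l) + ((l : ℕ) : F) • (gk s * gk l)) := by
      rw [psize_cons, gP_cons, pr_mul]
      simp only [Nat.cast_add, add_smul, smul_add, mul_add, mul_smul_comm]
      rw [show gk l * (gk s * gP mu) = gk s * (gk l * gP mu) by ring, show gP mu * (gk s * gk l) = gk s * (gk l * gP mu) by ring]
      abel
    rw [e]
    refine Submodule.add_mem _ ?_ ?_
    · have := gk_mul_Ug l _ _ _ (ih fun x hx => h x (Multiset.mem_cons_of_mem hx))
      rw [psize_cons, Qn_cons]
      convert this using 2 <;> ring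
    · have hl : (l : ℕ) ≤ s := h l (Multiset.mem_cons_self _ _)
      have := pr_span l s
      generalize alpha • pr (gk s) (gk l) + ((l : ℕ) : F) • (gk s * gk l) = z at this ⊢
      induction this using Submodule.span_induction with
      | mem x hx =>
        obtain ⟨r, h1, h2, rfl⟩ := hx
        obtain ⟨r1, e1, e2, e3⟩ := gk_mul_gP (l - r) mu
        obtain ⟨r2, f1, f2, f3⟩ := gk_mul_gP (s + r) r1
        rw [show gP mu * (gk (s + r) * gk (l - r)) = gk (s + r) * (gk (l - r) * gP mu) by ring, e1, f1]
        refine Submodule.subset_span ⟨r2, ?_, ?_, rfl⟩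
        · rw [f2, e2, psize_cons]; omega
        · rw [f3, e3, Qn_cons]
          obtain ⟨d, hd⟩ := Nat.exists_eq_add_of_le h2
          rw [hd] at hl ⊢
          rw [Nat.add_sub_cancel_left]
          nlinarith
      | zero => simp
      | add x y _ _ hx hy => rw [mul_add]; exact Submodule.add_mem _ hx hy
      | smul c x _ hx => rw [mul_smul_comm]; exact Submodule.smul_mem _ _ hx

lemma DD_gP (mu : JPartition) : DD alpha (gP mu) - ee mu • gP mu ∈ Ug (psize mu) (Qn mu) := by
  induction mu using part_ind with
  | h0 => simp [gP_zero]
  | hc s mu hs ih =>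
    have e : DD alpha (gP (s ::ₘ mu)) - ee (s ::ₘ mu) • gP (s ::ₘ mu) =
      gk s * (DD alpha (gP mu) - ee mu • gP mu) + (alpha • pr (gk s) (gP mu) + (psize mu : F) • (gk s * gP mu)) := by
      rw [ee_cons s mu hs, gP_cons, DD_mul, DD_gk, mul_sub, sub_smul, add_smul, smul_mul_assoc, mul_smul_comm]
      abel
    rw [e, psize_cons, Qn_cons]
    exact Submodule.add_mem _ (gk_mul_Ug _ _ _ _ ih) (pr_gP s mu fun x hx => hs x hx)

end JK
end

section
namespace JK
open MvPolynomial

lemma gP_add (a b : JPartition) : gP (a + b) = gP a * gP b := by simp [gP]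

lemma gk_adjoin : Algebra.adjoin F (Set.range gk) = ⊤ := by
  have hP : ∀ k, (Pn k : SymA) ∈ Algebra.adjoin F (Set.range gk) := by
    intro k
    induction k using Nat.strong_induction_on with
    | _ k ih =>
      rcases k with _ | k
      · simp
      · have h := gk_succ k
        rw [Finset.sum_range_succ, Nat.sub_self, gk_zero, mul_one] at h
        rw [← sub_eq_iff_eq_add'.mpr h]
        refine Subalgebra.sub_mem _ (Subalgebra.smul_mem _ (Algebra.subset_adjoin (Set.mem_range_self _)) _)
          (Subalgebra.sum_mem _ fun i hi => Subalgebra.mul_mem _ (ih _ ?_) (Algebra.subset_adjoin (Set.mem_range_self _)))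
        rw [Finset.mem_range] at hi; omega
  rw [eq_top_iff, ← MvPolynomial.adjoin_range_X]
  refine Algebra.adjoin_le ?_
  rintro _ ⟨i, rfl⟩
  rw [← Pn_coe]; exact hP i

lemma gP_span : Submodule.span F (Set.range gP) = ⊤ := by
  have h := congrArg Subalgebra.toSubmodule gk_adjoin
  rw [Algebra.adjoin_eq_span, Algebra.top_toSubmodule] at h
  rw [eq_top_iff, ← h]
  refine Submodule.span_mono fun x hx => ?_
  induction hx using Submonoid.closure_induction with
  | mem x h =>
    obtain ⟨k, rfl⟩ := h
    obtain ⟨r, hr, _⟩ := gk_mul_gP k 0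
    exact ⟨r, by rw [← hr, gP_zero, mul_one]⟩
  | one => exact ⟨0, gP_zero⟩
  | mul x y _ _ hx hy =>
    obtain ⟨a, rfl⟩ := hx
    obtain ⟨b, rfl⟩ := hy
    exact ⟨a + b, gP_add a b⟩

lemma span_ext {ι : Type*} {v : ι → SymA} (hv : Submodule.span F (Set.range v) = ⊤) {f : SymA} (h : ∀ i, hall f (v i) = 0) : f = 0 := by
  apply hall_self
  have : f ∈ Submodule.span F (Set.range v) := by rw [hv]; trivial
  have key : ∀ x ∈ Submodule.span F (Set.range v), hall f x = 0 := by
    intro x hx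
    induction hx using Submodule.span_induction with
    | mem x h' => obtain ⟨i, rfl⟩ := h'; exact h i
    | zero => simp
    | add x y _ _ hx hy => simp [hx, hy]
    | smul c x _ hx => simp [hx]
  exact key f this

lemma gP_ext {f : SymA} (h : ∀ mu, hall f (gP mu) = 0) : f = 0 := span_ext gP_span h

lemma J_ne {J : JPartition → SymA} (hJ : IsJackFamily J) (l : JPartition) : J l ≠ 0 := by
  intro h
  have := hJ.normalized l
  rw [h] at this; simp at this

lemma J_self {J : JPartition → SymA} (hJ : IsJackFamily J) (l : JPartition) : hall (J l) (J l) ≠ 0 :=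
  fun h => J_ne hJ l (hall_self _ h)

lemma J_li {J : JPartition → SymA} (hJ : IsJackFamily J) : LinearIndependent F J := by
  rw [linearIndependent_iff']
  intro s c hc i hi
  have h := congrArg (fun x => hall x (J i)) hc
  simp only [hall_sum_left, hall_smul_left, hall_zero_left] at h
  rw [Finset.sum_eq_single i] at h
  · exact (mul_eq_zero.mp h).resolve_right (J_self hJ i)
  · intro j _ hj; rw [hJ.orthogonal j i hj, mul_zero]
  · intro h'; exact absurd hi h'

/-- functions supported on `S` when paired with the complete functions -/
def WS (S : Finset JPartition) : Submodule F SymA where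
  carrier := {f | ∀ mu, mu ∉ S → hall f (gP mu) = 0}
  add_mem' := by intro a b ha hb mu h; simp [ha mu h, hb mu h]
  zero_mem' := by intro mu h; simp
  smul_mem' := by intro c a ha mu h; simp [ha mu h]

lemma WS_span {J : JPartition → SymA} (hJ : IsJackFamily J) (S : Finset JPartition)
    (hS : ∀ rho ∈ S, J rho ∈ WS S) : Submodule.span F (Set.range fun r : S => J r) = WS S := by
  let ev : WS S →ₗ[F] (S → F) := LinearMap.pi fun r => hallL (gP r) ∘ₗ (WS S).subtype
  have hinj : Function.Injective ev := by
    rw [← LinearMap.ker_eq_bot, LinearMap.ker_eq_bot']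
    intro f hf
    ext1
    refine gP_ext fun mu => ?_
    by_cases h : mu ∈ S
    · have := congrFun hf ⟨mu, h⟩
      simpa [ev, hallL_apply] using this
    · exact f.2 mu h
  have hfd : FiniteDimensional F (WS S) := FiniteDimensional.of_injective ev hinj
  have hrank : Module.finrank F (WS S) ≤ Fintype.card S := by
    have := LinearMap.finrank_le_finrank_of_injective hinj
    simpa using this
  refine Submodule.eq_of_le_of_finrank_le ?_ ?_
  · rw [Submodule.span_le]
    rintro _ ⟨r, rfl⟩
    exact hS r r.2
  · rw [show (fun r : S => J r) = J ∘ Subtype.val from rfl, finrank_span_eq_card ((J_li hJ).comp _ Subtype.val_injective)]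
    exact hrank

lemma WS_orth {J : JPartition → SymA} (hJ : IsJackFamily J) (S : Finset JPartition)
    (hS : ∀ rho ∈ S, J rho ∈ WS S) {f : SymA} (hf : f ∈ WS S) {l : JPartition} (hl : l ∉ S) : hall f (J l) = 0 := by
  rw [← WS_span hJ S hS] at hf
  induction hf using Submodule.span_induction with
  | mem x h => obtain ⟨r, rfl⟩ := h; exact hJ.orthogonal _ _ fun h => hl (h ▸ r.2)
  | zero => simp
  | add x y _ _ hx hy => simp [hx, hy]
  | smul c x _ hx => simp [hx]

lemma LL_mul (f g : SymA) : LL (f * g) = LL f * g + f * LL g := by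
  induction f using P_ind with
  | h1 => simp
  | ha f g hf hg => simp only [add_mul, map_add, hf, hg]; ring
  | hs c f hf => simp only [smul_mul_assoc, map_smul, hf, smul_add]
  | hP i f hi hf => rw [mul_assoc, LL_P, LL_P, hf, add_mul, smul_mul_assoc, mul_add, mul_assoc, mul_assoc, mul_assoc]; abel

lemma LL_gk (k : ℕ) : LL (gk k) = (k : F) • gk k := by
  refine hall_ext fun x => ?_
  rw [← hall_LL, hall_smul_right]
  induction x using P_ind generalizing k with
  | h1 =>
    rw [LL_one, hall_zero_left, ← C_1, hall_C, coeff_zero_gk]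
    split_ifs with h <;> simp [h]
  | ha f g hf hg => simp only [map_add, hall_add_left, hf, hg]; ring
  | hs c f hf => simp only [map_smul, hall_smul_left, hf]; ring
  | hP i f hi hf =>
    rw [LL_P, hall_add_left, hall_smul_left]
    rcases le_or_gt i k with h | h
    · obtain ⟨d, rfl⟩ := Nat.exists_eq_add_of_le h
      rw [hall_Pg _ _ hi, hall_Pg _ _ hi, hf]; push_cast; ring
    · rw [hall_Pg0 _ _ h, hall_Pg0 _ _ h]; ring

lemma LL_gP (mu : JPartition) : LL (gP mu) = (psize mu : F) • gP mu := by
  induction mu using Multiset.induction with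
  | empty => simp [gP_zero]
  | cons l mu ih =>
    rw [gP_cons, LL_mul, ih, LL_gk, psize_cons, smul_mul_assoc, mul_smul_comm, ← add_smul, Nat.cast_add]

variable {J : JPartition → SymA}

lemma LL_J (hJ : IsJackFamily J) (l : JPartition) : LL (J l) = (psize l : F) • J l := by
  rw [← sub_eq_zero]
  refine gP_ext fun mu => ?_
  rw [hall_sub_left, hall_LL, LL_gP, hall_smul_left, hall_smul_right]
  by_cases h : dominates mu l
  · rw [h.1, sub_self]
  · rw [tri hJ _ _ h]; ring

/-- homogeneous of different degrees are orthogonal -/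
lemma hall_homog {f g : SymA} {a b : ℕ} (hf : LL f = (a : F) • f) (hg : LL g = (b : F) • g) (h : a ≠ b) : hall f g = 0 := by
  have := hall_LL f g
  rw [hf, hg, hall_smul_left, hall_smul_right] at this
  have h2 : ((a : F) - b) * hall f g = 0 := by rw [sub_mul, this, sub_self]
  refine (mul_eq_zero.mp h2).resolve_left ?_
  rw [sub_eq_zero]; exact_mod_cast h

lemma mem_WS_Pt {f : SymA} {n : ℕ} (hf : LL f = (n : F) • f) : f ∈ WS (Pt n) := by
  intro mu h
  rw [mem_Pt] at h
  exact hall_homog hf (LL_gP mu) (Ne.symm h)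

lemma LL_pn (m : Exp) : ∃ n : ℕ, LL (monomial m 1 : SymA) = (n : F) • monomial m 1 := by
  induction m using Finsupp.induction with
  | zero => exact ⟨0, by change LL 1 = _; simp⟩
  | single_add i k m hi hk ih =>
    obtain ⟨n, hn⟩ := ih
    have : ∀ k, ∃ n : ℕ, LL (monomial (Finsupp.single i k + m) 1 : SymA) = (n : F) • monomial (Finsupp.single i k + m) 1 := by
      intro k
      induction k with
      | zero => exact ⟨n, by simpa using hn⟩
      | succ k ih =>
        obtain ⟨n, hn⟩ := ih
        refine ⟨n + i, ?_⟩
        rw [show (monomial (Finsupp.single i (k + 1) + m) 1 : SymA) = Pn i * monomial (Finsupp.single i k + m) 1 by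
          rw [Pn_coe, X, monomial_mul, one_mul]; congr 1; rw [Finsupp.single_add]; ac_rfl]
        rw [LL_P, hn, mul_smul_comm, ← add_smul, Nat.cast_add]
    exact this k

lemma J_span (hJ : IsJackFamily J) : Submodule.span F (Set.range J) = ⊤ := by
  rw [eq_top_iff]
  intro f _
  rw [f.as_sum]
  refine Submodule.sum_mem _ fun m _ => ?_
  rw [← mul_one (coeff m f), ← smul_eq_mul, ← smul_monomial]
  refine Submodule.smul_mem _ _ ?_
  obtain ⟨n, hn⟩ := LL_pn m
  have h := mem_WS_Pt hn
  rw [← WS_span hJ (Pt n)] at h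
  · refine Submodule.span_mono ?_ h
    rintro _ ⟨r, rfl⟩; exact ⟨r, rfl⟩
  · intro rho hr
    rw [mem_Pt] at hr
    exact mem_WS_Pt (by rw [LL_J hJ, hr])

lemma J_ext (hJ : IsJackFamily J) {f : SymA} (h : ∀ l, hall f (J l) = 0) : f = 0 := span_ext (J_span hJ) h

/-- `f` in the span of `J l` if it is orthogonal to all the others -/
lemma J_prop (hJ : IsJackFamily J) {f : SymA} {l : JPartition} (h : ∀ r, r ≠ l → hall f (J r) = 0) : ∃ c : F, f = c • J l := by
  refine ⟨hall f (J l) / hall (J l) (J l), ?_⟩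
  rw [← sub_eq_zero]
  refine J_ext hJ fun r => ?_
  rw [hall_sub_left, hall_smul_left]
  by_cases hr : r = l
  · subst hr
    rw [div_mul_cancel₀ _ (J_self hJ r), sub_self]
  · rw [h r hr, hJ.orthogonal _ _ (Ne.symm hr), mul_zero, sub_zero]

/-- strictly smaller partitions -/
def Slt (l : JPartition) : Finset JPartition := (Pt (psize l)).filter fun m => Qn m < Qn l
/-- weakly smaller partitions -/
def Sle (l : JPartition) : Finset JPartition := insert l (Slt l)

lemma mem_Slt (l m : JPartition) : m ∈ Slt l ↔ psize m = psize l ∧ Qn m < Qn l := by simp [Slt]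
lemma mem_Sle (l m : JPartition) : m ∈ Sle l ↔ m = l ∨ (psize m = psize l ∧ Qn m < Qn l) := by simp [Sle, Slt]

lemma tri' (hJ : IsJackFamily J) {l m : JPartition} (h : hall (J l) (gP m) ≠ 0) : m = l ∨ (psize m = psize l ∧ Qn m < Qn l) := by
  have hd : dominates m l := by
    by_contra hd; exact h (tri hJ _ _ hd)
  by_cases e : m = l
  · exact Or.inl e
  · exact Or.inr ⟨hd.1, dom_Q hd e⟩

lemma Slt_J (hJ : IsJackFamily J) (l : JPartition) : ∀ r ∈ Slt l, J r ∈ WS (Slt l) := by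
  intro r hr mu hmu
  by_contra h
  rw [mem_Slt] at *
  rcases tri' hJ h with rfl | ⟨h1, h2⟩
  · exact hmu hr
  · exact hmu ⟨h1.trans hr.1, h2.trans hr.2⟩

lemma Sle_J (hJ : IsJackFamily J) (l : JPartition) : ∀ r ∈ Sle l, J r ∈ WS (Sle l) := by
  intro r hr mu hmu
  by_contra h
  rw [mem_Sle] at *
  rcases tri' hJ h with rfl | ⟨h1, h2⟩
  · exact hmu hr
  · rcases hr with rfl | hr
    · exact hmu (Or.inr ⟨h1, h2⟩)
    · exact hmu (Or.inr ⟨h1.trans hr.1, h2.trans hr.2⟩)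

lemma DD_sub_mem (hJ : IsJackFamily J) (l : JPartition) : DD alpha (J l) - ee l • J l ∈ WS (Slt l) := by
  intro mu hmu
  rw [mem_Slt] at hmu
  have h1 : ∀ x ∈ Ug (psize mu) (Qn mu), hall (J l) x = 0 := by
    intro x hx
    induction hx using Submodule.span_induction with
    | mem x h =>
      obtain ⟨r, e1, e2, rfl⟩ := h
      by_contra h
      rcases tri' hJ h with rfl | ⟨h1, h2⟩
      · exact hmu ⟨e1.symm, e2⟩
      · exact hmu ⟨by omega, by omega⟩
    | zero => simp
    | add x y _ _ hx hy => simp [hx, hy]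
    | smul c x _ hx => simp [hx]
  have h2 := h1 _ (DD_gP mu)
  rw [hall_sub_right, hall_smul_right, sub_eq_zero] at h2
  rw [hall_sub_left, hall_smul_left, hall_DD, h2, ← sub_mul]
  by_cases e : mu = l
  · rw [e, sub_self, zero_mul]
  · have : hall (J l) (gP mu) = 0 := by
      by_contra h
      rcases tri' hJ h with rfl | h
      · exact e rfl
      · exact hmu h
    rw [this, mul_zero]

lemma DD_J_orth (hJ : IsJackFamily J) (l r : JPartition) (h : ¬ (r = l ∨ (psize r = psize l ∧ Qn r < Qn l))) : hall (DD alpha (J l)) (J r) = 0 := by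
  have h1 := WS_orth hJ _ (Slt_J hJ l) (DD_sub_mem hJ l) (l := r) (by rw [mem_Slt]; tauto)
  rw [hall_sub_left, hall_smul_left, hJ.orthogonal l r (by tauto), mul_zero, sub_zero] at h1
  exact h1

lemma DD_J (hJ : IsJackFamily J) (l : JPartition) : DD alpha (J l) = ee l • J l := by
  rw [← sub_eq_zero]
  refine J_ext hJ fun r => ?_
  by_cases h : r ∈ Slt l
  · rw [mem_Slt] at h
    have hne : l ≠ r := by rintro rfl; exact lt_irrefl _ h.2
    rw [hall_sub_left, hall_smul_left, hJ.orthogonal l r hne, mul_zero, sub_zero, hall_DD, hall_comm]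
    refine DD_J_orth hJ r l ?_
    rintro (h' | h')
    · exact hne h'
    · omega
  · exact WS_orth hJ _ (Slt_J hJ l) (DD_sub_mem hJ l) h

lemma J_lead (hJ : IsJackFamily J) (l : JPartition) : hall (J l) (gP l) ≠ 0 := by
  intro h
  have hm : J l ∈ WS (Slt l) := by
    intro mu hmu
    by_contra h'
    rcases tri' hJ h' with rfl | h2
    · exact h' h
    · exact hmu ((mem_Slt _ _).2 h2)
  exact J_self hJ l (WS_orth hJ _ (Slt_J hJ l) hm (by rw [mem_Slt]; omega))

end JK
end

section
namespace JK
open MvPolynomial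
variable {J : JPartition → SymA}

lemma gk_pos_gP (k : ℕ+) (mu : JPartition) : gk k * gP mu = gP (k ::ₘ mu) := (gP_cons k mu).symm

lemma qk_J_zero (hJ : IsJackFamily J) (l : JPartition) (k : ℕ) (h : row l 0 < k) : qk k (J l) = 0 := by
  refine gP_ext fun mu => ?_
  lift k to ℕ+ using by omega
  rw [hall_qk, gk_pos_gP]
  refine tri hJ _ _ fun hd => ?_
  have h1 := dom_row0 hd
  have h2 := le_row_zero (k ::ₘ mu) k (Multiset.mem_cons_self _ _)
  omega

lemma pr_gP_ideal (s : ℕ) (mu : JPartition) :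
    alpha • pr (gk s) (gP mu) + (psize mu : F) • (gk s * gP mu) ∈ Ideal.span {x : SymA | ∃ m, s < m ∧ x = gk m} := by
  have hsm : ∀ (c : F) (x : SymA), x ∈ Ideal.span {x : SymA | ∃ m, s < m ∧ x = gk m} →
      c • x ∈ Ideal.span {x : SymA | ∃ m, s < m ∧ x = gk m} := by
    intro c x hx
    rw [MvPolynomial.smul_eq_C_mul]
    exact Ideal.mul_mem_left _ _ hx
  induction mu using Multiset.induction with
  | empty => simp [gP_zero, pr]
  | cons l mu ih =>
    have e : alpha • pr (gk s) (gP (l ::ₘ mu)) + (psize (l ::ₘ mu) : F) • (gk s * gP (l ::ₘ mu)) =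
      gk l * (alpha • pr (gk s) (gP mu) + (psize mu : F) • (gk s * gP mu)) +
      gP mu * (alpha • pr (gk s) (gk l) + ((l : ℕ) : F) • (gk s * gk l)) := by
      rw [psize_cons, gP_cons, pr_mul]
      simp only [Nat.cast_add, add_smul, smul_add, mul_add, mul_smul_comm]
      rw [show gk l * (gk s * gP mu) = gk s * (gk l * gP mu) by ring, show gP mu * (gk s * gk l) = gk s * (gk l * gP mu) by ring]
      abel
    rw [e]
    refine Ideal.add_mem _ (Ideal.mul_mem_left _ _ ih) (Ideal.mul_mem_left _ _ ?_)
    have := pr_span l s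
    generalize alpha • pr (gk s) (gk l) + ((l : ℕ) : F) • (gk s * gk l) = z at this ⊢
    induction this using Submodule.span_induction with
    | mem x hx =>
      obtain ⟨r, h1, h2, rfl⟩ := hx
      exact Ideal.mul_mem_right _ _ (Ideal.subset_span ⟨_, by omega, rfl⟩)
    | zero => simp
    | add x y _ _ hx hy => exact Ideal.add_mem _ hx hy
    | smul c x _ hx => exact hsm _ _ hx

lemma hall_ideal (hJ : IsJackFamily J) (l : JPartition) (s : ℕ) (hs : row l 0 ≤ s) (x : SymA)
    (hx : x ∈ Ideal.span {x : SymA | ∃ m, s < m ∧ x = gk m}) : hall (J l) x = 0 := by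
  induction hx using Submodule.span_induction with
  | mem x hx =>
    obtain ⟨m, hm, rfl⟩ := hx
    rw [← mul_one (gk m), ← hall_qk, qk_J_zero hJ _ _ (by omega), hall_zero_left]
  | zero => simp
  | add x y _ _ hx hy => simp [hx, hy]
  | smul c x h _ =>
    rw [smul_eq_mul]
    have key : ∀ x ∈ Ideal.span {x : SymA | ∃ m, s < m ∧ x = gk m}, ∀ c, hall (J l) (c * x) = 0 := by
      intro x hx
      induction hx using Submodule.span_induction with
      | mem x hx =>
        intro c
        obtain ⟨m, hm, rfl⟩ := hx
        rw [mul_comm, ← hall_qk, qk_J_zero hJ _ _ (by omega), hall_zero_left]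
      | zero => simp
      | add x y _ _ hx hy => intro c; simp [mul_add, hx c, hy c]
      | smul d x _ hx => intro c; rw [smul_eq_mul, ← mul_assoc]; exact hx _
    exact key x h c

lemma qk_J (hJ : IsJackFamily J) (s : ℕ+) (mu : JPartition) (hs : ∀ x ∈ mu, x ≤ s) :
    ∃ c : F, c ≠ 0 ∧ qk s (J (s ::ₘ mu)) = c • J mu := by
  set f := qk s (J (s ::ₘ mu)) with hf
  have hg : ∀ rho, hall f (gP rho) = hall (J (s ::ₘ mu)) (gP (s ::ₘ rho)) := by
    intro rho; rw [hf, hall_qk, gk_pos_gP]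
  have hz : ∀ rho, hall f (gP rho) ≠ 0 → rho = mu ∨ (psize rho = psize mu ∧ Qn rho < Qn mu) := by
    intro rho h
    rw [hg] at h
    rcases tri' hJ h with h | ⟨h1, h2⟩
    · exact Or.inl ((Multiset.cons_inj_right s).1 h)
    · rw [psize_cons, psize_cons] at h1; rw [Qn_cons, Qn_cons] at h2
      exact Or.inr ⟨by omega, by omega⟩
  have hW : f ∈ WS (Sle mu) := by
    intro rho h
    by_contra h'
    exact h ((mem_Sle _ _).2 (hz _ h'))
  have hD : DD alpha f = ee mu • f := by
    rw [← sub_eq_zero]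
    refine gP_ext fun rho => ?_
    have h1 := hall_ideal hJ (s ::ₘ mu) s (row_cons_zero s mu hs).le _ (pr_gP_ideal s rho)
    rw [hall_add_right, hall_smul_right, gk_pos_gP] at h1
    have h2 : hall (DD alpha (J (s ::ₘ mu))) (gk s * gP rho) = ee (s ::ₘ mu) * hall f (gP rho) := by
      rw [DD_J hJ, hall_smul_left, hg, gk_pos_gP]
    rw [hall_DD, DD_mul, hall_add_right, hall_add_right, DD_gk, smul_mul_assoc, gk_pos_gP, hall_smul_right, ← hall_qk, ← hf,
      ← hg, ← hall_DD, ee_cons s mu hs] at h2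
    rw [hall_smul_right, ← hg] at h1
    rw [hall_smul_right] at h2
    rw [hall_sub_left, hall_smul_left]
    by_cases h : psize rho = psize mu
    · rw [h] at h1
      linear_combination h2 - h1
    · have h0 : hall f (gP rho) = 0 := by
        by_contra h'
        rcases hz _ h' with rfl | h'
        · exact h rfl
        · exact h h'.1
      rw [h0] at h1 h2 ⊢
      linear_combination h2 - h1
  obtain ⟨c, hc⟩ := J_prop hJ (f := f) (l := mu) (by
    intro r hr
    by_cases h : r ∈ Sle mu
    · rw [mem_Sle] at h
      rcases h with h | h
      · exact absurd h hr
      have h1 := hall_DD f (J r)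
      rw [hD, DD_J hJ, hall_smul_left, hall_smul_right] at h1
      by_contra h0
      have := ee_size_Q h.1.symm (mul_right_cancel₀ h0 h1)
      omega
    · exact WS_orth hJ _ (Sle_J hJ mu) hW h)
  refine ⟨c, ?_, hc⟩
  rintro rfl
  have := hg mu
  rw [hc, zero_smul, hall_zero_left] at this
  exact J_lead hJ _ this.symm

lemma J_mem (hJ : IsJackFamily J) (f : SymA) : f ∈ Submodule.span F (J '' {r | hall f (J r) ≠ 0}) := by
  have h : f ∈ Submodule.span F (Set.range J) := by rw [J_span hJ]; trivial
  obtain ⟨c, rfl⟩ := Finsupp.mem_span_range_iff_exists_finsupp.1 h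
  refine Submodule.sum_mem _ fun r hr => Submodule.smul_mem _ _ (Submodule.subset_span ⟨r, ?_, rfl⟩)
  rw [Set.mem_setOf_eq, Finsupp.sum, hall_sum_left, Finset.sum_eq_single r, hall_smul_left]
  · exact mul_ne_zero (Finsupp.mem_support_iff.1 hr) (J_self hJ r)
  · intro b _ hb; rw [hall_smul_left, hJ.orthogonal _ _ hb, mul_zero]
  · intro h; exact absurd hr h

lemma J_lin (hJ : IsJackFamily J) (f : SymA) {φ : SymA →ₗ[F] F} (h : ∀ r, hall f (J r) ≠ 0 → φ (J r) = 0) : φ f = 0 := by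
  have := J_mem hJ f
  have h2 : Submodule.span F (J '' {r | hall f (J r) ≠ 0}) ≤ LinearMap.ker φ := by
    rw [Submodule.span_le]
    rintro _ ⟨r, hr, rfl⟩
    exact h r hr
  exact h2 this

lemma qmax (hJ : IsJackFamily J) (f : SymA) (s : ℕ+) (hf : ∀ r, hall f (J r) ≠ 0 → row r 0 ≤ s)
    (nu : JPartition) (hnu : ∀ x ∈ nu, x ≤ s) (h : hall f (J (s ::ₘ nu)) ≠ 0) : hall (qk s f) (J nu) ≠ 0 := by
  obtain ⟨c, hc, e⟩ := qk_J hJ s nu hnu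
  have := J_lin hJ f (φ := hall (J (s ::ₘ nu)) (J (s ::ₘ nu)) • (hallL (J nu) ∘ₗ qk s) -
    (c * hall (J nu) (J nu)) • hallL (J (s ::ₘ nu))) (by
    intro r hr
    simp only [LinearMap.sub_apply, LinearMap.smul_apply, LinearMap.comp_apply, hallL_apply, smul_eq_mul]
    by_cases hrs : r = s ::ₘ nu
    · subst hrs
      rw [e, hall_smul_left]; ring
    · rw [hJ.orthogonal _ _ hrs, mul_zero, sub_zero]
      rcases lt_or_eq_of_le (hf r hr) with h1 | h1
      · rw [qk_J_zero hJ _ _ h1]; simp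
      · have hr0 : r ≠ 0 := by
          rintro rfl
          rw [row_zero] at h1
          exact s.pos.ne h1
        obtain ⟨t, mu, ht, rfl⟩ := part_exists r hr0
        rw [row_cons_zero t mu ht] at h1
        have h1 := PNat.coe_injective h1
        subst h1
        obtain ⟨d, hd, e'⟩ := qk_J hJ t mu ht
        rw [e', hall_smul_left, hJ.orthogonal mu nu (by rintro rfl; exact hrs rfl)]; ring)
  simp only [LinearMap.sub_apply, LinearMap.smul_apply, LinearMap.comp_apply, hallL_apply, smul_eq_mul] at this
  intro h0
  rw [h0, mul_zero, zero_sub, neg_eq_zero] at this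
  exact mul_ne_zero (mul_ne_zero hc (J_self hJ _)) h this

lemma row_zero_cases (r : JPartition) (h : row r 0 ≠ 0) : ∃ (s : ℕ+) (mu : JPartition), (∀ x ∈ mu, x ≤ s) ∧ r = s ::ₘ mu ∧ row r 0 = s := by
  have hr0 : r ≠ 0 := by rintro rfl; exact h (row_zero _)
  obtain ⟨t, mu, ht, rfl⟩ := part_exists r hr0
  exact ⟨t, mu, ht, rfl, row_cons_zero t mu ht⟩

lemma qtop (hJ : IsJackFamily J) (f : SymA) (n : ℕ) (hn : LL f = (n : F) • f) (k : ℕ) (hk : ∀ j, k < j → qk j f = 0)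
    (nu : JPartition) (h : hall f (J nu) ≠ 0) : row nu 0 ≤ k := by
  by_contra hlt
  have hsz : ∀ r, hall f (J r) ≠ 0 → r ∈ Pt n := by
    intro r hr
    rw [mem_Pt]
    by_contra h'
    exact hr (hall_homog hn (LL_J hJ r) (Ne.symm h'))
  obtain ⟨r, hr, hmax⟩ := Finset.exists_max_image ((Pt n).filter fun r => hall f (J r) ≠ 0) (fun r => row r 0)
    ⟨nu, Finset.mem_filter.2 ⟨hsz _ h, h⟩⟩
  rw [Finset.mem_filter] at hr
  have h1 := hmax nu (Finset.mem_filter.2 ⟨hsz _ h, h⟩)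
  obtain ⟨s, mu, hs, rfl, e⟩ := row_zero_cases r (by omega)
  have := qmax hJ f s (fun t ht => e ▸ hmax t (Finset.mem_filter.2 ⟨hsz _ ht, ht⟩)) mu hs hr.2
  rw [hk s (by omega), hall_zero_left] at this
  exact this rfl

lemma hall_P1 (f h : SymA) : hall (Pn 1 * f) h = alpha * hall f (d1 h) := by
  have := hall_X 1 f h
  rw [← Pn_coe] at this
  simpa [d1] using this

lemma qk_P1 (k : ℕ) (f : SymA) : qk (k + 1) (Pn 1 * f) = Pn 1 * qk (k + 1) f + qk k f := by
  have := qk_X (k + 1) 1 f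
  rw [← Pn_coe] at this
  simpa using this

lemma qk_d1 (k : ℕ) (f : SymA) : qk k (d1 f) = d1 (qk k f) := by
  refine hall_ext fun x => ?_
  apply mul_left_cancel₀ alpha_ne
  rw [← hall_P1, hall_comm, hall_qk, hall_comm (Pn 1 * x), hall_qk, hall_comm (d1 f), ← hall_P1, hall_comm]
  congr 1; ring

lemma qk_zero (f : SymA) : qk 0 f = f := by
  refine hall_ext fun x => ?_
  rw [hall_comm, hall_qk, gk_zero, one_mul, hall_comm]

/-- `nu` is `lam` with a box added in row `r` -/
def AddBox (lam nu : JPartition) (r : ℕ) : Prop := ∀ i, row nu i = row lam i + if i = r then 1 else 0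

lemma LL_P1J (hJ : IsJackFamily J) (l : JPartition) : LL (Pn 1 * J l) = ((psize l + 1 : ℕ) : F) • (Pn 1 * J l) := by
  rw [LL_P, LL_J hJ, mul_smul_comm, ← add_smul]; simp

lemma psize_of_P1 (hJ : IsJackFamily J) {l nu : JPartition} (h : hall (Pn 1 * J l) (J nu) ≠ 0) : psize nu = psize l + 1 := by
  by_contra h'
  exact h (hall_homog (LL_P1J hJ l) (LL_J hJ nu) (Ne.symm h'))

lemma LL_d1J (hJ : IsJackFamily J) (nu : JPartition) (n : ℕ) (h : psize nu = n + 1) : LL (d1 (J nu)) = (n : F) • d1 (J nu) := by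
  have h1 := d1_LL (J nu)
  rw [LL_J hJ, map_smul, h] at h1
  rw [Nat.cast_add, Nat.cast_one, add_smul, one_smul] at h1
  have := add_right_cancel h1
  exact this.symm

lemma pieri (hJ : IsJackFamily J) (l : JPartition) : ∀ nu, hall (Pn 1 * J l) (J nu) ≠ 0 → ∃ r, AddBox l nu r := by
  induction l using Multiset.strongInductionOn with
  | _ l ih =>
  intro nu h
  have hsz := psize_of_P1 hJ h
  have hb : ∀ nu, hall (Pn 1 * J l) (J nu) ≠ 0 → row nu 0 ≤ row l 0 + 1 := by
    refine qtop hJ _ _ (LL_P1J hJ l) _ fun j hj => ?_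
    obtain ⟨j, rfl⟩ := Nat.exists_eq_succ_of_ne_zero (by omega : j ≠ 0)
    rw [Nat.succ_eq_add_one] at *
    rw [qk_P1, qk_J_zero hJ _ _ (by omega), qk_J_zero hJ _ _ (by omega)]; simp
  have hd : hall (d1 (J nu)) (J l) ≠ 0 := by
    intro h0
    rw [hall_P1, hall_comm, h0, mul_zero] at h
    exact h rfl
  have ha : ∀ r, hall (d1 (J nu)) (J r) ≠ 0 → row r 0 ≤ row nu 0 := by
    refine qtop hJ _ _ (LL_d1J hJ nu _ hsz) _ fun j hj => ?_
    rw [qk_d1, qk_J_zero hJ _ _ hj, map_zero]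
  have h1 := hb nu h
  have h2 := ha l hd
  have hnu0 : row nu 0 ≠ 0 := by
    intro h0
    have : nu = 0 := by
      refine row_inj fun i => ?_
      have := row_anti nu (Nat.zero_le i)
      rw [row_zero]; omega
    rw [this] at hsz; simp at hsz
  obtain ⟨s, nu', hs, rfl, es⟩ := row_zero_cases nu hnu0
  rcases lt_or_eq_of_le h2 with h3 | h3
  · have e : (s : ℕ) = row l 0 + 1 := by omega
    have := qmax hJ _ s (fun r hr => (hb r hr).trans e.ge) nu' hs h
    rw [e, qk_P1, qk_J_zero hJ _ _ (by omega), mul_zero, zero_add] at this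
    refine ⟨0, ?_⟩
    by_cases hl : row l 0 = 0
    · have hl0 : l = 0 := by
        refine row_inj fun i => ?_
        have := row_anti l (Nat.zero_le i)
        rw [row_zero]; omega
      rw [hl, qk_zero] at this
      have : l = nu' := by
        by_contra h'; exact this (hJ.orthogonal _ _ h')
      subst this
      intro i
      rcases i with _ | i
      · rw [es, e]; simp
      · rw [row_cons_succ s _ hs, hl0]; simp
    · obtain ⟨t, l', ht, rfl, et⟩ := row_zero_cases l hl
      obtain ⟨c, hc, e'⟩ := qk_J hJ t l' ht
      rw [et, e', hall_smul_left] at this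
      have : l' = nu' := by
        by_contra h'; exact this (by rw [hJ.orthogonal _ _ h', mul_zero])
      subst this
      intro i
      rcases i with _ | i
      · rw [es, e]; simp
      · rw [row_cons_succ s _ hs, row_cons_succ t _ ht]; simp
  · obtain ⟨t, l', ht, rfl, et⟩ := row_zero_cases l (by omega)
    have hts : t = s := PNat.coe_injective (by omega)
    subst hts
    have := qmax hJ _ t (fun r hr => (ha r hr).trans es.le) l' ht hd
    obtain ⟨c, hc, e'⟩ := qk_J hJ t nu' hs
    rw [qk_d1, e', map_smul, hall_smul_left] at this
    obtain ⟨r, hr⟩ := ih l' (Multiset.lt_cons_self _ _) nu' (by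
      rw [hall_P1, hall_comm]
      exact mul_ne_zero alpha_ne fun h' => this (by rw [h', mul_zero]))
    refine ⟨r + 1, ?_⟩
    intro i
    rcases i with _ | i
    · rw [es, et]; simp
    · rw [row_cons_succ t _ hs, row_cons_succ t _ ht, hr]; simp

lemma AddBox.psize {l nu : JPartition} {r : ℕ} (h : AddBox l nu r) : psize nu = psize l + 1 := by
  rw [← psize_row nu (plen l + plen nu + r + 1) (by omega), ← psize_row l (plen l + plen nu + r + 1) (by omega),
    Finset.sum_congr rfl fun i _ => h i, Finset.sum_add_distrib]
  simp

lemma AddBox.ee {l nu : JPartition} {r : ℕ} (h : AddBox l nu r) : ee nu - ee l = alpha * row l r - r := by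
  rw [ee_row nu (plen l + plen nu + r + 1) (by omega), ee_row l (plen l + plen nu + r + 1) (by omega), ← Finset.sum_sub_distrib,
    Finset.sum_eq_single r]
  · rw [h r, if_pos rfl, Nat.cast_choose_two, Nat.cast_choose_two]; push_cast; ring
  · intro i _ hi
    rw [h i, if_neg hi]; simp
  · intro hr; exact absurd (Finset.mem_range.2 (by omega)) hr

lemma hall_Dm1 (hJ : IsJackFamily J) (l nu : JPartition) : alpha * hall (Dm 1 (J l)) (J nu) = (ee nu - ee l) * hall (Pn 1 * J l) (J nu) := by
  have h := hall_DD (Pn 1 * J l) (J nu)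
  rw [DD_P1, DD_J hJ, DD_J hJ, hall_add_left, mul_smul_comm, hall_smul_left, hall_smul_left, hall_smul_right] at h
  linear_combination h

lemma hall_RR0 (hJ : IsJackFamily J) (l nu : JPartition) : hall (RR alpha 0 (J l)) (J nu) = (ee nu - ee l) * hall (Dm 1 (J l)) (J nu) := by
  have h := hall_DD (Dm 1 (J l)) (J nu)
  rw [DD_Dm, DD_J hJ, DD_J hJ, hall_add_left, map_smul, hall_smul_left, hall_smul_right] at h
  linear_combination h

end JK
end

section
namespace JK
open MvPolynomial
variable {J : JPartition → SymA}

/-- coefficient of `u^l` in `(x + u y)^n` -/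
def WW {A : Type*} [Ring A] (x y : A) : ℕ → ℕ → A
  | 0, 0 => 1
  | 0, _ + 1 => 0
  | n + 1, 0 => x * WW x y n 0
  | n + 1, l + 1 => x * WW x y n (l + 1) + y * WW x y n l

lemma WW_gt {A : Type*} [Ring A] (x y : A) (n : ℕ) : ∀ l, n < l → WW x y n l = 0 := by
  induction n with
  | zero => intro l hl; obtain ⟨l, rfl⟩ := Nat.exists_eq_succ_of_ne_zero hl.ne'; rfl
  | succ n ih =>
    intro l hl
    obtain ⟨l, rfl⟩ := Nat.exists_eq_succ_of_ne_zero (by omega : l ≠ 0)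
    rw [Nat.succ_eq_add_one, WW, ih _ (by omega), ih _ (by omega)]; simp

lemma WW_self {A : Type*} [Ring A] (x y : A) (n : ℕ) : WW x y n n = y ^ n := by
  induction n with
  | zero => rw [pow_zero]; simp [WW]
  | succ n ih => rw [WW, WW_gt _ _ _ _ (by omega), ih, pow_succ']; simp

lemma WW_pow {A : Type*} [Ring A] [Algebra F A] (x y : A) (u : F) (n : ℕ) :
    (x + u • y) ^ n = ∑ l ∈ Finset.range (n + 1), u ^ l • WW x y n l := by
  induction n with
  | zero => simp [WW]
  | succ n ih =>
    have hx : x * ∑ l ∈ Finset.range (n + 1), u ^ l • WW x y n l =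
        ∑ l ∈ Finset.range (n + 1), u ^ (l + 1) • (x * WW x y n (l + 1)) + x * WW x y n 0 := by
      rw [Finset.sum_range_succ (fun l => u ^ (l + 1) • (x * WW x y n (l + 1))), WW_gt x y n (n + 1) (by omega),
        Finset.mul_sum, Finset.sum_range_succ']
      simp only [mul_smul_comm, pow_zero, one_smul, mul_zero, smul_zero, add_zero]
    have hy : u • y * ∑ l ∈ Finset.range (n + 1), u ^ l • WW x y n l =
        ∑ l ∈ Finset.range (n + 1), u ^ (l + 1) • (y * WW x y n l) := by
      rw [Finset.mul_sum]
      refine Finset.sum_congr rfl fun l _ => ?_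
      rw [smul_mul_smul_comm, pow_succ']
    rw [pow_succ', ih, add_mul, hx, hy, Finset.sum_range_succ' _ (n + 1)]
    simp only [WW, smul_add, Finset.sum_add_distrib, pow_zero, one_smul]
    abel

/-- coefficient of `u^l` in `B_n(u)` -/
def BBc (n l : ℕ) : Module.End F SymA :=
  alpha⁻¹ • (Th ∘ₗ (WW (A := Module.End F (MM F)) (Gam alpha 0) (yp 1) n l) ∘ₗ mon 0)

lemma BB_BBc (u : F) (n : ℕ) : BB alpha u n = ∑ l ∈ Finset.range (n + 1), u ^ l • BBc n l := by
  have h : (Gam alpha u : Module.End F (MM F)) = Gam alpha 0 + u • yp 1 := by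
    simp only [Gam, zero_smul, add_zero]
  refine LinearMap.ext fun f => ?_
  have h2 := congrArg (fun A : Module.End F (MM F) => alpha⁻¹ • Th (A (mon 0 f))) (WW_pow (A := Module.End F (MM F)) (Gam alpha 0) (yp 1) u n)
  rw [BB_apply, h]
  refine h2.trans ?_
  simp only [LinearMap.sum_apply, map_sum, LinearMap.smul_apply, BBc, LinearMap.comp_apply, map_smul, Finset.smul_sum]
  refine Finset.sum_congr rfl fun l _ => ?_
  rw [smul_comm]

lemma BBc_gt (n l : ℕ) (h : n < l) : BBc n l = 0 := by
  rw [BBc, WW_gt _ _ _ _ h]; simp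

lemma yp_pow (n k : ℕ) (f : SymA) : ((yp 1 : Module.End F (MM F)) ^ n) (mon k f) = mon (k + n) f := by
  induction n with
  | zero => simp
  | succ n ih => rw [pow_succ', Module.End.mul_apply, ih, yp_mon]; rfl

lemma BBc_self (n : ℕ) (f : SymA) : BBc n n f = alpha⁻¹ • (Pn n * f) := by
  rw [BBc, WW_self]
  simp [yp_pow]

lemma alpha_inj {a i a' i' : ℕ} (h : alpha * a - i = alpha * a' - i') : a = a' ∧ i = i' := by
  have hp : algebraMap (Polynomial ℚ) F (Polynomial.X * Polynomial.C (a : ℚ) - Polynomial.C (i : ℚ)) =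
      algebraMap (Polynomial ℚ) F (Polynomial.X * Polynomial.C (a' : ℚ) - Polynomial.C (i' : ℚ)) := by
    simp only [map_mul, map_sub, RatFunc.algebraMap_X, RatFunc.algebraMap_C, map_natCast]
    exact h
  have hp2 := IsFractionRing.injective (Polynomial ℚ) F hp
  have h1 := congrArg (fun p => Polynomial.coeff p 1) hp2
  have h0 := congrArg (fun p => Polynomial.coeff p 0) hp2
  simp only [Polynomial.coeff_sub, Polynomial.coeff_X_mul, Polynomial.coeff_C_zero, Polynomial.coeff_C_succ, sub_zero,
    Polynomial.coeff_X_mul_zero, zero_sub, neg_inj] at h1 h0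
  exact ⟨by exact_mod_cast h1, by exact_mod_cast h0⟩

/-- content product -/
def ww (u : F) (l : JPartition) : F := ∏ i ∈ Finset.range (plen l), ∏ j ∈ Finset.range (row l i), (alpha * j - i + u)

lemma ww_row (u : F) (l : JPartition) (N : ℕ) (h : plen l ≤ N) :
    ww u l = ∏ i ∈ Finset.range N, ∏ j ∈ Finset.range (row l i), (alpha * j - i + u) := by
  refine Finset.prod_subset (Finset.range_mono h) fun i _ hi => ?_
  rw [Finset.mem_range, not_lt] at hi
  rw [row_ge_len l i hi]; simp

lemma ww_addBox {l nu : JPartition} {r : ℕ} (h : AddBox l nu r) (u : F) : ww u nu = (ee nu - ee l + u) * ww u l := by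
  rw [h.ee, ww_row u nu (plen l + plen nu + r + 1) (by omega), ww_row u l (plen l + plen nu + r + 1) (by omega)]
  have hr : r ∈ Finset.range (plen l + plen nu + r + 1) := Finset.mem_range.2 (by omega)
  rw [← Finset.mul_prod_erase _ _ hr, ← Finset.mul_prod_erase _ _ hr, h r, if_pos rfl, Finset.prod_range_succ]
  rw [Finset.prod_congr rfl (s₁ := Finset.erase _ r) (g := fun i => ∏ j ∈ Finset.range (row l i), (alpha * j - i + u))]
  · ring
  · intro i hi
    rw [h i, if_neg (Finset.ne_of_mem_erase hi), add_zero]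

lemma ww_ne (m : ℕ) (l : JPartition) : ww (-(m + 1 : F)) l ≠ 0 := by
  refine Finset.prod_ne_zero_iff.2 fun i _ => Finset.prod_ne_zero_iff.2 fun j _ h => ?_
  have : alpha * j - (i + m + 1 : ℕ) = alpha * (0 : ℕ) - (0 : ℕ) := by
    push_cast; linear_combination h
  have := (alpha_inj this).2
  omega

/-- Jack basis -/
def bJ (hJ : IsJackFamily J) : Module.Basis JPartition F SymA := Module.Basis.mk (J_li hJ) (J_span hJ).ge

lemma bJ_apply (hJ : IsJackFamily J) (l) : bJ hJ l = J l := by simp [bJ]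

def ZZ (hJ : IsJackFamily J) (u : F) : SymA →ₗ[F] SymA := (bJ hJ).constr F fun l => ww u l • J l

lemma ZZ_J (hJ : IsJackFamily J) (u : F) (l) : ZZ hJ u (J l) = ww u l • J l := by
  have := (bJ hJ).constr_basis F (fun l => ww u l • J l) l
  rwa [bJ_apply] at this

lemma J_lext (hJ : IsJackFamily J) {V : Type*} [AddCommGroup V] [Module F V] {A B : SymA →ₗ[F] V} (h : ∀ l, A (J l) = B (J l)) : A = B :=
  (bJ hJ).ext fun l => by rw [bJ_apply]; exact h l

lemma hall_ZZ (hJ : IsJackFamily J) (u : F) (g : SymA) (nu) : hall (ZZ hJ u g) (J nu) = ww u nu * hall g (J nu) := by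
  have : hallL (J nu) ∘ₗ ZZ hJ u = ww u nu • hallL (J nu) := by
    refine J_lext hJ fun l => ?_
    simp only [LinearMap.comp_apply, ZZ_J, map_smul, LinearMap.smul_apply, hallL_apply, smul_eq_mul]
    by_cases h : l = nu
    · rw [h]
    · rw [hJ.orthogonal _ _ h]; ring
  have := LinearMap.congr_fun this g
  simpa [hallL_apply] using this

lemma ZZ_surj (hJ : IsJackFamily J) (m : ℕ) : Function.Surjective (ZZ hJ (-(m + 1 : F))) := by
  rw [← LinearMap.range_eq_top, eq_top_iff, ← J_span hJ, Submodule.span_le]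
  rintro _ ⟨l, rfl⟩
  refine ⟨(ww (-(m + 1 : F)) l)⁻¹ • J l, ?_⟩
  rw [map_smul, ZZ_J, smul_smul, inv_mul_cancel₀ (ww_ne m l), one_smul]

lemma hall_J_ext (hJ : IsJackFamily J) {f g : SymA} (h : ∀ l, hall f (J l) = hall g (J l)) : f = g := by
  rw [← sub_eq_zero]
  exact J_ext hJ fun l => by rw [hall_sub_left, h, sub_self]

lemma pieri_ww (hJ : IsJackFamily J) (u : F) (l nu : JPartition) :
    ww u nu * hall (Pn 1 * J l) (J nu) = (ee nu - ee l + u) * ww u l * hall (Pn 1 * J l) (J nu) := by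
  by_cases h : hall (Pn 1 * J l) (J nu) = 0
  · rw [h]; ring
  · obtain ⟨r, hr⟩ := pieri hJ l nu h
    rw [ww_addBox hr]

lemma ZZ_P1 (hJ : IsJackFamily J) (u : F) (f : SymA) : ZZ hJ u (alpha⁻¹ • (Pn 1 * f)) = BB alpha u 1 (ZZ hJ u f) := by
  have : ZZ hJ u ∘ₗ (alpha⁻¹ • LinearMap.mulLeft F (Pn 1)) = BB alpha u 1 ∘ₗ ZZ hJ u := by
    refine J_lext hJ fun l => hall_J_ext hJ fun nu => ?_
    simp only [LinearMap.comp_apply, LinearMap.smul_apply, LinearMap.mulLeft_apply]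
    rw [hall_ZZ, ZZ_J, map_smul, hall_smul_left, hall_smul_left, BB_one _ _ alpha_ne, hall_add_left, hall_smul_left]
    have h1 := hall_Dm1 hJ l nu
    have h2 := pieri_ww hJ u l nu
    have := alpha_ne
    apply mul_left_cancel₀ this
    field_simp
    linear_combination h2 - ww u l * h1
  exact LinearMap.congr_fun this f

lemma ZZ_Dm1 (hJ : IsJackFamily J) (u : F) (f : SymA) : ZZ hJ u (Dm 1 f) = RR alpha u (ZZ hJ u f) := by
  have : ZZ hJ u ∘ₗ Dm 1 = RR alpha u ∘ₗ ZZ hJ u := by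
    refine J_lext hJ fun l => hall_J_ext hJ fun nu => ?_
    simp only [LinearMap.comp_apply]
    rw [hall_ZZ, ZZ_J, map_smul, hall_smul_left, RR_u, hall_add_left, hall_smul_left, hall_RR0 hJ]
    have h1 := hall_Dm1 hJ l nu
    have h2 := pieri_ww hJ u l nu
    apply mul_left_cancel₀ alpha_ne
    linear_combination (ww u nu - (ee nu - ee l + u) * ww u l) * h1 + (ee nu - ee l) * h2
  exact LinearMap.congr_fun this f

lemma ZZ_P (hJ : IsJackFamily J) (u : F) (n : ℕ) : ∀ f : SymA, ZZ hJ u (alpha⁻¹ • (Pn (n + 1) * f)) = BB alpha u (n + 1) (ZZ hJ u f) := by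
  induction n with
  | zero => exact ZZ_P1 hJ u
  | succ n ih =>
    intro f
    have e : (n + 1 : F) • (alpha⁻¹ • (Pn (n + 1 + 1) * f)) = Dm 1 (alpha⁻¹ • (Pn (n + 1) * f)) - alpha⁻¹ • (Pn (n + 1) * Dm 1 f) := by
      rw [map_smul, Dm_P, smul_add, add_comm 1 (n + 1), add_sub_cancel_left, smul_comm]; simp
    have h := congrArg (ZZ hJ u) e
    rw [map_sub, ZZ_Dm1, ih, ih, ZZ_Dm1, RR_BB_apply, add_sub_cancel_left, map_smul] at h
    refine smul_right_injective _ (natCast_ne n) ?_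
    simpa using h

lemma BB_comm_aux (hJ : IsJackFamily J) (m : ℕ) (a b : ℕ) (f : SymA) :
    BB alpha (-(m + 1 : F)) (a + 1) (BB alpha (-(m + 1 : F)) (b + 1) f) = BB alpha (-(m + 1 : F)) (b + 1) (BB alpha (-(m + 1 : F)) (a + 1) f) := by
  obtain ⟨f, rfl⟩ := ZZ_surj hJ m f
  rw [← ZZ_P, ← ZZ_P, ← ZZ_P, ← ZZ_P]
  congr 1
  rw [mul_smul_comm, mul_smul_comm]
  congr 2
  ring

lemma poly_zero (P : Polynomial F) (h : ∀ m : ℕ, P.eval (-(m + 1 : F)) = 0) : P = 0 := by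
  refine Polynomial.eq_zero_of_infinite_isRoot P (Set.Infinite.mono (s := Set.range fun m : ℕ => (-(m + 1 : F))) ?_ ?_)
  · rintro _ ⟨m, rfl⟩; exact h m
  · refine Set.infinite_range_of_injective fun a b hab => ?_
    simpa using hab

lemma BB_comm (hJ : IsJackFamily J) (u : F) (a b : ℕ) :
    BB alpha u (a + 1) * BB alpha u (b + 1) = BB alpha u (b + 1) * BB alpha u (a + 1) := by
  refine LinearMap.ext fun f => ?_
  rw [Module.End.mul_apply, Module.End.mul_apply]
  ext m
  rw [← sub_eq_zero]
  let P : Polynomial F := ∑ l ∈ Finset.range (a + 1 + 1), ∑ k ∈ Finset.range (b + 1 + 1),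
    Polynomial.C (coeff m (BBc (a + 1) l (BBc (b + 1) k f)) - coeff m (BBc (b + 1) k (BBc (a + 1) l f))) * Polynomial.X ^ (l + k)
  have hP : ∀ u : F, P.eval u = coeff m (BB alpha u (a + 1) (BB alpha u (b + 1) f)) - coeff m (BB alpha u (b + 1) (BB alpha u (a + 1) f)) := by
    intro u
    simp only [P, Polynomial.eval_finset_sum, Polynomial.eval_mul, Polynomial.eval_C, Polynomial.eval_pow, Polynomial.eval_X, BB_BBc,
      LinearMap.sum_apply, LinearMap.smul_apply, map_sum, map_smul, coeff_sum, coeff_smul, smul_eq_mul, Finset.mul_sum, sub_mul, Finset.sum_sub_distrib]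
    congr 1
    · rw [Finset.sum_comm]
      exact Finset.sum_congr rfl fun i _ => Finset.sum_congr rfl fun j _ => by ring
    · exact Finset.sum_congr rfl fun i _ => Finset.sum_congr rfl fun j _ => by ring
  rw [← hP, poly_zero P, Polynomial.eval_zero]
  intro k
  rw [hP, BB_comm_aux hJ, sub_self]

end JK
end

section
namespace JK
open MvPolynomial
variable {J : JPartition → SymA}

/-- the operators `B_{n+1}(-α s)` -/
def bs (s : ℕ) (n : ℕ) : Module.End F SymA := BB alpha (-(alpha * s)) (n + 1)

lemma bs_comm (hJ : IsJackFamily J) (s m n : ℕ) : bs s m * bs s n = bs s n * bs s m := BB_comm hJ _ _ _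

lemma hall_RB (hJ : IsJackFamily J) (u a : F) (l nu : JPartition) :
    alpha * hall (RR alpha u (J l) + a • BB alpha u 1 (J l)) (J nu) =
      (ee nu - ee l + u) * (ee nu - ee l + a) * hall (Pn 1 * J l) (J nu) := by
  rw [RR_u, BB_one _ _ alpha_ne, hall_add_left, hall_add_left, hall_smul_left, hall_smul_left, hall_add_left, hall_smul_left, hall_RR0 hJ]
  have h1 := hall_Dm1 hJ l nu
  have := alpha_ne
  have e : alpha * (u / alpha) = u := by field_simp
  linear_combination (ee nu - ee l + u + a) * h1 + a * hall (Pn 1 * J l) (J nu) * e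

lemma gs_rec (hJ : IsJackFamily J) (s k : ℕ) (a : F) (f : SymA) :
    (k + 1 : F) • GG (bs s) (1 : F) (k + 1) f =
      (RR alpha (-(alpha * s)) (GG (bs s) (1 : F) k f) + (1 - a) • BB alpha (-(alpha * s)) 1 (GG (bs s) (1 : F) k f))
      - GG (bs s) (1 : F) k (RR alpha (-(alpha * s)) f + (-a) • BB alpha (-(alpha * s)) 1 f) := by
  have h := GG_R (K := F) (bs s) (bs_comm hJ s) (RR alpha (-(alpha * s))) (fun n => by
    have := RR_BB alpha (-(alpha * s)) (n + 1)
    refine LinearMap.ext fun g => ?_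
    have := LinearMap.congr_fun this g
    simp only [bs, LinearMap.sub_apply, Module.End.mul_apply, LinearMap.smul_apply, LinearMap.add_apply, Nat.cast_add, Nat.cast_one] at this ⊢
    rw [this, add_sub_cancel_left]) k
  have h2 := LinearMap.congr_fun h f
  have h3 := LinearMap.congr_fun (GG_comm (bs s) (bs_comm hJ s) (1 : F) (bs s 0) (fun n => bs_comm hJ s 0 n) k) f
  simp only [LinearMap.sub_apply, Module.End.mul_apply, LinearMap.smul_apply, LinearMap.add_apply, bs, zero_add] at h2 h3 ⊢
  change (k + 1 : F) • GG (bs s) (1 : F) (k + 1) f = RR alpha (-(alpha * s)) (GG (bs s) (1 : F) k f) - GG (bs s) (1 : F) k (RR alpha (-(alpha * s)) f)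
    + BB alpha (-(alpha * s)) 1 (GG (bs s) (1 : F) k f) at h2
  change BB alpha (-(alpha * s)) 1 (GG (bs s) (1 : F) k f) = GG (bs s) (1 : F) k (BB alpha (-(alpha * s)) 1 f) at h3
  change (k + 1 : F) • GG (bs s) (1 : F) (k + 1) f = _ - GG (bs s) (1 : F) k _
  rw [h2, map_add, map_smul, ← h3, sub_smul, one_smul, neg_smul]
  abel

/-- horizontal strips with largest part at most `s` -/
def Strip (s : ℕ) (l nu : JPartition) : Prop :=
  row nu 0 ≤ s ∧ ∀ i, row nu (i + 1) ≤ row l i ∧ row l i ≤ row nu i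

lemma pieri_u (hJ : IsJackFamily J) (s : ℕ) (l nu : JPartition) (x : F) (hl : row l 0 ≤ s)
    (h : (ee nu - ee l + (-(alpha * s))) * x * hall (Pn 1 * J l) (J nu) ≠ 0) :
    ∃ r, AddBox l nu r ∧ row nu 0 ≤ s := by
  obtain ⟨r, hr⟩ := pieri hJ l nu (fun h' => h (by rw [h', mul_zero]))
  refine ⟨r, hr, ?_⟩
  have h0 := hr 0
  by_contra hc
  have hr0 : 0 = r := by
    by_contra h'
    rw [if_neg h'] at h0
    omega
  rw [if_pos hr0] at h0
  have hs : row l 0 = s := by omega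
  apply h
  rw [hr.ee, ← hr0, hs]
  push_cast
  ring

lemma strip_aux (hJ : IsJackFamily J) (s k : ℕ) (a : F) (l nu : JPartition) (hl : row l 0 ≤ s)
    (ih : ∀ l nu : JPartition, row l 0 ≤ s → hall (GG (bs s) (1 : F) k (J l)) (J nu) ≠ 0 → Strip s l nu)
    (h : hall (GG (bs s) (1 : F) (k + 1) (J l)) (J nu) ≠ 0) :
    (∃ ka r, Strip s l ka ∧ AddBox ka nu r ∧ row nu 0 ≤ s ∧ ee nu - ee ka + (1 - a) ≠ 0) ∨
    (∃ ka r, Strip s ka nu ∧ AddBox l ka r ∧ ee ka - ee l + (-a) ≠ 0) := by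
  by_contra hc
  rw [not_or] at hc
  obtain ⟨hc1, hc2⟩ := hc
  apply h
  have hk := natCast_ne k
  apply mul_left_cancel₀ hk
  rw [← hall_smul_left, gs_rec hJ s k a, mul_zero, hall_sub_left]
  have e1 : hall (RR alpha (-(alpha * s)) (GG (bs s) (1 : F) k (J l)) + (1 - a) • BB alpha (-(alpha * s)) 1 (GG (bs s) (1 : F) k (J l))) (J nu) = 0 := by
    have := J_lin hJ (GG (bs s) (1 : F) k (J l)) (φ := hallL (J nu) ∘ₗ (RR alpha (-(alpha * s)) + (1 - a) • BB alpha (-(alpha * s)) 1)) fun ka hka => ?_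
    · simpa only [LinearMap.comp_apply, LinearMap.add_apply, LinearMap.smul_apply, hallL_apply] using this
    have hst := ih l ka hl hka
    simp only [LinearMap.comp_apply, LinearMap.add_apply, LinearMap.smul_apply, hallL_apply]
    apply mul_left_cancel₀ alpha_ne
    rw [hall_RB hJ, mul_zero]
    by_contra hne
    obtain ⟨r, hr, h0⟩ := pieri_u hJ s ka nu _ hst.1 hne
    exact hc1 ⟨ka, r, hst, hr, h0, fun h' => hne (by rw [h']; ring)⟩
  have e2 : hall (GG (bs s) (1 : F) k (RR alpha (-(alpha * s)) (J l) + (-a) • BB alpha (-(alpha * s)) 1 (J l))) (J nu) = 0 := by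
    have := J_lin hJ (RR alpha (-(alpha * s)) (J l) + (-a) • BB alpha (-(alpha * s)) 1 (J l)) (φ := hallL (J nu) ∘ₗ GG (bs s) (1 : F) k) fun ka hka => ?_
    · simpa only [LinearMap.comp_apply, hallL_apply] using this
    simp only [LinearMap.comp_apply, hallL_apply]
    have hka2 := mul_ne_zero alpha_ne hka
    rw [hall_RB hJ] at hka2
    obtain ⟨r, hr, h0⟩ := pieri_u hJ s l ka _ hl hka2
    by_contra hne
    exact hc2 ⟨ka, r, ih ka nu h0 hne, hr, fun h' => hka2 (by rw [h']; ring)⟩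
  rw [e1, e2, sub_zero]

lemma AddBox.le {l nu : JPartition} {r : ℕ} (h : AddBox l nu r) (i : ℕ) : row l i ≤ row nu i := by
  rw [h i]; omega

lemma strip (hJ : IsJackFamily J) (s k : ℕ) : ∀ l nu : JPartition, row l 0 ≤ s →
    hall (GG (bs s) (1 : F) k (J l)) (J nu) ≠ 0 → Strip s l nu := by
  induction k with
  | zero =>
    intro l nu hl h
    rw [GG_zero, Module.End.one_apply] at h
    have : l = nu := by
      by_contra h'
      exact h (hJ.orthogonal _ _ h')
    subst this
    exact ⟨hl, fun i => ⟨row_anti1 l i, le_rfl⟩⟩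
  | succ k ih =>
    intro l nu hl h
    refine ⟨?_, fun q => ⟨?_, ?_⟩⟩
    · rcases strip_aux hJ s k 0 l nu hl ih h with ⟨ka, r, h1, h2, h3, h4⟩ | ⟨ka, r, h1, h2, h3⟩
      · exact h3
      · exact h1.1
    · by_contra hq
      rcases strip_aux hJ s k (alpha * row l q - q) l nu hl ih h with ⟨ka, r, h1, h2, h3, h4⟩ | ⟨ka, r, h1, h2, h3⟩
      · have g1 := (h1.2 q).1
        have g2 := h2 (q + 1)
        have hr : q + 1 = r := by
          by_contra h'
          rw [if_neg h'] at g2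
          omega
        rw [if_pos hr] at g2
        have g3 : row ka (q + 1) = row l q := by omega
        apply h4
        rw [h2.ee, ← hr, g3]
        push_cast
        ring
      · have g1 := (h1.2 q).1
        have g2 := h2 q
        have hr : q = r := by
          by_contra h'
          rw [if_neg h'] at g2
          omega
        apply h3
        rw [h2.ee, ← hr]
        ring
    · rcases strip_aux hJ s k 0 l nu hl ih h with ⟨ka, r, h1, h2, h3, h4⟩ | ⟨ka, r, h1, h2, h3⟩
      · exact (h1.2 q).2.trans (h2.le q)
      · exact (h2.le q).trans (h1.2 q).2

lemma gs_LL (s k : ℕ) (f : SymA) : LL (GG (bs s) (1 : F) k f) = GG (bs s) (1 : F) k (LL f) + (k : F) • GG (bs s) (1 : F) k f := by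
  have h := GG_L (K := F) (bs s) (LL : Module.End F SymA) (fun n => by
    refine LinearMap.ext fun g => ?_
    simp only [bs, LinearMap.sub_apply, Module.End.mul_apply, LinearMap.smul_apply]
    rw [LL_BB _ _ alpha_ne, add_sub_cancel_left]
    push_cast; rfl) k
  have h2 := LinearMap.congr_fun h f
  simp only [LinearMap.sub_apply, Module.End.mul_apply, LinearMap.smul_apply] at h2
  rw [← h2]; abel

lemma gs_d1 (s k : ℕ) (f : SymA) : d1 (GG (bs s) (1 : F) (k + 1) f) = GG (bs s) (1 : F) (k + 1) (d1 f) + ((k : F) - s) • GG (bs s) (1 : F) k f := by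
  have h := GG_d (K := F) (bs s) (d1 : Module.End F SymA) (-(s : F)) (by
    refine LinearMap.ext fun g => ?_
    simp only [bs, LinearMap.sub_apply, Module.End.mul_apply, LinearMap.smul_apply, zero_add]
    rw [d1_BB_one _ _ alpha_ne, add_sub_cancel_left, Module.End.one_apply]
    congr 1
    have := alpha_ne
    field_simp) (fun n => by
    refine LinearMap.ext fun g => ?_
    simp only [bs, LinearMap.sub_apply, Module.End.mul_apply, LinearMap.smul_apply, zero_add]
    rw [d1_BB _ _ alpha_ne, add_sub_cancel_left]) k
  have h2 := LinearMap.congr_fun h f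
  simp only [LinearMap.sub_apply, Module.End.mul_apply, LinearMap.smul_apply] at h2
  rw [sub_eq_iff_eq_add'] at h2
  rw [h2, add_comm (-(s : F)), ← sub_eq_add_neg]

lemma gs_size (hJ : IsJackFamily J) (s k : ℕ) (l nu : JPartition) (h : hall (GG (bs s) (1 : F) k (J l)) (J nu) ≠ 0) :
    psize nu = psize l + k := by
  by_contra h'
  refine h (hall_homog (a := psize l + k) ?_ (LL_J hJ nu) (Ne.symm h'))
  rw [gs_LL, LL_J hJ, map_smul, ← add_smul]
  push_cast; rfl

lemma strip_size {s : ℕ} {l nu : JPartition} (h : Strip s l nu) : psize nu ≤ psize l + s ∧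
    (psize nu = psize l + s → row nu 0 = s ∧ ∀ i, row nu (i + 1) = row l i) := by
  have key : ∀ N, plen l + plen nu ≤ N → psize nu = row nu 0 + ∑ i ∈ Finset.range N, row nu (i + 1) ∧ psize l = ∑ i ∈ Finset.range N, row l i := by
    intro N hN
    rw [← psize_row nu (N + 1) (by omega), ← psize_row l N (by omega), Finset.sum_range_succ', add_comm]
    exact ⟨rfl, rfl⟩
  have hle : ∀ N, ∀ i ∈ Finset.range N, row nu (i + 1) ≤ row l i := fun N i _ => (h.2 i).1
  refine ⟨?_, fun he => ?_⟩
  · obtain ⟨h1, h2⟩ := key _ le_rfl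
    have := Finset.sum_le_sum (hle (plen l + plen nu))
    have := h.1
    omega
  · have h0 := h.1
    refine ⟨?_, fun i => ?_⟩
    · obtain ⟨h1, h2⟩ := key _ le_rfl
      have := Finset.sum_le_sum (hle (plen l + plen nu))
      omega
    · obtain ⟨h1, h2⟩ := key (plen l + plen nu + i + 1) (by omega)
      have h3 := Finset.sum_le_sum (hle (plen l + plen nu + i + 1))
      have h4 := (Finset.sum_eq_sum_iff_of_le (hle (plen l + plen nu + i + 1))).1 (by omega)
      exact h4 i (Finset.mem_range.2 (by omega))

lemma gs_van (hJ : IsJackFamily J) (s k : ℕ) (l : JPartition) (hl : row l 0 ≤ s) (hk : s < k) : GG (bs s) (1 : F) k (J l) = 0 := by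
  refine J_ext hJ fun nu => ?_
  by_contra h
  have h1 := gs_size hJ s k l nu h
  have h2 := (strip_size (strip hJ s k l nu hl h)).1
  omega

lemma gs_top (hJ : IsJackFamily J) (s : ℕ+) (l : JPartition) (hl : ∀ x ∈ l, x ≤ s) :
    ∃ c : F, GG (bs s) (1 : F) s (J l) = c • J (s ::ₘ l) := by
  refine J_prop hJ fun nu hnu => ?_
  by_contra h
  have hl0 : row l 0 ≤ s := row_le s l (fun x hx => by exact_mod_cast hl x hx) 0
  have h1 := gs_size hJ s s l nu h
  have h2 := (strip_size (strip hJ s s l nu hl0 h)).2 h1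
  apply hnu
  refine row_inj fun i => ?_
  cases i with
  | zero => rw [row_cons_zero s l hl, h2.1]
  | succ i => rw [row_cons_succ s l hl, h2.2]

end JK
end

section
namespace JK
open MvPolynomial
variable {J : JPartition → SymA}

lemma toExp_eq (mu : JPartition) : toExp mu = Multiset.toFinsupp mu := by
  ext i
  rw [toExp, Finsupp.finsetSum_apply, Multiset.toFinsupp_apply]
  simp only [Finsupp.single_apply]
  rw [Finset.sum_ite_eq']
  split_ifs with h
  · rfl
  · rw [Multiset.mem_toFinset] at h
    rw [Multiset.count_eq_zero_of_notMem h]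

/-- partitions are exponent vectors -/
def eqv : JPartition ≃ Exp := Multiset.toFinsupp.toEquiv

lemma eqv_apply (mu : JPartition) : eqv mu = toExp mu := (toExp_eq mu).symm

lemma toExp_inj {mu nu : JPartition} (h : toExp mu = toExp nu) : mu = nu := by
  rw [toExp_eq, toExp_eq] at h
  exact Multiset.toFinsupp.injective h

lemma toExp_surj (m : Exp) : ∃ mu, toExp mu = m := ⟨eqv.symm m, by rw [← eqv_apply, Equiv.apply_symm_apply]⟩

lemma toExp_zero : toExp 0 = 0 := by rw [toExp_eq]; simp

lemma toExp_cons (i : ℕ+) (mu : JPartition) : toExp (i ::ₘ mu) = toExp mu + Finsupp.single i 1 := by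
  rw [toExp_eq, toExp_eq, ← Multiset.singleton_add, map_add, Multiset.toFinsupp_singleton, add_comm]

lemma toExp_one (mu : JPartition) : toExp mu 1 = pmult mu 1 := by
  rw [toExp_eq]; rfl

lemma wt_add (m n : Exp) : wt (m + n) = wt m + wt n := by
  rw [wt, Finsupp.sum_add_index']
  · rfl
  · simp
  · intros; ring

lemma wt_single (i : ℕ+) (k : ℕ) : wt (Finsupp.single i k) = k * i := by
  rw [wt, Finsupp.sum_single_index]; simp

@[simp] lemma wt_zero : wt 0 = 0 := by simp [wt]

lemma wt_toExp (mu : JPartition) : wt (toExp mu) = psize mu := by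
  induction mu using Multiset.induction_on with
  | empty => rw [toExp_zero]; simp
  | cons i mu ih => rw [toExp_cons, wt_add, ih, wt_single, psize_cons]; ring

lemma toExp_addOnes (mu : JPartition) (k : ℕ) : toExp (addOnes mu k) = toExp mu + Finsupp.single 1 k := by
  induction k with
  | zero => simp [addOnes]
  | succ k ih =>
    have : addOnes mu (k + 1) = 1 ::ₘ addOnes mu k := by
      rw [addOnes, addOnes, Multiset.replicate_succ, Multiset.add_cons]
    rw [this, toExp_cons, ih, Finsupp.single_add, add_assoc]

lemma monomial_cons (i : ℕ+) (m : Exp) : (monomial (m + Finsupp.single i 1) 1 : SymA) = Pn i * monomial m 1 := by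
  rw [Pn_coe, X, monomial_mul, one_mul, add_comm]

lemma LL_mono (m : Exp) : LL (monomial m 1 : SymA) = (wt m : F) • monomial m 1 := by
  obtain ⟨mu, rfl⟩ := toExp_surj m
  induction mu using Multiset.induction_on with
  | empty => rw [toExp_zero]; change LL 1 = _; simp
  | cons i mu ih =>
    rw [toExp_cons, monomial_cons, LL_P, ih, mul_smul_comm, ← add_smul, wt_add, wt_single, one_mul, Nat.cast_add]

lemma coeff_LL (m : Exp) (f : SymA) : coeff m (LL f) = wt m * coeff m f := by
  induction f using MvPolynomial.induction_on' with
  | monomial n a =>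
    rw [← mul_one a, ← smul_eq_mul, ← smul_monomial, map_smul, LL_mono]
    simp only [coeff_smul, coeff_monomial, smul_eq_mul]
    split_ifs with h
    · rw [h]; ring
    · ring
  | add f g hf hg => rw [map_add, coeff_add, coeff_add, hf, hg]; ring

lemma coeff_d1 (m : Exp) (f : SymA) : coeff m (d1 f) = (m 1 + 1) * coeff (m + Finsupp.single 1 1) f := by
  have := coeff_pderiv (i := (1 : ℕ+)) f m
  rw [d1]
  refine this.trans ?_
  ring

lemma coeff_eig {f : SymA} {c : F} (h : LL f = c • f) {m : Exp} (hm : (wt m : F) ≠ c) : coeff m f = 0 := by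
  have := congrArg (coeff m) h
  rw [coeff_LL, coeff_smul, smul_eq_mul] at this
  by_contra hne
  exact hm (mul_right_cancel₀ hne this)

lemma rec1 {Y : SymA} {N : ℕ} (hY : LL Y + d1 Y = (N : F) • Y) (m : Exp) :
    (m 1 + 1 : F) * coeff (m + Finsupp.single 1 1) Y = (N - wt m) * coeff m Y := by
  have := congrArg (coeff m) hY
  rw [coeff_add, coeff_LL, coeff_smul, coeff_d1, smul_eq_mul] at this
  linear_combination this

lemma rec_k {Y : SymA} {N : ℕ} (hY : LL Y + d1 Y = (N : F) • Y) (m : Exp) (k : ℕ) (h : wt m + k ≤ N) :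
    (Nat.choose (m 1 + k) k : F) * coeff (m + Finsupp.single 1 k) Y = (Nat.choose (N - wt m) k : F) * coeff m Y := by
  induction k with
  | zero => simp
  | succ k ih =>
    have ih := ih (by omega)
    have h1 := rec1 hY (m + Finsupp.single 1 k)
    have e1 : ((m 1 + k + 1 : ℕ) : F) * (Nat.choose (m 1 + k) k : F) = (Nat.choose (m 1 + (k + 1)) (k + 1) : F) * ((k + 1 : ℕ) : F) := by
      exact_mod_cast Nat.add_one_mul_choose_eq (m 1 + k) k
    have e2 : (Nat.choose (N - wt m) (k + 1) : F) * ((k + 1 : ℕ) : F) = (Nat.choose (N - wt m) k : F) * ((N - wt m - k : ℕ) : F) := by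
      exact_mod_cast Nat.choose_succ_right_eq (N - wt m) k
    have e3 : ((N - wt m - k : ℕ) : F) = N - wt m - k := by
      rw [Nat.cast_sub (by omega), Nat.cast_sub (by omega)]
    rw [wt_add, wt_single, Finsupp.add_apply, Finsupp.single_eq_same, add_assoc, ← Finsupp.single_add] at h1
    rw [e3] at e2
    push_cast at e1 e2 h1
    apply mul_left_cancel₀ (natCast_ne k)
    linear_combination (-coeff (m + Finsupp.single 1 (k + 1)) Y) * e1 + coeff m Y * (-e2) + (Nat.choose (m 1 + k) k : F) * h1 + (N - wt m - k) * ih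

lemma rec_big {Y : SymA} {N : ℕ} (hY : LL Y + d1 Y = (N : F) • Y) (m : Exp) (h : N < wt m) : coeff m Y = 0 := by
  by_contra hne
  have key : ∀ k, coeff (m + Finsupp.single 1 k) Y ≠ 0 := by
    intro k
    induction k with
    | zero => simpa using hne
    | succ k ih =>
      have h1 := rec1 hY (m + Finsupp.single 1 k)
      intro h0
      rw [Finsupp.single_add, ← add_assoc] at h0
      rw [h0, mul_zero, wt_add] at h1
      have h2 := (mul_eq_zero.1 h1.symm).resolve_right ih
      rw [sub_eq_zero] at h2
      have := Nat.cast_injective h2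
      omega
  have hinf : Set.Infinite (Y.support : Set Exp) := by
    refine Set.infinite_of_injective_forall_mem (f := fun k : ℕ => m + Finsupp.single 1 k) ?_ ?_
    · intro a b hab
      have := congrArg (fun e : Exp => e 1) hab
      simpa using this
    · intro k
      simpa using key k
  exact hinf (Finset.finite_toSet _)

lemma rec_theta {Y : SymA} {l : JPartition} (hY : LL Y + d1 Y = (psize l : F) • Y)
    (htop : ∀ m, wt m = psize l → coeff m Y = coeff m (J l)) (mu : JPartition) : coeff (toExp mu) Y = theta J mu l := by
  rw [theta]
  split_ifs with h
  · exact rec_big hY _ (by rwa [wt_toExp])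
  · have h1 := rec_k hY (toExp mu) (psize l - psize mu) (by rw [wt_toExp]; omega)
    rw [wt_toExp, Nat.choose_self, Nat.cast_one, one_mul] at h1
    rw [← h1, toExp_addOnes, htop, toExp_one, add_comm (pmult mu 1), Nat.choose_symm_add]
    rw [wt_add, wt_toExp, wt_single]
    simp
    omega

/-- `e^{∂_1} J_l` -/
def Tht (J : JPartition → SymA) (l : JPartition) : SymA :=
  ∑ k ∈ Finset.range (psize l + 1), ((Nat.factorial k : ℕ) : F)⁻¹ • (d1 ^ k : Module.End F SymA) (J l)

lemma LL_d1k (hJ : IsJackFamily J) (l : JPartition) (k : ℕ) :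
    LL ((d1 ^ k : Module.End F SymA) (J l)) = ((psize l : F) - k) • (d1 ^ k : Module.End F SymA) (J l) := by
  induction k with
  | zero => simp [LL_J hJ]
  | succ k ih =>
    rw [pow_succ', Module.End.mul_apply]
    have := d1_LL ((d1 ^ k : Module.End F SymA) (J l))
    rw [ih, map_smul] at this
    rw [← sub_eq_iff_eq_add] at this
    rw [← this, Nat.cast_add, Nat.cast_one, ← sub_sub, sub_smul _ (1 : F), one_smul]

lemma d1k_zero (hJ : IsJackFamily J) (l : JPartition) : (d1 ^ (psize l + 1) : Module.End F SymA) (J l) = 0 := by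
  ext m
  rw [coeff_zero]
  refine coeff_eig (LL_d1k hJ l _) ?_
  push_cast
  intro h
  have : ((wt m + 1 : ℕ) : F) = ((0 : ℕ) : F) := by push_cast; linear_combination h
  have := Nat.cast_injective this
  omega

lemma Tht_eig (hJ : IsJackFamily J) (l : JPartition) : LL (Tht J l) + d1 (Tht J l) = (psize l : F) • Tht J l := by
  have h1 : LL (Tht J l) = (psize l : F) • Tht J l -
      ∑ k ∈ Finset.range (psize l + 1), ((k : F) * ((Nat.factorial k : ℕ) : F)⁻¹) • (d1 ^ k : Module.End F SymA) (J l) := by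
    rw [Tht, map_sum, Finset.smul_sum, ← Finset.sum_sub_distrib]
    refine Finset.sum_congr rfl fun k _ => ?_
    rw [map_smul, LL_d1k hJ, smul_smul, smul_smul, ← sub_smul]
    congr 1; ring
  have h2 : d1 (Tht J l) = ∑ k ∈ Finset.range (psize l + 1), ((k : F) * ((Nat.factorial k : ℕ) : F)⁻¹) • (d1 ^ k : Module.End F SymA) (J l) := by
    rw [Tht, map_sum, Finset.sum_range_succ, map_smul, ← Module.End.mul_apply, ← pow_succ', d1k_zero hJ, smul_zero, add_zero,
      Finset.sum_range_succ', Nat.cast_zero, zero_mul, zero_smul, add_zero]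
    refine Finset.sum_congr rfl fun k _ => ?_
    rw [map_smul, ← Module.End.mul_apply, ← pow_succ', Nat.factorial_succ]
    congr 1
    have := natCast_ne k
    push_cast
    rw [mul_inv, ← mul_assoc, mul_inv_cancel₀ this, one_mul]
  rw [h1, h2, sub_add_cancel]

lemma Tht_top (hJ : IsJackFamily J) (l : JPartition) (m : Exp) (h : wt m = psize l) : coeff m (Tht J l) = coeff m (J l) := by
  rw [Tht, coeff_sum, Finset.sum_eq_single 0]
  · simp
  · intro k _ hk
    rw [coeff_smul, coeff_eig (LL_d1k hJ l k), smul_zero]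
    rw [h]
    intro h'
    apply hk
    have : (k : F) = (0 : ℕ) := by push_cast; linear_combination h'
    exact Nat.cast_injective this
  · simp

lemma Tht_theta (hJ : IsJackFamily J) (mu l : JPartition) : coeff (toExp mu) (Tht J l) = theta J mu l :=
  rec_theta (Tht_eig hJ l) (Tht_top hJ l) mu

/-- span of Jacks with rows at most `s` -/
def Vs (J : JPartition → SymA) (s : ℕ) : Submodule F SymA := Submodule.span F (J '' {l | row l 0 ≤ s})

lemma J_mem_Vs (s : ℕ) (l : JPartition) (h : row l 0 ≤ s) : J l ∈ Vs J s := Submodule.subset_span ⟨l, h, rfl⟩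

lemma Vs_le (hJ : IsJackFamily J) (s : ℕ) (A : Module.End F SymA) (h : ∀ l nu, row l 0 ≤ s → hall (A (J l)) (J nu) ≠ 0 → row nu 0 ≤ s) (f : SymA)
    (hf : f ∈ Vs J s) : A f ∈ Vs J s := by
  have : Vs J s ≤ (Vs J s).comap A := by
    rw [Vs, Submodule.span_le]
    rintro _ ⟨l, hl, rfl⟩
    have := J_mem hJ (A (J l))
    refine Submodule.span_mono ?_ this
    rintro _ ⟨nu, hnu, rfl⟩
    exact ⟨nu, h l nu hl hnu, rfl⟩
  exact this hf

lemma Vs_d1 (hJ : IsJackFamily J) (s : ℕ) (f : SymA) (hf : f ∈ Vs J s) : d1 f ∈ Vs J s := by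
  refine Vs_le hJ s d1 (fun l nu hl h => ?_) f hf
  rw [hall_comm] at h
  have h2 := mul_ne_zero alpha_ne h
  rw [← hall_P1] at h2
  obtain ⟨r, hr⟩ := pieri hJ nu l h2
  exact (hr.le 0).trans hl

lemma Vs_gs (hJ : IsJackFamily J) (s k : ℕ) (f : SymA) (hf : f ∈ Vs J s) : GG (bs s) (1 : F) k f ∈ Vs J s :=
  Vs_le hJ s _ (fun l nu hl h => (strip hJ s k l nu hl h).1) f hf

lemma Vs_Tht (hJ : IsJackFamily J) (s : ℕ) (l : JPartition) (hl : row l 0 ≤ s) : Tht J l ∈ Vs J s := by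
  refine Submodule.sum_mem _ fun k hk => Submodule.smul_mem _ _ ?_
  clear hk
  induction k with
  | zero => simpa using J_mem_Vs s l hl
  | succ k ih => rw [pow_succ', Module.End.mul_apply]; exact Vs_d1 hJ s _ ih

lemma Vs_van (hJ : IsJackFamily J) (s k : ℕ) (hk : s < k) (f : SymA) (hf : f ∈ Vs J s) : GG (bs s) (1 : F) k f = 0 := by
  have : Vs J s ≤ LinearMap.ker (GG (bs s) (1 : F) k) := by
    rw [Vs, Submodule.span_le]
    rintro _ ⟨l, hl, rfl⟩
    exact gs_van hJ s k l hl hk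
  exact this hf

lemma bs_LL (s n : ℕ) (f : SymA) : LL (bs s n f) = bs s n (LL f) + (n + 1 : F) • bs s n f := by
  rw [bs, LL_BB _ _ alpha_ne]; push_cast; rfl

/-- truncation: `B_n` raises the degree -/
def Ws (k : ℕ) : Submodule F SymA where
  carrier := {f | ∀ m, wt m < k → coeff m f = 0}
  add_mem' := fun {a b} ha hb m hm => by rw [coeff_add, ha m hm, hb m hm, add_zero]
  zero_mem' := fun m _ => coeff_zero m
  smul_mem' := fun c x hx m hm => by rw [coeff_smul, hx m hm, smul_zero]

lemma BB_Ws (u : F) (n k : ℕ) (f : SymA) (hf : f ∈ Ws k) : BB alpha u n f ∈ Ws (n + k) := by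
  rw [f.as_sum, map_sum]
  refine Submodule.sum_mem _ fun m hm => ?_
  rw [← mul_one (coeff m f), ← smul_eq_mul, ← smul_monomial, map_smul]
  refine Submodule.smul_mem _ _ fun m' hm' => ?_
  have hwt : k ≤ wt m := by
    by_contra h
    exact (mem_support_iff.1 hm) (hf m (by omega))
  have := LL_BB alpha u alpha_ne n (monomial m 1)
  rw [LL_mono, map_smul, ← add_smul] at this
  refine coeff_eig this ?_
  rw [← Nat.cast_add]
  intro h
  have := Nat.cast_injective h
  omega

lemma gs_Ws (s : ℕ) (c : F) (k : ℕ) : ∀ j f, f ∈ Ws j → GG (bs s) c k f ∈ Ws (k + j) := by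
  induction k using Nat.strong_induction_on with
  | _ k ih =>
    intro j f hf
    cases k with
    | zero => rw [GG_zero]; simpa using hf
    | succ k =>
      rw [GG_succ, LinearMap.smul_apply, LinearMap.sum_apply]
      refine Submodule.smul_mem _ _ (Submodule.sum_mem _ fun n hn => ?_)
      rw [Finset.mem_range] at hn
      rw [Module.End.mul_apply]
      have h1 := ih (k - n) (by omega) j f hf
      have h2 := BB_Ws (-(alpha * s)) (n + 1) _ _ h1
      rwa [show n + 1 + (k - n + j) = k + 1 + j by omega] at h2

lemma coeff_gs (s : ℕ) (c : F) (k : ℕ) (f : SymA) (m : Exp) (h : wt m < k) : coeff m (GG (bs s) c k f) = 0 := by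
  refine gs_Ws s c k 0 f (fun m hm => absurd hm (by omega)) m (by omega)

lemma coeff_mono_ne {f : SymA} {c : F} (h : LL f = c • f) {m : Exp} (hm : coeff m f ≠ 0) : (wt m : F) = c := by
  by_contra h'
  exact hm (coeff_eig h h')

end JK
end

section
namespace JK
open MvPolynomial
variable {J : JPartition → SymA}

/-- adding a row -/
def Ya (s : ℕ) (T : SymA) : SymA := ∑ k ∈ Finset.range (s + 1), (-1 : F) ^ k • GG (bs s) (1 : F) k T

lemma Ya_eig (s : ℕ) (T : SymA) (N : ℕ) (hT : LL T + d1 T = (N : F) • T) :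
    LL (Ya s T) + d1 (Ya s T) = ((s + N : ℕ) : F) • Ya s T := by
  have h1 : LL (Ya s T) = ∑ k ∈ Finset.range (s + 1), (-1 : F) ^ k • GG (bs s) (1 : F) k (LL T)
      + ∑ k ∈ Finset.range (s + 1), ((-1 : F) ^ k * k) • GG (bs s) (1 : F) k T := by
    rw [Ya, map_sum, ← Finset.sum_add_distrib]
    refine Finset.sum_congr rfl fun k _ => ?_
    rw [map_smul, gs_LL, smul_add, smul_smul]
  have h2 : d1 (Ya s T) = ∑ k ∈ Finset.range (s + 1), (-1 : F) ^ k • GG (bs s) (1 : F) k (d1 T)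
      - ∑ k ∈ Finset.range (s + 1), ((-1 : F) ^ k * (k - s)) • GG (bs s) (1 : F) k T := by
    rw [Ya, map_sum, Finset.sum_range_succ', Finset.sum_range_succ' _ s, Finset.sum_range_succ _ s, sub_self, mul_zero, zero_smul, add_zero]
    rw [add_sub_right_comm, ← Finset.sum_sub_distrib]
    congr 1
    · refine Finset.sum_congr rfl fun k _ => ?_
      rw [map_smul, gs_d1, smul_add, smul_smul, pow_succ]
      rw [show (-1 : F) ^ k * -1 * ((k : F) - s) = -((-1 : F) ^ k * (k - s)) by ring, neg_smul, ← sub_eq_add_neg]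
    · rw [GG_zero]; simp
  have h3 : LL T = (N : F) • T - d1 T := by rw [← hT]; abel
  have h4 : ((s + N : ℕ) : F) • Ya s T = ∑ k ∈ Finset.range (s + 1), ((s + N : ℕ) : F) • (-1 : F) ^ k • GG (bs s) (1 : F) k T := by
    rw [Ya, Finset.smul_sum]
  rw [h1, h2, h3, h4, ← Finset.sum_sub_distrib, ← Finset.sum_add_distrib, ← Finset.sum_add_distrib]
  refine Finset.sum_congr rfl fun k _ => ?_
  rw [map_sub, map_smul, smul_sub, smul_smul, smul_smul]
  generalize GG (bs s) (1 : F) k T = a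
  generalize (-1 : F) ^ k • GG (bs s) (1 : F) k (d1 T) = b
  have : (((s + N : ℕ) : F) * (-1) ^ k) • a = ((-1 : F) ^ k * N) • a + ((-1 : F) ^ k * k) • a - ((-1 : F) ^ k * (k - s)) • a := by
    rw [← add_smul, ← sub_smul]
    congr 1
    push_cast; ring
  rw [this]
  abel

lemma gs_top_coeff (hJ : IsJackFamily J) (s k k' : ℕ) (l : JPartition) (hk : k ≤ k') (m : Exp) (hm : wt m = psize l + k') :
    coeff m (GG (bs s) (1 : F) k (Tht J l)) = if k = k' then coeff m (GG (bs s) (1 : F) k (J l)) else 0 := by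
  have key : ∀ j, ¬ (k = k' ∧ j = 0) → coeff m (GG (bs s) (1 : F) k ((d1 ^ j : Module.End F SymA) (J l))) = 0 := by
    intro j hj
    refine coeff_eig (c := (psize l : F) - j + k) ?_ ?_
    · rw [gs_LL, LL_d1k hJ, map_smul, ← add_smul]
    · rw [hm]
      intro h
      have : ((psize l + k' + j : ℕ) : F) = ((psize l + k : ℕ) : F) := by push_cast at h ⊢; linear_combination h
      have := Nat.cast_injective this
      omega
  rw [Tht, map_sum, coeff_sum]
  split_ifs with h
  · rw [Finset.sum_eq_single 0]
    · simp
    · intro j _ hj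
      rw [map_smul, coeff_smul, key j (by tauto), smul_zero]
    · simp
  · refine Finset.sum_eq_zero fun j _ => ?_
    rw [map_smul, coeff_smul, key j (by tauto), smul_zero]

lemma theta_zero (hJ : IsJackFamily J) (l : JPartition) : theta J 0 l = 1 := by
  rw [theta, toExp_addOnes, toExp_zero]
  simp [pmult, hJ.normalized]

lemma row_add (hJ : IsJackFamily J) (s : ℕ+) (l : JPartition) (hl : ∀ x ∈ l, x ≤ s) : Tht J (s ::ₘ l) = Ya s (Tht J l) := by
  have hY := Ya_eig s (Tht J l) (psize l) (Tht_eig hJ l)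
  rw [← psize_cons] at hY
  obtain ⟨c, hc⟩ := gs_top hJ s l hl
  have ht : ∀ m, wt m = psize (s ::ₘ l) → coeff m (Ya s (Tht J l)) = ((-1 : F) ^ (s : ℕ) * c) * coeff m (J (s ::ₘ l)) := by
    intro m hm
    rw [psize_cons, add_comm] at hm
    rw [Ya, coeff_sum, Finset.sum_range_succ, coeff_smul, gs_top_coeff hJ s s s l le_rfl m hm, if_pos rfl, hc, Finset.sum_eq_zero, zero_add,
      coeff_smul, smul_eq_mul, smul_eq_mul, mul_assoc]
    intro k hk
    rw [Finset.mem_range] at hk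
    rw [coeff_smul, gs_top_coeff hJ s k s l hk.le m hm, if_neg hk.ne, smul_zero]
  have h0 : coeff 0 (Ya s (Tht J l)) = 1 := by
    rw [Ya, coeff_sum, Finset.sum_range_succ', Finset.sum_eq_zero, zero_add]
    · rw [GG_zero]
      have := Tht_theta hJ 0 l
      rw [theta_zero hJ, toExp_zero] at this
      simpa using this
    · intro k _
      rw [coeff_smul, coeff_gs, smul_zero]
      simp
  have h1 := rec_k hY 0 (psize (s ::ₘ l)) (by simp)
  simp only [Finsupp.zero_apply, zero_add, wt_zero, Nat.sub_zero, Nat.choose_self, Nat.cast_one, one_mul, h0] at h1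
  rw [ht _ (by rw [wt_single]; simp), hJ.normalized, mul_one] at h1
  have ht' : ∀ m, wt m = psize (s ::ₘ l) → coeff m (Ya s (Tht J l)) = coeff m (J (s ::ₘ l)) := by
    intro m hm
    rw [ht m hm, h1, one_mul]
  ext m
  obtain ⟨mu, rfl⟩ := toExp_surj m
  rw [Tht_theta hJ, rec_theta hY ht']

lemma cauchy {V : Type*} [AddCommMonoid V] (f : ℕ → ℕ → V) (K : ℕ) (hf : ∀ a b, K ≤ a + b → f a b = 0) :
    ∑ k ∈ Finset.range K, ∑ p ∈ Finset.HasAntidiagonal.antidiagonal k, f p.1 p.2 = ∑ a ∈ Finset.range K, ∑ b ∈ Finset.range K, f a b := by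
  rw [← Finset.sum_product']
  rw [← Finset.sum_filter_of_ne (p := fun p : ℕ × ℕ => p.1 + p.2 < K) (by
    intro p _ h
    by_contra h'
    exact h (hf _ _ (by omega)))]
  rw [← Finset.sum_fiberwise_of_maps_to (t := Finset.range K) (g := fun p : ℕ × ℕ => p.1 + p.2) (by
    intro p hp; simpa using (Finset.mem_filter.1 hp).2)]
  refine Finset.sum_congr rfl fun k hk => Finset.sum_congr ?_ fun _ _ => rfl
  ext p
  simp only [Finset.HasAntidiagonal.mem_antidiagonal, Finset.mem_filter, Finset.mem_product, Finset.mem_range] at hk ⊢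
  omega

lemma GG_c0 (b : ℕ → Module.End F SymA) (k : ℕ) : GG b (0 : F) (k + 1) = 0 := by
  rw [GG_succ]; simp

lemma gsM_van (hJ : IsJackFamily J) (s M : ℕ) : ∀ f ∈ Vs J s, ∀ k, (GG (bs s) (M : F) k f ∈ Vs J s) ∧ (s * M < k → GG (bs s) (M : F) k f = 0) := by
  induction M with
  | zero =>
    intro f hf k
    cases k with
    | zero => rw [GG_zero]; exact ⟨hf, by simp⟩
    | succ k => rw [Nat.cast_zero, GG_c0]; simp
  | succ M ih =>
    intro f hf k
    rw [Nat.cast_succ, add_comm (M : F), GG_add _ (bs_comm hJ s), LinearMap.sum_apply]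
    refine ⟨Submodule.sum_mem _ fun p hp => ?_, fun hk => Finset.sum_eq_zero fun p hp => ?_⟩
    · rw [Module.End.mul_apply]
      exact Vs_gs hJ s _ _ (ih f hf _).1
    · rw [Finset.HasAntidiagonal.mem_antidiagonal] at hp
      rw [Module.End.mul_apply]
      by_cases h : s * M < p.2
      · rw [(ih f hf _).2 h, map_zero]
      · refine Vs_van hJ s _ ?_ _ (ih f hf _).1
        rw [Nat.mul_succ] at hk
        omega

lemma row_multi (hJ : IsJackFamily J) (s : ℕ+) (l : JPartition) (hl : ∀ x ∈ l, x ≤ s) (M : ℕ) : ∀ K, s * M < K →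
    Tht J (Multiset.replicate M s + l) = ∑ k ∈ Finset.range K, (-1 : F) ^ k • GG (bs s) (M : F) k (Tht J l) := by
  have hl0 : row l 0 ≤ s := row_le s l (fun x hx => by exact_mod_cast hl x hx) 0
  have hT := Vs_Tht hJ s l hl0
  induction M with
  | zero =>
    intro K hK
    obtain ⟨K, rfl⟩ := Nat.exists_eq_succ_of_ne_zero (by omega : K ≠ 0)
    rw [Finset.sum_range_succ', Finset.sum_eq_zero]
    · rw [GG_zero]; simp
    · intro k _
      rw [Nat.cast_zero, GG_c0]; simp
  | succ M ih =>
    intro K hK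
    rw [Nat.mul_succ] at hK
    have ih := ih K (by omega)
    rw [Multiset.replicate_succ, Multiset.cons_add, row_add hJ, Ya]
    · have e : ∑ k ∈ Finset.range (s + 1), (-1 : F) ^ k • GG (bs s) (1 : F) k (Tht J (Multiset.replicate M s + l)) =
          ∑ k ∈ Finset.range K, (-1 : F) ^ k • GG (bs s) (1 : F) k (Tht J (Multiset.replicate M s + l)) := by
        refine Finset.sum_subset (Finset.range_mono (by omega)) fun k _ hk => ?_
        rw [Finset.mem_range, not_lt] at hk
        rw [Vs_van hJ s k (by omega), smul_zero]
        refine Vs_Tht hJ s _ (row_le s _ (fun x hx => ?_) 0)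
        rcases Multiset.mem_add.1 hx with hx | hx
        · rw [Multiset.eq_of_mem_replicate hx]
        · exact_mod_cast hl x hx
      rw [e, ih]
      have c := cauchy (fun a b => ((-1 : F) ^ a * (-1 : F) ^ b) • GG (bs s) (1 : F) a (GG (bs s) (M : F) b (Tht J l))) K (by
        intro a b hab
        by_cases h : s * M < b
        · rw [(gsM_van hJ s M _ hT _).2 h, map_zero, smul_zero]
        · rw [Vs_van hJ s a (by omega) _ (gsM_van hJ s M _ hT _).1, smul_zero])
      simp only [map_sum, Finset.smul_sum, map_smul, smul_smul]
      rw [← c]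
      refine Finset.sum_congr rfl fun k _ => ?_
      rw [Nat.cast_succ, add_comm (M : F), GG_add _ (bs_comm hJ s), LinearMap.sum_apply, Finset.smul_sum]
      refine Finset.sum_congr rfl fun p hp => ?_
      rw [Finset.HasAntidiagonal.mem_antidiagonal] at hp
      rw [← hp, pow_add, Module.End.mul_apply]
    · intro x hx
      rcases Multiset.mem_add.1 hx with hx | hx
      · rw [Multiset.eq_of_mem_replicate hx]
      · exact hl x hx

lemma theta_multi (hJ : IsJackFamily J) (s : ℕ+) (l : JPartition) (hl : ∀ x ∈ l, x ≤ s) (M : ℕ) (mu : JPartition) :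
    theta J mu (Multiset.replicate M s + l) =
      ∑ k ∈ Finset.range (psize mu + 1), (-1 : F) ^ k * coeff (toExp mu) (GG (bs s) (M : F) k (Tht J l)) := by
  rw [← Tht_theta hJ, row_multi hJ s l hl M (psize mu + 1 + s * M) (by omega), coeff_sum]
  simp only [coeff_smul, smul_eq_mul]
  symm
  refine Finset.sum_subset (Finset.range_mono (by omega)) fun k _ hk => ?_
  rw [Finset.mem_range, not_lt] at hk
  rw [coeff_gs _ _ _ _ _ (by rw [wt_toExp]; omega), mul_zero]

/-- logarithmic derivative term -/
def Dv (J : JPartition → SymA) (u : F) (mu l : JPartition) : F :=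
  ∑ k ∈ Finset.range (psize mu), (-1 : F) ^ (k + 1) * ((k + 1 : F)⁻¹ * coeff (toExp mu) (BB alpha u (k + 1) (Tht J l)))

lemma theta_poly (hJ : IsJackFamily J) (s : ℕ+) (l : JPartition) (hl : ∀ x ∈ l, x ≤ s) (mu : JPartition) :
    ∃ P : Polynomial F, (∀ M : ℕ, theta J mu (Multiset.replicate M s + l) = P.eval (M : F)) ∧
      P.eval 0 = theta J mu l ∧ P.derivative.eval 0 = Dv J (-(alpha * (s : ℕ))) mu l := by
  choose P hP using fun k : ℕ => GG_poly (K := F) (bs s) k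
    ((lcoeff F (toExp mu) : SymA →ₗ[F] F) ∘ₗ (LinearMap.applyₗ (Tht J l) : Module.End F SymA →ₗ[F] SymA))
  let Q : Polynomial F := ∑ k ∈ Finset.range (psize mu), Polynomial.C ((-1 : F) ^ (k + 1)) * P k + Polynomial.C (theta J mu l)
  have hQ : ∀ c : F, Q.eval c = ∑ k ∈ Finset.range (psize mu + 1), (-1 : F) ^ k * coeff (toExp mu) (GG (bs s) c k (Tht J l)) := by
    intro c
    rw [Finset.sum_range_succ', GG_zero]
    simp only [Q, Polynomial.eval_add, Polynomial.eval_finset_sum, Polynomial.eval_mul, Polynomial.eval_C, ← (hP _).1]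
    rw [Module.End.one_apply, Tht_theta hJ, pow_zero, one_mul]
    rfl
  refine ⟨Q, fun M => ?_, ?_, ?_⟩
  · rw [theta_multi hJ s l hl, hQ]
  · have := theta_multi hJ s l hl 0 mu
    rw [Multiset.replicate_zero, zero_add, Nat.cast_zero] at this
    rw [hQ, this]
  · simp only [Q, Polynomial.derivative_add, Polynomial.derivative_sum, Polynomial.derivative_C_mul, Polynomial.derivative_C, add_zero,
      Polynomial.eval_finset_sum, Polynomial.eval_mul, Polynomial.eval_C, Dv]
    refine Finset.sum_congr rfl fun k _ => ?_
    rw [← Polynomial.coeff_zero_eq_eval_zero, Polynomial.coeff_derivative, (hP k).2.2]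
    simp only [Nat.cast_zero, zero_add, mul_one]
    rfl

end JK
end

section
namespace JK
open MvPolynomial
variable {J : JPartition → SymA}

lemma deriv1 (hJ : IsJackFamily J) {k : ℕ} {g : (Fin (k + 1) → JPartition) → JPartition → F}
    (hfin : ∀ mus : Fin (k + 1) → JPartition, {pi : JPartition | g mus pi ≠ 0}.Finite)
    (hdef : ∀ (mus : Fin (k + 1) → JPartition) (lam : JPartition),
      ∏ j, theta J (mus j) lam = ∑ pi ∈ (hfin mus).toFinset, g mus pi * theta J pi lam)
    (mus : Fin (k + 1) → JPartition) (s : ℕ+) (l : JPartition) (hl : ∀ x ∈ l, x ≤ s) :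
    ∑ j, (∏ i ∈ Finset.univ.erase j, theta J (mus i) l) * Dv J (-(alpha * (s : ℕ))) (mus j) l =
      ∑ pi ∈ (hfin mus).toFinset, g mus pi * Dv J (-(alpha * (s : ℕ))) pi l := by
  choose P h1 h2 h3 using theta_poly hJ s l hl
  have h : ∏ j, P (mus j) - ∑ pi ∈ (hfin mus).toFinset, Polynomial.C (g mus pi) * P pi = 0 := by
    refine Polynomial.eq_zero_of_infinite_isRoot _ (Set.Infinite.mono (s := Set.range fun M : ℕ => (M : F)) ?_ ?_)
    · rintro _ ⟨M, rfl⟩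
      simp only [Set.mem_setOf_eq, Polynomial.IsRoot.def, Polynomial.eval_sub, Polynomial.eval_prod, Polynomial.eval_finset_sum,
        Polynomial.eval_mul, Polynomial.eval_C, ← h1]
      rw [hdef, sub_self]
    · exact Set.infinite_range_of_injective Nat.cast_injective
  have hd := congrArg (fun p => (Polynomial.derivative p).eval 0) h
  simp only [Polynomial.derivative_sub, Polynomial.derivative_prod_finset, Polynomial.derivative_sum, Polynomial.derivative_C_mul,
    Polynomial.eval_sub, Polynomial.eval_finset_sum, Polynomial.eval_mul, Polynomial.eval_C, Polynomial.eval_prod, h2, h3,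
    Polynomial.derivative_zero, Polynomial.eval_zero] at hd
  exact sub_eq_zero.1 hd

/-- coefficient of `u^e` in `Dv` -/
def Dvc (J : JPartition → SymA) (e : ℕ) (mu l : JPartition) : F :=
  ∑ k ∈ Finset.range (psize mu), (-1 : F) ^ (k + 1) * ((k + 1 : F)⁻¹ * coeff (toExp mu) (BBc (k + 1) e (Tht J l)))

lemma Dv_poly (mu l : JPartition) : ∃ P : Polynomial F, (∀ u, P.eval u = Dv J u mu l) ∧ ∀ e, P.coeff e = Dvc J e mu l := by
  refine ⟨∑ k ∈ Finset.range (psize mu), Polynomial.C ((-1 : F) ^ (k + 1) * (k + 1 : F)⁻¹) *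
    ∑ e ∈ Finset.range (k + 1 + 1), Polynomial.C (coeff (toExp mu) (BBc (k + 1) e (Tht J l))) * Polynomial.X ^ e, fun u => ?_, fun e => ?_⟩
  · rw [Polynomial.eval_finset_sum, Dv]
    refine Finset.sum_congr rfl fun k _ => ?_
    rw [Polynomial.eval_mul, Polynomial.eval_C, Polynomial.eval_finset_sum, BB_BBc, LinearMap.sum_apply, coeff_sum, mul_assoc]
    congr 2
    refine Finset.sum_congr rfl fun e _ => ?_
    rw [Polynomial.eval_mul, Polynomial.eval_C, Polynomial.eval_pow, Polynomial.eval_X, LinearMap.smul_apply, coeff_smul, smul_eq_mul, mul_comm]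
  · rw [Polynomial.finset_sum_coeff, Dvc]
    refine Finset.sum_congr rfl fun k _ => ?_
    rw [Polynomial.coeff_C_mul, Polynomial.finset_sum_coeff, mul_assoc]
    congr 2
    simp only [Polynomial.coeff_C_mul_X_pow]
    rw [Finset.sum_ite_eq]
    split_ifs with h
    · rfl
    · rw [Finset.mem_range, not_lt] at h
      rw [BBc_gt _ _ (by omega)]; simp

lemma deriv2 (hJ : IsJackFamily J) {k : ℕ} {g : (Fin (k + 1) → JPartition) → JPartition → F}
    (hfin : ∀ mus : Fin (k + 1) → JPartition, {pi : JPartition | g mus pi ≠ 0}.Finite)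
    (hdef : ∀ (mus : Fin (k + 1) → JPartition) (lam : JPartition),
      ∏ j, theta J (mus j) lam = ∑ pi ∈ (hfin mus).toFinset, g mus pi * theta J pi lam)
    (mus : Fin (k + 1) → JPartition) (l : JPartition) (e : ℕ) :
    ∑ j, (∏ i ∈ Finset.univ.erase j, theta J (mus i) l) * Dvc J e (mus j) l =
      ∑ pi ∈ (hfin mus).toFinset, g mus pi * Dvc J e pi l := by
  choose P h1 h2 using fun mu => Dv_poly (J := J) mu l
  have h : ∑ j, Polynomial.C (∏ i ∈ Finset.univ.erase j, theta J (mus i) l) * P (mus j)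
      - ∑ pi ∈ (hfin mus).toFinset, Polynomial.C (g mus pi) * P pi = 0 := by
    refine Polynomial.eq_zero_of_infinite_isRoot _ (Set.Infinite.mono (s := Set.range fun M : ℕ => -(alpha * (M + psize l + 1 : ℕ))) ?_ ?_)
    · rintro _ ⟨M, rfl⟩
      simp only [Set.mem_setOf_eq, Polynomial.IsRoot.def, Polynomial.eval_sub, Polynomial.eval_finset_sum,
        Polynomial.eval_mul, Polynomial.eval_C, h1]
      have := deriv1 hJ hfin hdef mus ⟨M + psize l + 1, by omega⟩ l (by
        intro x hx
        change (x : ℕ) ≤ M + psize l + 1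
        obtain ⟨l', rfl⟩ := Multiset.exists_cons_of_mem hx
        rw [psize_cons]
        omega)
      exact sub_eq_zero.2 this
    · refine Set.infinite_range_of_injective fun a b hab => ?_
      have := mul_left_cancel₀ alpha_ne (neg_injective hab)
      have := Nat.cast_injective this
      omega
  have hd := congrArg (fun p => Polynomial.coeff p e) h
  simp only [Polynomial.coeff_sub, Polynomial.finset_sum_coeff, Polynomial.coeff_C_mul, h2, Polynomial.coeff_zero] at hd
  exact sub_eq_zero.1 hd

/-- matrix entries -/
def Bm (n e : ℕ) (m m' : Exp) : F := coeff m (BBc n e (monomial m' 1))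

lemma Bm_wt (n e : ℕ) (m m' : Exp) (h : wt m ≠ wt m' + n) : Bm n e m m' = 0 := by
  have hz : ∀ u, coeff m (BB alpha u n (monomial m' 1)) = 0 := by
    intro u
    have := LL_BB alpha u alpha_ne n (monomial m' 1)
    rw [LL_mono, map_smul, ← add_smul] at this
    refine coeff_eig this ?_
    rw [← Nat.cast_add]
    exact fun h' => h (Nat.cast_injective h')
  have hP : (∑ l ∈ Finset.range (n + 1), Polynomial.C (Bm n l m m') * Polynomial.X ^ l : Polynomial F) = 0 := by
    refine poly_zero _ fun M => ?_
    have := hz (-(M + 1 : F))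
    rw [BB_BBc, LinearMap.sum_apply, coeff_sum] at this
    rw [Polynomial.eval_finset_sum, ← this]
    refine Finset.sum_congr rfl fun l _ => ?_
    rw [Polynomial.eval_mul, Polynomial.eval_C, Polynomial.eval_pow, Polynomial.eval_X, LinearMap.smul_apply, coeff_smul, smul_eq_mul, mul_comm, Bm]
  have := congrArg (fun p => Polynomial.coeff p e) hP
  simp only [Polynomial.finset_sum_coeff, Polynomial.coeff_C_mul_X_pow, Polynomial.coeff_zero] at this
  rw [Finset.sum_ite_eq] at this
  split_ifs at this with h
  · exact this
  · rw [Finset.mem_range, not_lt] at h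
    rw [Bm, BBc_gt _ _ (by omega)]; simp

/-- partitions of size less than `N` -/
def Tn (N : ℕ) : Finset JPartition := (Finset.range N).biUnion Pt
lemma mem_Tn {N : ℕ} {mu : JPartition} : mu ∈ Tn N ↔ psize mu < N := by simp [Tn]

lemma coeff_BBc (n e : ℕ) (mu : JPartition) (f : SymA) (T : Finset JPartition) (hT : ∀ mu', psize mu = psize mu' + n → mu' ∈ T) :
    coeff (toExp mu) (BBc n e f) = ∑ mu' ∈ T, coeff (toExp mu') f * Bm n e (toExp mu) (toExp mu') := by
  have h1 : coeff (toExp mu) (BBc n e f) = ∑ m ∈ f.support, coeff m f * Bm n e (toExp mu) m := by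
    conv_lhs => rw [f.as_sum, map_sum, coeff_sum]
    refine Finset.sum_congr rfl fun m _ => ?_
    rw [Bm, ← smul_eq_mul, ← coeff_smul, ← map_smul, smul_monomial, smul_eq_mul, mul_one]
  have h2 : ∑ m ∈ f.support, coeff m f * Bm n e (toExp mu) m = ∑ m ∈ f.support ∪ T.image toExp, coeff m f * Bm n e (toExp mu) m := by
    refine Finset.sum_subset Finset.subset_union_left fun m _ hm => ?_
    rw [notMem_support_iff.1 hm, zero_mul]
  have h3 : ∑ m ∈ T.image toExp, coeff m f * Bm n e (toExp mu) m = ∑ m ∈ f.support ∪ T.image toExp, coeff m f * Bm n e (toExp mu) m := by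
    refine Finset.sum_subset Finset.subset_union_right fun m _ hm => ?_
    obtain ⟨mu', rfl⟩ := toExp_surj m
    rw [Bm_wt, mul_zero]
    rw [wt_toExp, wt_toExp]
    exact fun h => hm (Finset.mem_image_of_mem _ (hT mu' h))
  rw [h1, h2, ← h3, Finset.sum_image fun a _ b _ h => toExp_inj h]

/-- the matrix of the logarithmic series -/
def Phi (e : ℕ) (mu mu' : JPartition) : F :=
  ∑ k ∈ Finset.range (psize mu), (-1 : F) ^ (k + 1) * ((k + 1 : F)⁻¹ * Bm (k + 1) e (toExp mu) (toExp mu'))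

lemma Phi_zero (e : ℕ) (mu mu' : JPartition) (h : psize mu ≤ psize mu') : Phi e mu mu' = 0 := by
  refine Finset.sum_eq_zero fun k _ => ?_
  rw [Bm_wt, mul_zero, mul_zero]
  rw [wt_toExp, wt_toExp]
  omega

lemma Phi_eq (e n : ℕ) (mu mu' : JPartition) (h : psize mu = psize mu' + (n + 1)) :
    Phi e mu mu' = (-1 : F) ^ (n + 1) * ((n + 1 : F)⁻¹ * Bm (n + 1) e (toExp mu) (toExp mu')) := by
  rw [Phi, Finset.sum_eq_single n]
  · intro k _ hk
    rw [Bm_wt, mul_zero, mul_zero]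
    rw [wt_toExp, wt_toExp]
    omega
  · intro h'
    rw [Finset.mem_range] at h'
    omega

lemma Dvc_eq (hJ : IsJackFamily J) (e : ℕ) (mu l : JPartition) (T : Finset JPartition) (hT : ∀ mu', psize mu' < psize mu → mu' ∈ T) :
    Dvc J e mu l = ∑ mu' ∈ T, Phi e mu mu' * theta J mu' l := by
  rw [Dvc]
  simp only [Phi, Finset.sum_mul]
  rw [Finset.sum_comm]
  refine Finset.sum_congr rfl fun k _ => ?_
  rw [coeff_BBc (k + 1) e mu _ T fun mu' h => hT mu' (by omega), Finset.mul_sum, Finset.mul_sum]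
  refine Finset.sum_congr rfl fun mu' _ => ?_
  rw [Tht_theta hJ]; ring

lemma theta_same (mu l : JPartition) (h : psize mu = psize l) : theta J mu l = coeff (toExp mu) (J l) := by
  rw [theta, h, toExp_addOnes]; simp

lemma theta_li (hJ : IsJackFamily J) (c : JPartition → F) (S : Finset JPartition) (h : ∀ l, ∑ pi ∈ S, c pi * theta J pi l = 0) :
    ∀ pi ∈ S, c pi = 0 := by
  have key : ∀ n, ∀ pi ∈ S, psize pi = n → c pi = 0 := by
    intro n
    induction n using Nat.strong_induction_on with
    | _ n ih =>
      intro pi hpi hn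
      have hφ : (∑ p ∈ S.filter (fun p => psize p = n), c p • (lcoeff F (toExp p) : SymA →ₗ[F] F)) = 0 := by
        refine J_lext hJ fun l => ?_
        simp only [LinearMap.sum_apply, LinearMap.smul_apply, smul_eq_mul, lcoeff_apply, LinearMap.zero_apply]
        by_cases hl : psize l = n
        · rw [← h l, Finset.sum_filter]
          refine Finset.sum_congr rfl fun p hp => ?_
          split_ifs with hpn
          · rw [theta_same p l (by omega)]
          · rcases lt_or_gt_of_ne hpn with hlt | hgt
            · rw [ih _ hlt p hp rfl, zero_mul]
            · rw [theta, if_pos (by omega), mul_zero]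
        · refine Finset.sum_eq_zero fun p hp => ?_
          rw [Finset.mem_filter] at hp
          rw [coeff_eig (LL_J hJ l), mul_zero]
          rw [wt_toExp, hp.2]
          exact fun h' => hl (Nat.cast_injective h').symm
      have := LinearMap.congr_fun hφ (monomial (toExp pi) 1)
      simp only [LinearMap.sum_apply, LinearMap.smul_apply, smul_eq_mul, lcoeff_apply, LinearMap.zero_apply, coeff_monomial] at this
      rw [Finset.sum_eq_single pi] at this
      · simpa using this
      · intro p _ hp
        rw [if_neg fun h' => hp (toExp_inj h').symm, mul_zero]
      · intro h'
        exact absurd (Finset.mem_filter.2 ⟨hpi, hn⟩) h'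
  exact fun pi hpi => key _ pi hpi rfl

lemma star (hJ : IsJackFamily J) {k : ℕ} {g : (Fin (k + 1) → JPartition) → JPartition → F}
    (hfin : ∀ mus : Fin (k + 1) → JPartition, {pi : JPartition | g mus pi ≠ 0}.Finite)
    (hdef : ∀ (mus : Fin (k + 1) → JPartition) (lam : JPartition),
      ∏ j, theta J (mus j) lam = ∑ pi ∈ (hfin mus).toFinset, g mus pi * theta J pi lam)
    (mus : Fin (k + 1) → JPartition) (e : ℕ) (pi : JPartition) :
    ∑ j, ∑ mu' ∈ Tn (psize (mus j)), Phi e (mus j) mu' * g (Function.update mus j mu') pi =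
      ∑ pi' ∈ (hfin mus).toFinset, g mus pi' * Phi e pi' pi := by
  let N := ∑ p ∈ (hfin mus).toFinset, psize p
  let S : Finset JPartition := insert pi (Tn N ∪ Finset.univ.biUnion fun j => (Tn (psize (mus j))).biUnion fun mu' =>
    (hfin (Function.update mus j mu')).toFinset)
  have key := theta_li hJ (fun p => ∑ j, ∑ mu' ∈ Tn (psize (mus j)), Phi e (mus j) mu' * g (Function.update mus j mu') p -
      ∑ pi' ∈ (hfin mus).toFinset, g mus pi' * Phi e pi' p) S ?_ pi (Finset.mem_insert_self _ _)
  · exact sub_eq_zero.1 key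
  · intro l
    have h := deriv2 hJ hfin hdef mus l e
    have hR : ∑ pi' ∈ (hfin mus).toFinset, g mus pi' * Dvc J e pi' l =
        ∑ p ∈ S, (∑ pi' ∈ (hfin mus).toFinset, g mus pi' * Phi e pi' p) * theta J p l := by
      simp only [Finset.sum_mul]
      rw [Finset.sum_comm]
      refine Finset.sum_congr rfl fun p hp => ?_
      rw [Dvc_eq hJ e p l S, Finset.mul_sum]
      · exact Finset.sum_congr rfl fun _ _ => by ring
      · intro mu' hmu
        refine Finset.mem_insert_of_mem (Finset.mem_union_left _ (mem_Tn.2 (hmu.trans_le ?_)))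
        exact Finset.single_le_sum (f := fun p => psize p) (fun _ _ => Nat.zero_le _) hp
    have hL : ∑ j, (∏ i ∈ Finset.univ.erase j, theta J (mus i) l) * Dvc J e (mus j) l =
        ∑ p ∈ S, (∑ j, ∑ mu' ∈ Tn (psize (mus j)), Phi e (mus j) mu' * g (Function.update mus j mu') p) * theta J p l := by
      simp only [Finset.sum_mul]
      rw [Finset.sum_comm]
      refine Finset.sum_congr rfl fun j _ => ?_
      rw [Finset.sum_comm, Dvc_eq hJ e (mus j) l (Tn (psize (mus j))) (fun mu' h => mem_Tn.2 h), Finset.mul_sum]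
      refine Finset.sum_congr rfl fun mu' hmu => ?_
      have h1 := hdef (Function.update mus j mu') l
      rw [← Finset.mul_prod_erase _ _ (Finset.mem_univ j), Function.update_self] at h1
      have h2 : ∏ i ∈ Finset.univ.erase j, theta J (Function.update mus j mu' i) l = ∏ i ∈ Finset.univ.erase j, theta J (mus i) l :=
        Finset.prod_congr rfl fun i hi => by rw [Function.update_of_ne (Finset.ne_of_mem_erase hi)]
      have h3 : ∑ p ∈ (hfin (Function.update mus j mu')).toFinset, g (Function.update mus j mu') p * theta J p l =
          ∑ p ∈ S, g (Function.update mus j mu') p * theta J p l := by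
        refine Finset.sum_subset ?_ ?_
        · intro p hp
          refine Finset.mem_insert_of_mem (Finset.mem_union_right _ ?_)
          exact Finset.mem_biUnion.2 ⟨j, Finset.mem_univ _, Finset.mem_biUnion.2 ⟨mu', hmu, hp⟩⟩
        · intro p _ hp
          have : g (Function.update mus j mu') p = 0 := by simpa using hp
          rw [this, zero_mul]
      rw [h2, h3] at h1
      rw [mul_left_comm, mul_comm (∏ i ∈ Finset.univ.erase j, theta J (mus i) l), h1, Finset.mul_sum]
      exact Finset.sum_congr rfl fun _ _ => by ring
    simp only [sub_mul, Finset.sum_sub_distrib]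
    rw [← hL, ← hR, h, sub_self]

lemma Bm_self (n : ℕ+) (m m' : Exp) : Bm n n m m' = if m = m' + Finsupp.single n 1 then alpha⁻¹ else 0 := by
  rw [Bm, BBc_self, ← monomial_cons, coeff_smul, coeff_monomial]
  simp [eq_comm]

lemma g_deg (hJ : IsJackFamily J) {k : ℕ} {g : (Fin (k + 1) → JPartition) → JPartition → F}
    (hfin : ∀ mus : Fin (k + 1) → JPartition, {pi : JPartition | g mus pi ≠ 0}.Finite)
    (hdef : ∀ (mus : Fin (k + 1) → JPartition) (lam : JPartition),
      ∏ j, theta J (mus j) lam = ∑ pi ∈ (hfin mus).toFinset, g mus pi * theta J pi lam) (n : ℕ) :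
    ∀ (mus : Fin (k + 1) → JPartition), ∑ j, psize (mus j) = n → ∀ pi, n < psize pi → g mus pi = 0 := by
  induction n using Nat.strong_induction_on with
  | _ n ih =>
    intro mus hmus pi hpi
    by_contra hne
    obtain ⟨p0, hp0, hmax⟩ := Finset.exists_max_image (hfin mus).toFinset psize ⟨pi, by simpa using hne⟩
    have hp0' : g mus p0 ≠ 0 := by simpa using hp0
    have hs : n < psize p0 := hpi.trans_le (hmax pi (by simpa using hne))
    have : p0 ≠ 0 := by rintro rfl; simp at hs
    obtain ⟨r, hr⟩ := Multiset.exists_mem_of_ne_zero this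
    obtain ⟨p, rfl⟩ := Multiset.exists_cons_of_mem hr
    have hst := star hJ hfin hdef mus r p
    rw [psize_cons] at hs hmax
    obtain ⟨r', hr'⟩ : ∃ r', (r : ℕ) = r' + 1 := ⟨(r : ℕ) - 1, by have : 0 < (r : ℕ) := r.2; omega⟩
    have hBm : ∀ mu' : JPartition, psize mu' = psize p + r → Phi r mu' p = if mu' = r ::ₘ p then (-1 : F) ^ (r' + 1) * ((r' + 1 : F)⁻¹ * alpha⁻¹) else 0 := by
      intro mu' hmu
      rw [Phi_eq r r' mu' p (by omega), ← hr', Bm_self, ← toExp_cons]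
      by_cases h : mu' = r ::ₘ p
      · rw [if_pos h, if_pos (by rw [h])]
      · rw [if_neg h, if_neg fun h' => h (toExp_inj h'), mul_zero, mul_zero]
    have hPhi_lt : ∀ mu mu' : JPartition, psize mu < psize mu' + r → Phi r mu mu' = 0 := by
      intro mu mu' h
      refine Finset.sum_eq_zero fun q _ => ?_
      by_cases hq : psize mu = psize mu' + (q + 1)
      · rw [Bm, BBc_gt _ _ (by omega)]; simp
      · rw [Bm_wt, mul_zero, mul_zero]
        rwa [wt_toExp, wt_toExp]
    rw [Finset.sum_eq_single (r ::ₘ p), hBm _ (by rw [psize_cons]; ring), if_pos rfl, Finset.sum_eq_zero] at hst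
    · have h1 := natCast_ne r'
      have h2 := alpha_ne
      have : g mus (r ::ₘ p) * ((-1 : F) ^ (r' + 1) * ((r' + 1 : F)⁻¹ * alpha⁻¹)) ≠ 0 := by
        refine mul_ne_zero hp0' (mul_ne_zero (pow_ne_zero _ (neg_ne_zero.2 one_ne_zero)) (mul_ne_zero (inv_ne_zero h1) (inv_ne_zero h2)))
      exact this hst.symm
    · intro j _
      refine Finset.sum_eq_zero fun mu' hmu => ?_
      by_cases hlt : psize (mus j) < psize mu' + r
      · rw [hPhi_lt _ _ hlt, zero_mul]
      · have hsum : ∑ i, psize (Function.update mus j mu' i) + psize (mus j) = n + psize mu' := by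
          rw [← hmus, ← Finset.add_sum_erase _ _ (Finset.mem_univ j), ← Finset.add_sum_erase Finset.univ (fun i => psize (mus i)) (Finset.mem_univ j),
            Function.update_self]
          have : ∑ i ∈ Finset.univ.erase j, psize (Function.update mus j mu' i) = ∑ i ∈ Finset.univ.erase j, psize (mus i) :=
            Finset.sum_congr rfl fun i hi => by rw [Function.update_of_ne (Finset.ne_of_mem_erase hi)]
          rw [this]; ring
        have hr0 : 0 < (r : ℕ) := r.2
        have hz := ih (∑ i, psize (Function.update mus j mu' i)) (by omega) (Function.update mus j mu') rfl p (by omega)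
        rw [hz, mul_zero]
    · intro p' hp' hne'
      rcases lt_trichotomy (psize p') (psize p + r) with h | h | h
      · rw [hPhi_lt _ _ h, mul_zero]
      · rw [hBm _ h, if_neg hne', mul_zero]
      · have := hmax p' hp'
        omega
    · intro h
      exact absurd hp0 h

end JK
end

section
namespace JK
open MvPolynomial
variable {J : JPartition → SymA}

def ren : SymA →ₗ[F] PY := (rename Sum.inl : SymA →ₐ[F] PY).toLinearMap
lemma ren_apply (f : SymA) : ren f = rename Sum.inl f := rfl
lemma ren_mul (f g : SymA) : ren (f * g) = ren f * ren g := by simp [ren_apply]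
lemma ren_Pn (i : ℕ+) : ren (Pn i) = pv i := by rw [Pn_coe, ren_apply, rename_X]; rfl
lemma pderiv_ren (i : ℕ+) (f : SymA) : pderiv (Sum.inl i) (ren f) = ren (pderiv i f) := by
  rw [ren_apply, pderiv_rename Sum.inl_injective]; rfl
lemma pderiv_ren0 (i : ℕ) (f : SymA) : pderiv (Sum.inr i) (ren f) = 0 := by
  rw [ren_apply]
  refine pderiv_eq_zero_of_notMem_vars fun h => ?_
  have := vars_rename (Sum.inl : ℕ+ → ℕ+ ⊕ ℕ) f h
  simp at this

def emb : MM F →ₗ[F] PY := lif fun k => LinearMap.mulLeft F (yv k) ∘ₗ ren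
lemma emb_mon (k : ℕ) (f : SymA) : emb (mon k f) = yv k * ren f := by simp [emb]

lemma pderiv_emb (j : ℕ) (x : MM F) : pderiv (Sum.inr j) (emb x) = ren (x.coeff j) := by
  induction x using mon_ind with
  | h0 k f =>
    rw [emb_mon, Derivation.leibniz, pderiv_ren0, smul_zero, zero_add, yv, pderiv_X, mon_apply, Polynomial.coeff_monomial]
    by_cases h : k = j
    · subst h; simp
    · rw [if_neg h, Pi.single_eq_of_ne (by simpa using h)]; simp
  | ha x y hx hy => rw [map_add, map_add, hx, hy, Polynomial.coeff_add, map_add]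

lemma finsum_lif {V : Type*} [AddCommGroup V] [Module F V] (L : ℕ → SymA →ₗ[F] V) (x : MM F) :
    ∑ᶠ j : ℕ, L j (x.coeff j) = lif L x := by
  rw [finsum_eq_sum_of_support_subset (s := x.support)]
  · rfl
  · intro j hj
    rw [Finset.mem_coe, Polynomial.mem_support_iff]
    intro h
    exact hj (by simp [h])

lemma finsum_pnat {V : Type*} [AddCommGroup V] (φ : ℕ → V) (h0 : φ 0 = 0) :
    ∑ᶠ i : ℕ+, φ i = ∑ᶠ n : ℕ, φ n := by
  rw [← finsum_mem_range (f := φ) (g := fun i : ℕ+ => (i : ℕ)) PNat.coe_injective]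
  refine finsum_congr fun n => ?_
  rcases Nat.eq_zero_or_pos n with rfl | h
  · rw [h0]; simp
  · rw [finsum_eq_if, if_pos ⟨⟨n, h⟩, rfl⟩]

lemma finsum_pnat_succ {V : Type*} [AddCommGroup V] (φ : ℕ → V) :
    ∑ᶠ i : ℕ+, φ (i - 1) = ∑ᶠ n : ℕ, φ n :=
  finsum_comp_equiv (f := φ) Equiv.pnatEquivNat

lemma dd_coeff_zero (h : SymA) : (dd h).coeff 0 = 0 := by
  induction h using MvPolynomial.induction_on with
  | C a => rw [← mul_one (MvPolynomial.C a), ← MvPolynomial.smul_eq_C_mul, map_smul]; simp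
  | add f g hf hg => rw [map_add, Polynomial.coeff_add, hf, hg, add_zero]
  | mul_X f i hf =>
    rw [dd_mul, ← smul_eq_ml, ← smul_eq_ml, ← Pn_coe, dd_Pn]
    simp [hf, mon_apply, Polynomial.coeff_monomial]

lemma Yplus_emb (x : MM F) : Yplus (emb x) = emb (yp 1 x) := by
  simp only [Yplus, pderiv_emb]
  refine (finsum_lif (fun j => LinearMap.mulLeft F (yv (j + 1)) ∘ₗ ren) x).trans ?_
  refine sum_mon_eq _ (emb ∘ₗ yp 1) (fun k f => ?_) x
  simp [emb_mon]

lemma dropY_ren (f : SymA) : dropY (ren f) = f := by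
  rw [ren_apply, dropY, aeval_rename]
  exact aeval_X_left_apply f

lemma Theta_emb (x : MM F) : dropY (ThetaY (emb x)) = Th x := by
  simp only [ThetaY, pderiv_emb, ← ren_Pn]
  rw [finsum_pnat (fun i => ren (Pn i) * ren (x.coeff i)) (by simp)]
  refine (congrArg dropY (finsum_lif (fun j => LinearMap.mulLeft F (ren (Pn j)) ∘ₗ ren) x)).trans ?_
  refine sum_mon_eq (dropY.toLinearMap ∘ₗ lif (fun j => LinearMap.mulLeft F (ren (Pn j)) ∘ₗ ren)) Th (fun k f => ?_) x
  simp [dropY_ren]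

lemma N_emb (x : MM F) : (∑ᶠ i : ℕ+, ((i : ℕ) : F) •
      (yv ((i : ℕ) + 1) * MvPolynomial.pderiv (Sum.inr (i : ℕ)) (emb x))) = emb (yp 1 (NN x)) := by
  simp only [pderiv_emb]
  rw [finsum_pnat (fun i : ℕ => (i : F) • (yv (i + 1) * ren (x.coeff i))) (by simp)]
  refine (finsum_lif (fun j => (j : F) • (LinearMap.mulLeft F (yv (j + 1)) ∘ₗ ren)) x).trans ?_
  refine sum_mon_eq _ (emb ∘ₗ yp 1 ∘ₗ NN) (fun k f => ?_) x
  simp [emb_mon]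

lemma d_emb (x : MM F) : (∑ᶠ i : ℕ+, ∑ᶠ j : ℕ+, ((j : ℕ) : F) •
      (yv ((i : ℕ) + (j : ℕ)) *
        MvPolynomial.pderiv (Sum.inl j) (MvPolynomial.pderiv (Sum.inr ((i : ℕ) - 1)) (emb x)))) = emb (yp 1 (dl x)) := by
  have h : ∀ i : ℕ+, ∑ᶠ j : ℕ+, ((j : ℕ) : F) •
      (yv ((i : ℕ) + (j : ℕ)) *
        MvPolynomial.pderiv (Sum.inl j) (MvPolynomial.pderiv (Sum.inr ((i : ℕ) - 1)) (emb x))) =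
        emb (yp (((i : ℕ) - 1) + 1) (dd (x.coeff (i - 1)))) := by
    intro i
    have hi : (i : ℕ) - 1 + 1 = i := Nat.succ_pred_eq_of_pos i.2
    rw [hi]
    generalize hz : x.coeff ((i : ℕ) - 1) = h
    simp only [pderiv_emb, hz, pderiv_ren, ← mul_smul_comm, ← map_smul ren, ← dd_coeff]
    rw [finsum_pnat (fun j => yv (i + j) * ren ((dd h).coeff j)) (by simp [dd_coeff_zero])]
    refine (finsum_lif (fun j => LinearMap.mulLeft F (yv (i + j)) ∘ₗ ren) (dd h)).trans ?_
    refine sum_mon_eq _ (emb ∘ₗ yp i) (fun k f => ?_) (dd h)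
    simp [emb_mon, add_comm]
  simp only [h]
  rw [finsum_pnat_succ (fun n => emb (yp (n + 1) (dd (x.coeff n))))]
  refine (finsum_lif (fun n => emb ∘ₗ yp (n + 1) ∘ₗ dd) x).trans ?_
  refine sum_mon_eq _ (emb ∘ₗ yp 1 ∘ₗ dl) (fun k f => ?_) x
  simp [add_comm]

def Sn (n : ℕ) (x : MM F) : PY := ∑ᶠ j : ℕ+, yv (n + 1) * pv j * ren (x.coeff (n + j))

lemma Sn_fin (n : ℕ) (x : MM F) : (Function.support fun j : ℕ+ => yv (n + 1) * pv j * ren (x.coeff (n + j))).Finite := by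
  refine Set.Finite.subset (Set.Finite.preimage (f := fun j : ℕ+ => n + (j : ℕ)) ?_ x.support.finite_toSet) ?_
  · intro a _ b _ h
    exact PNat.coe_injective (by simpa using h)
  · intro j hj
    simp only [Set.mem_preimage, Finset.mem_coe, Polynomial.mem_support_iff]
    intro h
    exact hj (by simp [h])

lemma Sn_add (n : ℕ) (x y : MM F) : Sn n (x + y) = Sn n x + Sn n y := by
  rw [Sn, Sn, Sn, ← finsum_add_distrib (Sn_fin n x) (Sn_fin n y)]
  refine finsum_congr fun j => ?_
  rw [Polynomial.coeff_add, map_add, mul_add]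

lemma Sn_zero (n : ℕ) (x : MM F) (h : x.natDegree ≤ n) : Sn n x = 0 := by
  rw [Sn, ← finsum_zero]
  refine finsum_congr fun j => ?_
  rw [Polynomial.coeff_eq_zero_of_natDegree_lt (by have : 0 < (j : ℕ) := j.2; omega)]
  simp

lemma Sn_supp (x : MM F) : (Function.support fun n => Sn n x).Finite := by
  refine (Finset.range x.natDegree).finite_toSet.subset fun n hn => ?_
  rw [Finset.mem_coe, Finset.mem_range]
  by_contra h
  exact hn (Sn_zero n x (by omega))

lemma Sn_mon (n k : ℕ) (f : SymA) : Sn n (mon k f) = yv (n + 1) * ren (Pn (k - n) * f) := by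
  by_cases h : n < k
  · rw [Sn, finsum_eq_single _ (show ℕ+ from ⟨k - n, by omega⟩)]
    · rw [← ren_Pn, PNat.mk_coe, mon_apply, Polynomial.coeff_monomial, if_pos (by omega), mul_assoc, ren_mul]
    · intro j hj
      rw [mon_apply, Polynomial.coeff_monomial, if_neg, map_zero, mul_zero]
      intro h'
      exact hj (PNat.coe_injective (by rw [PNat.mk_coe]; omega))
  · rw [show k - n = 0 by omega, Pn_zero, zero_mul, map_zero, mul_zero]
    refine Sn_zero n _ ?_
    rw [mon_apply]
    exact (Polynomial.natDegree_monomial_le f).trans (by omega)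

lemma C_emb (x : MM F) : (∑ᶠ i : ℕ+, ∑ᶠ j : ℕ+,
      yv (i : ℕ) * pv j * MvPolynomial.pderiv (Sum.inr ((i : ℕ) + (j : ℕ) - 1)) (emb x)) = emb (yp 1 (CC x)) := by
  have h : ∀ i : ℕ+, ∑ᶠ j : ℕ+,
      yv (i : ℕ) * pv j * MvPolynomial.pderiv (Sum.inr ((i : ℕ) + (j : ℕ) - 1)) (emb x) = Sn (i - 1) x := by
    intro i
    have hi : (i : ℕ) - 1 + 1 = i := Nat.succ_pred_eq_of_pos i.2
    refine finsum_congr fun j => ?_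
    rw [hi, pderiv_emb, show (i : ℕ) + (j : ℕ) - 1 = i - 1 + j by omega]
  simp only [h]
  rw [finsum_pnat_succ (fun n => Sn n x)]
  clear h
  induction x using mon_ind with
  | h0 k f =>
    simp only [Sn_mon]
    rw [finsum_eq_sum_of_support_subset (s := Finset.range (k + 1)), CC_mon, map_sum, map_sum, ← Finset.sum_range_reflect]
    · refine Finset.sum_congr rfl fun j hj => ?_
      rw [Finset.mem_range] at hj
      rw [yp_mon, emb_mon, show k + 1 - 1 - j = k - j by omega, show k - (k - j) = j by omega]
    · intro n hn
      rw [Finset.mem_coe, Finset.mem_range]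
      by_contra h
      exact hn (by simp only [show k - n = 0 by omega, Pn_zero, zero_mul, map_zero, mul_zero])
  | ha x y hx hy =>
    simp only [Sn_add]
    rw [finsum_add_distrib (Sn_supp x) (Sn_supp y), map_add, map_add, map_add, hx, hy]

lemma Gamma_emb (x : MM F) : GammaY (emb x) = emb (Gam alpha 0 x) := by
  rw [GammaY, d_emb, C_emb, N_emb, Gam_apply]
  simp

def wl : List Bool → Module.End F (MM F)
  | [] => 1
  | b :: w => (if b then yp 1 else Gam alpha 0) * wl w

lemma word_emb (w : List Bool) (x : MM F) : wordOp w (emb x) = emb (wl w x) := by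
  induction w with
  | nil => rfl
  | cons b w ih =>
    rw [wordOp, ih]
    cases b
    · exact Gamma_emb _
    · exact Yplus_emb _

lemma wl_sum (n : ℕ) : ∀ l : ℕ, ∑ s : Fin n → Bool,
      (if (Finset.univ.filter fun i => s i = true).card = l then wl (List.ofFn s) else 0) =
      WW (Gam alpha 0 : Module.End F (MM F)) (yp 1) n l := by
  induction n with
  | zero =>
    intro l
    cases l
    · simp [WW, wl]
    · simp [WW]
  | succ n ih =>
    intro l
    rw [← Equiv.sum_comp (Fin.consEquiv fun _ => Bool), Fintype.sum_prod_type, Fintype.sum_bool]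
    simp only [Fin.card_filter_univ_succ, Fin.consEquiv_apply, Fin.cons_zero, Fin.cons_succ, List.ofFn_succ, wl, if_true,
      Bool.false_eq_true, if_false, Function.comp_def]
    cases l with
    | zero =>
      rw [WW, ← ih 0, Finset.mul_sum, Finset.sum_eq_zero, zero_add]
      · exact Finset.sum_congr rfl fun s _ => by rw [mul_ite, mul_zero]
      · intro s _; simp
    | succ l =>
      rw [WW, ← ih (l + 1), ← ih l, Finset.mul_sum, Finset.mul_sum, add_comm]
      simp only [mul_ite, mul_zero, add_left_inj]

lemma Bc_eq (n l : ℕ) (f : SymA) : Bc n l f = BBc n l f := by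
  have h : alpha⁻¹ • (yv 0 * rename Sum.inl f) = emb (alpha⁻¹ • mon 0 f) := by
    rw [map_smul, emb_mon]; rfl
  rw [Bc, h]
  simp only [word_emb]
  rw [← map_sum, Theta_emb, Finset.sum_filter]
  have := congrArg (fun A : Module.End F (MM F) => A (alpha⁻¹ • mon 0 f)) (wl_sum n l)
  simp only [LinearMap.sum_apply] at this
  have h2 : ∀ s : Fin n → Bool, (if (Finset.univ.filter fun i => s i = true).card = l then wl (List.ofFn s) (alpha⁻¹ • mon 0 f) else 0)
     = (if (Finset.univ.filter fun i => s i = true).card = l then wl (List.ofFn s) else 0) (alpha⁻¹ • mon 0 f) := by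
    intro s; split_ifs <;> rfl
  rw [Finset.sum_congr rfl fun s _ => h2 s, this, map_smul, map_smul]
  rfl

lemma Bmat_eq (n l : ℕ) (m m' : Exp) : Bmat n l m m' = Bm n l m m' := by
  rw [Bmat, Bc_eq, Bm]

end JK
end

section
namespace JK
open MvPolynomial
variable {J : JPartition → SymA}

lemma pPow_mono (l : JPartition) : pPow l = monomial (toExp l) 1 := by
  induction l using Multiset.induction_on with
  | empty => simp [pPow, toExp_zero]
  | cons i l ih =>
    rw [toExp_cons, monomial_cons, ← ih, Pn_coe, pPow, pPow, Multiset.map_cons, Multiset.prod_cons]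

lemma Gk_coeff {k : ℕ} {g : (Fin (k + 1) → JPartition) → JPartition → F}
    (hfin : ∀ mus : Fin (k + 1) → JPartition, {pi : JPartition | g mus pi ≠ 0}.Finite)
    (mus : Fin (k + 1) → JPartition) (K : ℕ) (p : JPartition) :
    coeff (toExp p) (GkSeriesCoef k g mus K) =
      if psize p + K = ∑ j, psize (mus j) then g mus p / zalpha (toExp p) else 0 := by
  rw [GkSeriesCoef, finsum_eq_sum_of_support_subset (s := (hfin mus).toFinset), coeff_sum]
  · have h : ∀ q : JPartition, coeff (toExp p) (if psize q + K = ∑ j, psize (mus j) then (g mus q / zalpha (toExp q)) • pPow q else 0)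
      = if q = p then (if psize p + K = ∑ j, psize (mus j) then g mus p / zalpha (toExp p) else 0) else 0 := by
      intro q
      by_cases hq : q = p
      · subst hq
        rw [if_pos rfl]
        split_ifs
        · rw [coeff_smul, pPow_mono, coeff_monomial, if_pos rfl, smul_eq_mul, mul_one]
        · rw [coeff_zero]
      · rw [if_neg hq]
        split_ifs
        · rw [coeff_smul, pPow_mono, coeff_monomial, if_neg (fun h => hq (toExp_inj h)), smul_zero]
        · rw [coeff_zero]
    rw [Finset.sum_congr rfl fun q _ => h q, Finset.sum_ite_eq']
    split_ifs with h1 h2 h3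
    · rfl
    · rfl
    · have : g mus p = 0 := by simpa using h1
      rw [this, zero_div]
    · rfl
  · intro q hq
    rw [Set.Finite.coe_toFinset]
    intro h
    refine hq ?_
    simp only [h, zero_div, zero_smul, ite_self]

lemma Bperp_coeff (n l : ℕ) (f : SymA) (p : Exp) :
    coeff p (Bperp n l f) = ∑ m' ∈ f.support, coeff m' f * (Bm n l m' p * zalpha m' / zalpha p) := by
  rw [Bperp, coeff_sum]
  refine Finset.sum_congr rfl fun m' _ => ?_
  rw [coeff_smul, smul_eq_mul]
  congr 1
  rw [finsum_eq_sum_of_support_subset (s := insert p ((Tn (wt m' + 1)).image toExp)), coeff_sum, Finset.sum_eq_single p]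
  · rw [coeff_smul, coeff_monomial, if_pos rfl, smul_eq_mul, mul_one, Bmat_eq]
  · intro q _ hq
    rw [coeff_smul, coeff_monomial, if_neg hq, smul_zero]
  · intro h
    exact absurd (Finset.mem_insert_self _ _) h
  · intro m hm
    obtain ⟨mu, rfl⟩ := toExp_surj m
    refine Finset.mem_coe.2 (Finset.mem_insert_of_mem (Finset.mem_image_of_mem _ (mem_Tn.2 ?_)))
    by_contra h
    refine hm ?_
    simp only
    rw [Bmat_eq, Bm_wt, zero_mul, zero_div, zero_smul]
    rw [wt_toExp]
    omega

lemma Bperp_Gk {k : ℕ} {g : (Fin (k + 1) → JPartition) → JPartition → F}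
    (hfin : ∀ mus : Fin (k + 1) → JPartition, {pi : JPartition | g mus pi ≠ 0}.Finite)
    (mus : Fin (k + 1) → JPartition) (n l K : ℕ) (p : JPartition) :
    coeff (toExp p) (Bperp n l (GkSeriesCoef k g mus K)) =
      ∑ q ∈ (hfin mus).toFinset, (if psize q + K = ∑ j, psize (mus j) then
        g mus q * Bm n l (toExp q) (toExp p) / zalpha (toExp p) else 0) := by
  rw [Bperp_coeff, Finset.sum_subset (s₂ := (hfin mus).toFinset.image toExp), Finset.sum_image (fun a _ b _ h => toExp_inj h)]
  · refine Finset.sum_congr rfl fun q _ => ?_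
    rw [Gk_coeff hfin]
    have := zalpha_ne (toExp q)
    split_ifs
    · field_simp
    · rw [zero_mul]
  · intro m hm
    obtain ⟨mu, rfl⟩ := toExp_surj m
    refine Finset.mem_image_of_mem _ ?_
    rw [mem_support_iff, Gk_coeff hfin] at hm
    rw [Set.Finite.mem_toFinset]
    intro h
    refine hm ?_
    simp only [h, zero_div, ite_self]
  · intro m _ hm
    rw [notMem_support_iff.1 hm, zero_mul]

lemma sum_update {k : ℕ} (mus : Fin (k + 1) → JPartition) (j : Fin (k + 1)) (mu' : JPartition) :
    ∑ i, psize (Function.update mus j mu' i) + psize (mus j) = ∑ i, psize (mus i) + psize mu' := by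
  rw [← Finset.add_sum_erase _ _ (Finset.mem_univ j), ← Finset.add_sum_erase Finset.univ (fun i => psize (mus i)) (Finset.mem_univ j),
    Function.update_self]
  have : ∑ i ∈ Finset.univ.erase j, psize (Function.update mus j mu' i) = ∑ i ∈ Finset.univ.erase j, psize (mus i) :=
    Finset.sum_congr rfl fun i hi => by rw [Function.update_of_ne (Finset.ne_of_mem_erase hi)]
  rw [this]; ring

lemma left_term (hJ : IsJackFamily J) {k : ℕ} {g : (Fin (k + 1) → JPartition) → JPartition → F}
    (hfin : ∀ mus : Fin (k + 1) → JPartition, {pi : JPartition | g mus pi ≠ 0}.Finite)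
    (hdef : ∀ (mus : Fin (k + 1) → JPartition) (lam : JPartition),
      ∏ j, theta J (mus j) lam = ∑ pi ∈ (hfin mus).toFinset, g mus pi * theta J pi lam)
    (mus : Fin (k + 1) → JPartition) (l K : ℕ) (p : JPartition) (j : Fin (k + 1)) (mu' : JPartition)
    (hmu : psize mu' < psize (mus j)) :
    ∑ n ∈ Finset.Icc 1 K, ((-1 : F) ^ n / (n : F)) * (Bm n l (toExp (mus j)) (toExp mu') *
      (if psize p + (K - n) = ∑ i, psize (Function.update mus j mu' i) then
        g (Function.update mus j mu') p / zalpha (toExp p) else 0)) =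
    if psize p + K = ∑ j, psize (mus j) then (Phi l (mus j) mu' * g (Function.update mus j mu') p) / zalpha (toExp p) else 0 := by
  have hs := sum_update mus j mu'
  obtain ⟨d, hd⟩ : ∃ d, psize (mus j) = psize mu' + (d + 1) := ⟨psize (mus j) - psize mu' - 1, by omega⟩
  have hz : ∀ n, n ≠ d + 1 → Bm n l (toExp (mus j)) (toExp mu') = 0 := by
    intro n hn
    refine Bm_wt _ _ _ _ ?_
    rw [wt_toExp, wt_toExp]; omega
  by_cases hK : d + 1 ≤ K
  · rw [Finset.sum_eq_single (d + 1)]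
    · rw [Phi_eq l d _ _ hd]
      by_cases hp : psize p + K = ∑ j, psize (mus j)
      · rw [if_pos hp, if_pos (by omega)]
        push_cast
        ring
      · rw [if_neg hp, if_neg (by omega), mul_zero, mul_zero]
    · intro n _ hn
      rw [hz n hn, zero_mul, mul_zero]
    · intro h
      exact absurd (Finset.mem_Icc.2 ⟨by omega, hK⟩) h
  · rw [Finset.sum_eq_zero]
    · by_cases hp : psize p + K = ∑ j, psize (mus j)
      · rw [g_deg hJ hfin hdef _ _ rfl p (by omega), mul_zero, zero_div, ite_self]
      · rw [if_neg hp]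
    · intro n hn
      rw [Finset.mem_Icc] at hn
      rw [hz n (by omega), zero_mul, mul_zero]

lemma right_term (hJ : IsJackFamily J) {k : ℕ} {g : (Fin (k + 1) → JPartition) → JPartition → F}
    (hfin : ∀ mus : Fin (k + 1) → JPartition, {pi : JPartition | g mus pi ≠ 0}.Finite)
    (hdef : ∀ (mus : Fin (k + 1) → JPartition) (lam : JPartition),
      ∏ j, theta J (mus j) lam = ∑ pi ∈ (hfin mus).toFinset, g mus pi * theta J pi lam)
    (mus : Fin (k + 1) → JPartition) (l K : ℕ) (p q : JPartition) :
    ∑ n ∈ Finset.Icc 1 K, ((-1 : F) ^ n / (n : F)) * (if psize q + (K - n) = ∑ j, psize (mus j) then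
        g mus q * Bm n l (toExp q) (toExp p) / zalpha (toExp p) else 0) =
    if psize p + K = ∑ j, psize (mus j) then (g mus q * Phi l q p) / zalpha (toExp p) else 0 := by
  have hz : ∀ n, psize q ≠ psize p + n → Bm n l (toExp q) (toExp p) = 0 := by
    intro n hn
    refine Bm_wt _ _ _ _ ?_
    rwa [wt_toExp, wt_toExp]
  by_cases hlt : psize q ≤ psize p
  · rw [Phi_zero _ _ _ hlt, mul_zero, zero_div, ite_self]
    refine Finset.sum_eq_zero fun n hn => ?_
    rw [Finset.mem_Icc] at hn
    rw [hz n (by omega), mul_zero, zero_div, ite_self, mul_zero]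
  obtain ⟨d, hd⟩ : ∃ d, psize q = psize p + (d + 1) := ⟨psize q - psize p - 1, by omega⟩
  by_cases hK : d + 1 ≤ K
  · rw [Finset.sum_eq_single (d + 1)]
    · rw [Phi_eq l d _ _ hd]
      by_cases hp : psize p + K = ∑ j, psize (mus j)
      · rw [if_pos hp, if_pos (by omega)]
        push_cast
        ring
      · rw [if_neg hp, if_neg (by omega), mul_zero]
    · intro n _ hn
      rw [hz n (by omega), mul_zero, zero_div, ite_self, mul_zero]
    · intro h
      exact absurd (Finset.mem_Icc.2 ⟨by omega, hK⟩) h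
  · rw [Finset.sum_eq_zero]
    · by_cases hp : psize p + K = ∑ j, psize (mus j)
      · rw [g_deg hJ hfin hdef _ mus rfl q (by omega), zero_mul, zero_div, ite_self]
      · rw [if_neg hp]
    · intro n hn
      rw [Finset.mem_Icc] at hn
      rw [hz n (by omega), mul_zero, zero_div, ite_self, mul_zero]

lemma left_coeff {k : ℕ} {g : (Fin (k + 1) → JPartition) → JPartition → F}
    (hfin : ∀ mus : Fin (k + 1) → JPartition, {pi : JPartition | g mus pi ≠ 0}.Finite)
    (mus : Fin (k + 1) → JPartition) (n l K : ℕ) (hn : 1 ≤ n) (p : JPartition) (j : Fin (k + 1)) :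
    coeff (toExp p) (∑ᶠ mu' : JPartition,
          Bmat n l (toExp (mus j)) (toExp mu') •
            GkSeriesCoef k g (Function.update mus j mu') K) =
    ∑ mu' ∈ Tn (psize (mus j)), Bm n l (toExp (mus j)) (toExp mu') *
      (if psize p + K = ∑ i, psize (Function.update mus j mu' i) then
        g (Function.update mus j mu') p / zalpha (toExp p) else 0) := by
  rw [finsum_eq_sum_of_support_subset (s := Tn (psize (mus j))), coeff_sum]
  · refine Finset.sum_congr rfl fun mu' _ => ?_
    rw [coeff_smul, Gk_coeff hfin, Bmat_eq, smul_eq_mul]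
  · intro mu' h
    rw [Finset.mem_coe, mem_Tn]
    by_contra hlt
    refine h ?_
    simp only
    rw [Bmat_eq, Bm_wt, zero_smul]
    rw [wt_toExp, wt_toExp]; omega

lemma final (hJ : IsJackFamily J) {k : ℕ} {g : (Fin (k + 1) → JPartition) → JPartition → F}
    (hfin : ∀ mus : Fin (k + 1) → JPartition, {pi : JPartition | g mus pi ≠ 0}.Finite)
    (hdef : ∀ (mus : Fin (k + 1) → JPartition) (lam : JPartition),
      ∏ j, theta J (mus j) lam = ∑ᶠ pi : JPartition, g mus pi * theta J pi lam)
    (mus : Fin (k + 1) → JPartition) (l K : ℕ) :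
    (∑ n ∈ Finset.Icc 1 K, ((-1 : F) ^ n / (n : F)) •
        ∑ j : Fin (k + 1), ∑ᶠ mu' : JPartition,
          Bmat n l (toExp (mus j)) (toExp mu') •
            GkSeriesCoef k g (Function.update mus j mu') (K - n))
    = ∑ n ∈ Finset.Icc 1 K, ((-1 : F) ^ n / (n : F)) •
        Bperp n l (GkSeriesCoef k g mus (K - n)) := by
  have hdef' : ∀ (mus : Fin (k + 1) → JPartition) (lam : JPartition),
      ∏ j, theta J (mus j) lam = ∑ pi ∈ (hfin mus).toFinset, g mus pi * theta J pi lam := by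
    intro mus lam
    rw [hdef, finsum_eq_sum_of_support_subset]
    intro q hq
    rw [Set.Finite.coe_toFinset]
    intro h
    exact hq (by simp only [h, zero_mul])
  refine MvPolynomial.ext _ _ fun m => ?_
  obtain ⟨p, rfl⟩ := toExp_surj m
  have hL : ∀ n ∈ Finset.Icc 1 K, coeff (toExp p) (((-1 : F) ^ n / (n : F)) •
        ∑ j : Fin (k + 1), ∑ᶠ mu' : JPartition,
          Bmat n l (toExp (mus j)) (toExp mu') •
            GkSeriesCoef k g (Function.update mus j mu') (K - n)) =
      ∑ j, ∑ mu' ∈ Tn (psize (mus j)), ((-1 : F) ^ n / (n : F)) * (Bm n l (toExp (mus j)) (toExp mu') *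
      (if psize p + (K - n) = ∑ i, psize (Function.update mus j mu' i) then
        g (Function.update mus j mu') p / zalpha (toExp p) else 0)) := by
    intro n hn
    rw [coeff_smul, coeff_sum, smul_eq_mul, Finset.mul_sum]
    refine Finset.sum_congr rfl fun j _ => ?_
    rw [left_coeff hfin mus n l (K - n) (Finset.mem_Icc.1 hn).1 p j, Finset.mul_sum]
  have hR : ∀ n ∈ Finset.Icc 1 K, coeff (toExp p) (((-1 : F) ^ n / (n : F)) •
        Bperp n l (GkSeriesCoef k g mus (K - n))) =
      ∑ q ∈ (hfin mus).toFinset, ((-1 : F) ^ n / (n : F)) * (if psize q + (K - n) = ∑ j, psize (mus j) then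
        g mus q * Bm n l (toExp q) (toExp p) / zalpha (toExp p) else 0) := by
    intro n hn
    rw [coeff_smul, smul_eq_mul, Bperp_Gk hfin, Finset.mul_sum]
  rw [coeff_sum, coeff_sum, Finset.sum_congr rfl hL, Finset.sum_congr rfl hR, Finset.sum_comm,
    Finset.sum_comm (t := (hfin mus).toFinset)]
  have h1 : ∀ j, ∑ n ∈ Finset.Icc 1 K, ∑ mu' ∈ Tn (psize (mus j)), ((-1 : F) ^ n / (n : F)) * (Bm n l (toExp (mus j)) (toExp mu') *
      (if psize p + (K - n) = ∑ i, psize (Function.update mus j mu' i) then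
        g (Function.update mus j mu') p / zalpha (toExp p) else 0)) =
      ∑ mu' ∈ Tn (psize (mus j)), if psize p + K = ∑ j, psize (mus j) then (Phi l (mus j) mu' * g (Function.update mus j mu') p) / zalpha (toExp p) else 0 := by
    intro j
    rw [Finset.sum_comm]
    exact Finset.sum_congr rfl fun mu' hmu => left_term hJ hfin hdef' mus l K p j mu' (mem_Tn.1 hmu)
  rw [Finset.sum_congr rfl fun j _ => h1 j,
    Finset.sum_congr rfl fun q _ => right_term hJ hfin hdef' mus l K p q]
  by_cases hp : psize p + K = ∑ j, psize (mus j)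
  · simp only [if_pos hp, ← Finset.sum_div]
    rw [star hJ hfin hdef' mus l p]
  · simp only [if_neg hp, Finset.sum_const_zero]

end JK
end

/-- **Theorem 4.6.** For `k ≥ 1` and `k+2` alphabets `p, q^{(0)}, …, q^{(k)}`, the series
`G_k^{(α)}` satisfies
`(B_∞^{(α)}(-t,q^{(0)},u) + ⋯ + B_∞^{(α)}(-t,q^{(k)},u)) ⬝ G_k^{(α)}
   = B_∞^{(α)⊥}(-t,p,u) ⬝ G_k^{(α)}`,
where `g^π_{μ^{(0)},…,μ^{(k)}}` are the structure coefficients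
`θ_{μ^{(0)}}^{(α)} ⋯ θ_{μ^{(k)}}^{(α)} = ∑_π g^π_{μ^{(0)},…,μ^{(k)}} θ_π^{(α)}`.
The identity is stated coefficientwise in the monomials of `q^{(0)}, …, q^{(k)}`, in
`u^ℓ` and `t^K`, the coefficients lying in `ℚ(α)[p]`. -/
theorem statement11
    (J : JPartition → SymA) (hJ : IsJackFamily J)
    (k : ℕ) (hk : 1 ≤ k)
    (g : (Fin (k + 1) → JPartition) → JPartition → F)
    (hfin : ∀ mus : Fin (k + 1) → JPartition, {pi : JPartition | g mus pi ≠ 0}.Finite)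
    (hdef : ∀ (mus : Fin (k + 1) → JPartition) (lam : JPartition),
      ∏ j, theta J (mus j) lam = ∑ᶠ pi : JPartition, g mus pi * theta J pi lam)
    (mus : Fin (k + 1) → JPartition) (ℓ K : ℕ) :
    (∑ n ∈ Finset.Icc 1 K, ((-1 : F) ^ n / (n : F)) •
        ∑ j : Fin (k + 1), ∑ᶠ mu' : JPartition,
          Bmat n ℓ (toExp (mus j)) (toExp mu') •
            GkSeriesCoef k g (Function.update mus j mu') (K - n))
    = ∑ n ∈ Finset.Icc 1 K, ((-1 : F) ^ n / (n : F)) •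
        Bperp n ℓ (GkSeriesCoef k g mus (K - n)) :=
  JK.final hJ hfin hdef mus ℓ K

end
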